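/- Let χ and ν be distinct Dirichlet characters modulo q. Then ∫_T^{2T} |L(1/2+it, χ)·L(1/2+it, ν)|² dt = D(χ,ν)·T(log T)² + O_q(T log T), where D(χ,ν) = (6/π²)·|L(1, χν̄)|²·(φ(q)/q)·∏_{p | q}(1 − 1/(p+1)), the product running over the primes p dividing q, χν̄ denoting the product of χ with the conjugate character of ν, and φ denoting Euler's totient function. -/

import Mathlib

open Complex Filter MeasureTheory Finset HurwitzZeta
open scoped ArithmeticFunction Real Classical

noncomputable section

/-- The finite set of primes `p ≤ X`. -/
def primesUpTo (X : ℝ) : Finset ℕ :=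
  (Finset.range (Nat.floor X + 1)).filter (fun p => p.Prime ∧ (p : ℝ) ≤ X)

/-- The finite set of naturals `n ≤ X`. -/
def natsUpTo (X : ℝ) : Finset ℕ :=
  (Finset.range (Nat.floor X + 1)).filter (fun n => (n : ℝ) ≤ X)

/-- Truncated Euler product `P_X(s,χ)`, defined via the primitive character `χ*` inducing `χ`:
`P_X(s,χ) = ∏_{p ∣ q} (1 - χ*(p) p^{-s}) · exp(∑_{n ≤ X} χ*(n) Λ(n) / (n^s log n))`. -/
def PX {q : ℕ} (X : ℝ) (χ : DirichletCharacter ℂ q) (s : ℂ) : ℂ :=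
  (∏ p ∈ q.primeFactors, (1 - χ.primitiveCharacter ((p : ℕ) : ZMod χ.conductor) * (p : ℂ) ^ (-s))) *
    Complex.exp (∑ n ∈ natsUpTo X,
      χ.primitiveCharacter ((n : ℕ) : ZMod χ.conductor) * (Λ n : ℂ) / ((n : ℂ) ^ s * (Real.log n : ℂ)))

/-- `𝓟_X^ℓ(s) = ∏_χ P_X(s,χ)^{ℓ_χ}`. -/
def PXl {q : ℕ} (X : ℝ) (ℓ : DirichletCharacter ℂ q → ℕ) (s : ℂ) : ℂ :=
  ∏ χ : DirichletCharacter ℂ q, (PX X χ s) ^ (ℓ χ)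

/-- A Dirichlet character as an arithmetic function. -/
def chiArith {q : ℕ} (χ : DirichletCharacter ℂ q) : ArithmeticFunction ℂ :=
  ⟨fun n => if n = 0 then 0 else χ ((n : ℕ) : ZMod q), by simp⟩

/-- `d_ℓ`, the coefficients of the Dirichlet series of `𝓛^ℓ(s) = ∏_χ L(s,χ)^{ℓ_χ}`,
i.e. the Dirichlet convolution product `∏_χ χ^{*ℓ_χ}`. -/
def dcoef {q : ℕ} (ℓ : DirichletCharacter ℂ q → ℕ) : ArithmeticFunction ℂ :=
  ∏ χ : DirichletCharacter ℂ q, (chiArith χ) ^ (ℓ χ)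

/-- `P*_X(s,χ) = ∏_{p ≤ X}(1 − χ(p)p^{−s})^{−1} · ∏_{√X < p ≤ X}(1 + χ(p)²/(2p^{2s}))^{−1}`. -/
def PstarX {q : ℕ} (X : ℝ) (χ : DirichletCharacter ℂ q) (s : ℂ) : ℂ :=
  ((primesUpTo X).prod (fun p : ℕ => (1 - χ ((p : ℕ) : ZMod q) * (p : ℂ) ^ (-s))⁻¹)) *
    ((primesUpTo X).filter (fun p : ℕ => Real.sqrt X < (p : ℝ))).prod
      (fun p : ℕ => (1 + χ ((p : ℕ) : ZMod q) ^ 2 / (2 * (p : ℂ) ^ (2 * s)))⁻¹)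

/-- `𝓟*_X^ℓ(s) = ∏_χ P*_X(s,χ)^{ℓ_χ}`. -/
def PstarXl {q : ℕ} (X : ℝ) (ℓ : DirichletCharacter ℂ q → ℕ) (s : ℂ) : ℂ :=
  ∏ χ : DirichletCharacter ℂ q, (PstarX X χ s) ^ (ℓ χ)

/-- `Q_X(s,χ) = ∏_{p ≤ √X}(1 − χ(p)p^{−s}) · ∏_{√X < p ≤ X}(1 − χ(p)p^{−s} + χ(p)²/(2p^{2s}))`. -/
def QX {q : ℕ} (X : ℝ) (χ : DirichletCharacter ℂ q) (s : ℂ) : ℂ :=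
  (((primesUpTo X).filter (fun p : ℕ => (p : ℝ) ≤ Real.sqrt X)).prod
      (fun p : ℕ => 1 - χ ((p : ℕ) : ZMod q) * (p : ℂ) ^ (-s))) *
    ((primesUpTo X).filter (fun p : ℕ => Real.sqrt X < (p : ℝ))).prod
      (fun p : ℕ => 1 - χ ((p : ℕ) : ZMod q) * (p : ℂ) ^ (-s)
        + χ ((p : ℕ) : ZMod q) ^ 2 / (2 * (p : ℂ) ^ (2 * s)))

/-- `𝓠_X^ℓ(s) = ∏_χ Q_X(s,χ)^{ℓ_χ}`. -/
def QXl {q : ℕ} (X : ℝ) (ℓ : DirichletCharacter ℂ q → ℕ) (s : ℂ) : ℂ :=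
  ∏ χ : DirichletCharacter ℂ q, (QX X χ s) ^ (ℓ χ)

/-- `𝓛^ℓ(s) = ∏_χ L(s,χ)^{ℓ_χ}`. -/
def Ll {q : ℕ} [NeZero q] (ℓ : DirichletCharacter ℂ q → ℕ) (s : ℂ) : ℂ :=
  ∏ χ : DirichletCharacter ℂ q, (DirichletCharacter.LFunction χ s) ^ (ℓ χ)

/-- GRH for the Dirichlet L-functions modulo `q`: every zero `ρ` of `L(s,χ)` with
`0 < Re ρ < 1` satisfies `Re ρ = 1/2`. -/
def GRHmod (q : ℕ) [NeZero q] : Prop :=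
  ∀ χ : DirichletCharacter ℂ q, ∀ ρ : ℂ,
    DirichletCharacter.LFunction χ ρ = 0 → 0 < ρ.re → ρ.re < 1 → ρ.re = 1 / 2

end

namespace MeanSquareL

open scoped Topology

/-- The sawtooth kernel `θ - 1/2` against an exponential of nonzero integer frequency. -/
lemma integral_sawtooth_exp {h : ℤ} (hh : h ≠ 0) :
    ∫ θ in (0:ℝ)..1, ((θ:ℂ) - 1/2) * cexp (2 * π * I * h * θ) = 1 / (2 * π * I * h) := by
  have hc : (2 * π * I * h : ℂ) ≠ 0 := by
    simp [Real.pi_ne_zero, hh, I_ne_zero]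
  set c : ℂ := 2 * π * I * h with hcdef
  have hexp : cexp c = 1 := by
    rw [hcdef, Complex.exp_eq_one_iff]; exact ⟨h, by ring⟩
  have hder : ∀ x ∈ Set.uIcc (0:ℝ) 1, HasDerivAt
      (fun θ : ℝ => ((θ:ℂ) - 1/2) * (cexp (c * θ) / c) - cexp (c * θ) / c ^ 2)
      (((x:ℂ) - 1/2) * cexp (c * x)) x := by
    intro x _
    have h0 : HasDerivAt (fun θ : ℝ => (θ:ℂ)) 1 x := Complex.ofRealCLM.hasDerivAt
    have h1 : HasDerivAt (fun θ : ℝ => cexp (c * θ)) (cexp (c * x) * (c * 1)) x :=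
      (h0.const_mul c).cexp
    have h2 := ((h0.sub_const (1/2)).mul (h1.div_const c)).sub (h1.div_const (c^2))
    refine h2.congr_deriv ?_
    field_simp
    ring
  rw [intervalIntegral.integral_eq_sub_of_hasDerivAt hder]
  · simp [hexp]
    ring
  · apply Continuous.intervalIntegrable; fun_prop

lemma integral_exp_int {h : ℤ} (hh : h ≠ 0) :
    ∫ θ in (0:ℝ)..1, cexp (2 * π * I * h * θ) = 0 := by
  have hc : (2 * π * I * h : ℂ) ≠ 0 := by
    simp [Real.pi_ne_zero, hh, I_ne_zero]
  have hexp : cexp (2 * π * I * h) = 1 := by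
    rw [Complex.exp_eq_one_iff]; exact ⟨h, by ring⟩
  rw [integral_exp_mul_complex hc]
  simp [hexp]

/-- The square of a finite exponential sum, expanded. -/
lemma normSq_expsum (s : Finset ℕ) (x : ℕ → ℂ) (e : ℕ → ℂ) (he : ∀ m, (starRingEnd ℂ) (e m) = (e m)⁻¹) :
    ((‖∑ m ∈ s, x m * e m‖ ^ 2 : ℝ) : ℂ) =
      ∑ m ∈ s, ∑ n ∈ s, x m * (starRingEnd ℂ) (x n) * (e m * (e n)⁻¹) := by
  rw [Complex.ofReal_pow, ← Complex.mul_conj', map_sum, Finset.sum_mul_sum]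
  refine Finset.sum_congr rfl fun m _ => Finset.sum_congr rfl fun n _ => ?_
  rw [map_mul, he]; ring

lemma conj_exp_I (r : ℝ) : (starRingEnd ℂ) (cexp (r * I)) = (cexp (r * I))⁻¹ := by
  rw [← Complex.exp_conj, ← Complex.exp_neg]; simp

/-- Hilbert's inequality. -/
lemma hilbert_ineq (s : Finset ℕ) (x : ℕ → ℂ) :
    ‖∑ m ∈ s, ∑ n ∈ s, if m = n then 0 else x m * (starRingEnd ℂ) (x n) / ((m:ℂ) - n)‖
      ≤ π * ∑ n ∈ s, ‖x n‖ ^ 2 := by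
  set e : ℝ → ℕ → ℂ := fun θ m => cexp ((2 * π * m * θ : ℝ) * I) with he
  have hee : ∀ θ m n, e θ m * (e θ n)⁻¹ = cexp (2 * π * I * ((m - n : ℤ) : ℂ) * θ) := by
    intro θ m n
    rw [he]; simp only
    rw [← Complex.exp_neg, ← Complex.exp_add]; congr 1; push_cast; ring
  have hsq : ∀ θ : ℝ, ((‖∑ m ∈ s, x m * e θ m‖ ^ 2 : ℝ) : ℂ) =
      ∑ m ∈ s, ∑ n ∈ s, x m * (starRingEnd ℂ) (x n) * cexp (2 * π * I * ((m - n : ℤ) : ℂ) * θ) := by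
    intro θ
    rw [normSq_expsum s x (e θ) (fun m => conj_exp_I _)]
    simp only [hee]
  have hcont : Continuous fun θ : ℝ => ‖∑ m ∈ s, x m * e θ m‖ ^ 2 := by
    simp only [he]; fun_prop
  have key1 : ∫ θ in (0:ℝ)..1, ‖∑ m ∈ s, x m * e θ m‖ ^ 2 = ∑ n ∈ s, ‖x n‖ ^ 2 := by
    have : ((∫ θ in (0:ℝ)..1, ‖∑ m ∈ s, x m * e θ m‖ ^ 2 : ℝ) : ℂ)
        = ((∑ n ∈ s, ‖x n‖ ^ 2 : ℝ) : ℂ) := by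
      rw [← intervalIntegral.integral_ofReal]
      simp only [hsq]
      rw [intervalIntegral.integral_finsetSum
        (fun m _ => Continuous.intervalIntegrable (by fun_prop) _ _)]
      push_cast
      refine Finset.sum_congr rfl fun m hm => ?_
      rw [intervalIntegral.integral_finsetSum
        (fun n _ => Continuous.intervalIntegrable (by fun_prop) _ _), Finset.sum_eq_single m]
      · simp [Complex.mul_conj']
      · intro n _ hnm
        have hz : (m - n : ℤ) ≠ 0 := by
          intro h'; apply hnm; omega
        have := integral_exp_int hz
        push_cast at this
        rw [intervalIntegral.integral_const_mul, this, mul_zero]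
      · exact fun h => absurd hm h
    exact_mod_cast this
  have key2 : (∑ m ∈ s, ∑ n ∈ s, if m = n then 0 else x m * (starRingEnd ℂ) (x n) / ((m:ℂ) - n))
      = (2 * π * I) * ∫ θ in (0:ℝ)..1, ((θ:ℂ) - 1/2) * ((‖∑ m ∈ s, x m * e θ m‖ ^ 2 : ℝ) : ℂ) := by
    simp only [hsq, Finset.mul_sum]
    rw [intervalIntegral.integral_finsetSum
      (fun m _ => Continuous.intervalIntegrable (by fun_prop) _ _), Finset.mul_sum]
    refine Finset.sum_congr rfl fun m hm => ?_
    rw [intervalIntegral.integral_finsetSum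
      (fun m _ => Continuous.intervalIntegrable (by fun_prop) _ _), Finset.mul_sum]
    refine Finset.sum_congr rfl fun n hn => ?_
    have : ∀ θ : ℝ, ((θ:ℂ) - 1/2) * (x m * (starRingEnd ℂ) (x n) *
        cexp (2 * π * I * ((m - n : ℤ) : ℂ) * θ)) = (x m * (starRingEnd ℂ) (x n)) *
        (((θ:ℂ) - 1/2) * cexp (2 * π * I * ((m - n : ℤ) : ℂ) * θ)) := fun θ => by ring
    simp only [this]
    rw [intervalIntegral.integral_const_mul]
    split_ifs with h
    · subst h
      have h0 : ∫ θ in (0:ℝ)..1, ((θ:ℂ) - 1/2) = 0 := by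
        have : ∀ θ : ℝ, ((θ:ℂ) - 1/2) = ((θ - 1/2 : ℝ) : ℂ) := fun θ => by push_cast; ring
        simp only [this]
        rw [intervalIntegral.integral_ofReal]
        norm_num [integral_id]
      simp at h0 ⊢
      exact Or.inr h0
    · have hz : (m - n : ℤ) ≠ 0 := by
        intro h'; apply h; omega
      rw [integral_sawtooth_exp hz]
      have h1 : ((m:ℂ) - n) ≠ 0 := by exact_mod_cast hz
      have h2 : (π:ℂ) ≠ 0 := by exact_mod_cast Real.pi_ne_zero
      push_cast
      field_simp [I_ne_zero]
  rw [key2, norm_mul]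
  have hn : ‖(2 * π * I : ℂ)‖ = 2 * π := by
    simp [abs_of_pos Real.pi_pos]
  rw [hn, ← key1]
  have hb : ‖∫ θ in (0:ℝ)..1, ((θ:ℂ) - 1/2) * ((‖∑ m ∈ s, x m * e θ m‖ ^ 2 : ℝ) : ℂ)‖ ≤
      ∫ θ in (0:ℝ)..1, (1/2) * ‖∑ m ∈ s, x m * e θ m‖ ^ 2 := by
    apply intervalIntegral.norm_integral_le_of_norm_le zero_le_one
    · refine ae_of_all _ fun θ hθ => ?_
      rw [norm_mul]
      have h1 : ‖(θ:ℂ) - 1/2‖ ≤ 1/2 := by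
        have : ((θ:ℂ) - 1/2) = ((θ - 1/2 : ℝ) : ℂ) := by push_cast; ring
        rw [this, Complex.norm_real, Real.norm_eq_abs, abs_le]
        constructor <;> linarith [hθ.1, hθ.2]
      have h2 : ‖((‖∑ m ∈ s, x m * e θ m‖ ^ 2 : ℝ) : ℂ)‖ = ‖∑ m ∈ s, x m * e θ m‖ ^ 2 := by
        rw [Complex.norm_real, Real.norm_eq_abs, abs_of_nonneg (by positivity)]
      rw [h2]
      gcongr
    · exact (hcont.const_mul _).intervalIntegrable _ _ 
  rw [intervalIntegral.integral_const_mul] at hb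
  calc _ ≤ 2 * π * (1/2 * ∫ θ in (0:ℝ)..1, ‖∑ m ∈ s, x m * e θ m‖ ^ 2) := by gcongr
    _ = _ := by ring

/-- `1/log(m/n)` is approximated by `√(mn)/(m-n)` up to a bounded error. -/
lemma inv_sub_inv_two_sinh {u : ℝ} (hu : u ≠ 0) : |1 / u - 1 / (2 * Real.sinh (u / 2))| ≤ 1 := by
  wlog hpos : 0 < u generalizing u
  · have h := this (u := -u) (by simpa using hu) (by
      rcases lt_or_gt_of_ne hu with h | h
      · linarith
      · exact absurd h hpos)
    rw [neg_div, Real.sinh_neg] at h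
    rw [← abs_neg]
    convert h using 2
    rw [one_div_neg_eq_neg_one_div, mul_neg, one_div_neg_eq_neg_one_div]; ring
  have hs : u / 2 ≤ Real.sinh (u / 2) := (Real.self_le_sinh_iff).2 (by positivity)
  have hsp : 0 < Real.sinh (u / 2) := by linarith
  have h1 : 1 / (2 * Real.sinh (u / 2)) ≤ 1 / u := by
    apply one_div_le_one_div_of_le hpos; linarith
  rw [abs_of_nonneg (by linarith)]
  have hup : (1 - u) * (2 * Real.sinh (u / 2)) ≤ u := by
    rcases le_or_gt 1 u with h | h
    · nlinarith
    · have e1 : 1 - u ≤ Real.exp (-u) := by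
        have := Real.add_one_le_exp (-u); linarith
      have e2 : Real.exp (-u) * (2 * Real.sinh (u / 2)) ≤ u := by
        rw [Real.sinh_eq]
        have : Real.exp (-u) * (2 * ((Real.exp (u/2) - Real.exp (-(u/2)))/2)) =
          Real.exp (-(u/2)) * (1 - Real.exp (-u)) := by
          have a1 : Real.exp (-u) = Real.exp (-(u/2)) * Real.exp (-(u/2)) := by
            rw [← Real.exp_add]; congr 1; ring
          have a2 : Real.exp (-(u/2)) * Real.exp (u/2) = 1 := by
            rw [← Real.exp_add]; simp
          rw [a1]; linear_combination (Real.exp (-(u/2))) * a2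
        rw [this]
        have b1 : Real.exp (-(u/2)) ≤ 1 := Real.exp_le_one_iff.2 (by linarith)
        have b2 : 1 - Real.exp (-u) ≤ u := by linarith
        have b3 : 0 ≤ 1 - Real.exp (-u) := by
          have := Real.exp_le_one_iff.2 (show -u ≤ 0 by linarith); linarith
        nlinarith [Real.exp_pos (-(u/2))]
      calc _ ≤ Real.exp (-u) * (2 * Real.sinh (u / 2)) := by gcongr
        _ ≤ u := e2
  rw [div_sub_div _ _ hpos.ne' (by positivity), div_le_one (by positivity)]
  nlinarith

lemma inv_log_sub {m n : ℕ} (hm : 0 < m) (hn : 0 < n) (h : m ≠ n) :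
    |1 / (Real.log m - Real.log n) - √m * √n / (m - n)| ≤ 1 := by
  have hm' : (0:ℝ) < m := by exact_mod_cast hm
  have hn' : (0:ℝ) < n := by exact_mod_cast hn
  have hu : Real.log m - Real.log n ≠ 0 := by
    intro h'
    have := Real.log_injOn_pos hm' hn' (by linarith)
    exact h (by exact_mod_cast this)
  convert inv_sub_inv_two_sinh hu using 3
  have e1 : Real.exp ((Real.log m - Real.log n) / 2) = √m / √n := by
    rw [sub_div, Real.exp_sub, ← Real.log_sqrt hm'.le, ← Real.log_sqrt hn'.le,
      Real.exp_log (Real.sqrt_pos.2 hm'), Real.exp_log (Real.sqrt_pos.2 hn')]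
  rw [Real.sinh_eq, Real.exp_neg, e1]
  have p1 := Real.sqrt_pos.2 hm'
  have p2 := Real.sqrt_pos.2 hn'
  have q1 := Real.mul_self_sqrt hm'.le
  have q2 := Real.mul_self_sqrt hn'.le
  have hne : (m:ℝ) - n ≠ 0 := by
    rw [sub_ne_zero]; exact_mod_cast h
  have : 2 * ((√m / √n - (√m / √n)⁻¹) / 2) = (m - n) / (√m * √n) := by
    field_simp
    rw [Real.sq_sqrt hm'.le, Real.sq_sqrt hn'.le]
  rw [this, one_div_div]

lemma natCast_cpow_neg_I {n : ℕ} (hn : 0 < n) (t : ℝ) :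
    (n:ℂ) ^ (-(t:ℂ) * I) = cexp ((-t * Real.log n : ℝ) * I) := by
  rw [Complex.cpow_def_of_ne_zero (by exact_mod_cast hn.ne'), ← Complex.natCast_log]
  congr 1; push_cast; ring

/-- The off-diagonal form with logarithmic frequencies. -/
lemma log_hilbert (s : Finset ℕ) (hs : ∀ n ∈ s, 0 < n) (x : ℕ → ℂ) :
    ‖∑ m ∈ s, ∑ n ∈ s, if m = n then 0 else
        x m * (starRingEnd ℂ) (x n) / ((Real.log m - Real.log n : ℝ) : ℂ)‖
      ≤ π * ∑ n ∈ s, n * ‖x n‖ ^ 2 + (∑ n ∈ s, ‖x n‖) ^ 2 := by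
  set y : ℕ → ℂ := fun n => (√n : ℝ) * x n with hy
  have h1 := hilbert_ineq s y
  have h2 : ∀ n, ‖y n‖ ^ 2 = n * ‖x n‖ ^ 2 := by
    intro n
    rw [hy]; simp only
    rw [norm_mul, mul_pow, Complex.norm_real, Real.norm_eq_abs, sq_abs, Real.sq_sqrt (by positivity)]
  simp only [h2] at h1
  set A := ∑ m ∈ s, ∑ n ∈ s, if m = n then 0 else y m * (starRingEnd ℂ) (y n) / ((m:ℂ) - n)
  set B := ∑ m ∈ s, ∑ n ∈ s, if m = n then 0 else
        x m * (starRingEnd ℂ) (x n) / ((Real.log m - Real.log n : ℝ) : ℂ)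
  have h3 : ‖B - A‖ ≤ (∑ n ∈ s, ‖x n‖) ^ 2 := by
    rw [← Finset.sum_sub_distrib, sq, Finset.sum_mul_sum]
    refine norm_sum_le_of_le _ fun m hm => ?_
    rw [← Finset.sum_sub_distrib]
    refine norm_sum_le_of_le _ fun n hn => ?_
    split_ifs with h
    · simp; positivity
    · have e : x m * (starRingEnd ℂ) (x n) / ((Real.log m - Real.log n : ℝ) : ℂ) -
          y m * (starRingEnd ℂ) (y n) / ((m:ℂ) - n) = x m * (starRingEnd ℂ) (x n) *
          ((1 / (Real.log m - Real.log n) - √m * √n / (m - n) : ℝ) : ℂ) := by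
        rw [hy]; simp only [map_mul, Complex.conj_ofReal]; push_cast; ring
      rw [e, norm_mul, norm_mul, RCLike.norm_conj, Complex.norm_real, Real.norm_eq_abs]
      exact mul_le_of_le_one_right (by positivity) (inv_log_sub (hs m hm) (hs n hn) h)
  calc ‖B‖ = ‖A + (B - A)‖ := by congr 1; ring
    _ ≤ ‖A‖ + ‖B - A‖ := norm_add_le _ _
    _ ≤ _ := by gcongr

/-- The mean value theorem for Dirichlet polynomials. -/
lemma mean_value (s : Finset ℕ) (hs : ∀ n ∈ s, 0 < n) (x : ℕ → ℂ) (a b : ℝ) :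
    |(∫ t in a..b, ‖∑ n ∈ s, x n * (n:ℂ) ^ (-(t:ℂ) * I)‖ ^ 2) - (b - a) * ∑ n ∈ s, ‖x n‖ ^ 2|
      ≤ 2 * (π * ∑ n ∈ s, n * ‖x n‖ ^ 2 + (∑ n ∈ s, ‖x n‖) ^ 2) := by
  set e : ℝ → ℕ → ℂ := fun t n => cexp ((-t * Real.log n : ℝ) * I) with he
  have hee : ∀ t m n, e t m * (e t n)⁻¹ =
      cexp ((-(Real.log m - Real.log n : ℝ) * I) * t) := by
    intro t m n
    rw [he]; simp only
    rw [← Complex.exp_neg, ← Complex.exp_add]; congr 1; push_cast; ring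
  have hsum : ∀ t : ℝ, ∑ n ∈ s, x n * (n:ℂ) ^ (-(t:ℂ) * I) = ∑ n ∈ s, x n * e t n := fun t =>
    Finset.sum_congr rfl fun n hn => by rw [natCast_cpow_neg_I (hs n hn)]
  simp only [hsum]
  set V : ℝ → ℂ := fun t => ∑ m ∈ s, ∑ n ∈ s, if m = n then 0 else
        (x m * e t m) * (starRingEnd ℂ) (x n * e t n) / ((Real.log m - Real.log n : ℝ) : ℂ) with hV
  have hVb : ∀ t, ‖V t‖ ≤ π * ∑ n ∈ s, n * ‖x n‖ ^ 2 + (∑ n ∈ s, ‖x n‖) ^ 2 := by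
    intro t
    have h := log_hilbert s hs (fun n => x n * e t n)
    have hn : ∀ n, ‖x n * e t n‖ = ‖x n‖ := fun n => by
      rw [norm_mul, he]; simp only; rw [Complex.norm_exp_ofReal_mul_I, mul_one]
    simpa only [hn] using h
  have main : ((∫ t in a..b, ‖∑ n ∈ s, x n * e t n‖ ^ 2 : ℝ) : ℂ) =
      (((b - a) * ∑ n ∈ s, ‖x n‖ ^ 2 : ℝ) : ℂ) + I * (V b - V a) := by
    have hsq : ∀ t : ℝ, ((‖∑ m ∈ s, x m * e t m‖ ^ 2 : ℝ) : ℂ) =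
        ∑ m ∈ s, ∑ n ∈ s, x m * (starRingEnd ℂ) (x n) *
          cexp ((-(Real.log m - Real.log n : ℝ) * I) * t) := by
      intro t
      rw [normSq_expsum s x (e t) (fun m => conj_exp_I _)]
      simp only [hee]
    rw [← intervalIntegral.integral_ofReal]
    simp only [hsq]
    rw [intervalIntegral.integral_finsetSum
        (fun m _ => Continuous.intervalIntegrable (by fun_prop) _ _)]
    have hd : (((b - a) * ∑ n ∈ s, ‖x n‖ ^ 2 : ℝ) : ℂ) = ∑ m ∈ s, ∑ n ∈ s,
        if m = n then ((b - a) : ℂ) * (x m * (starRingEnd ℂ) (x n)) else 0 := by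
      push_cast
      rw [Finset.mul_sum]
      refine Finset.sum_congr rfl fun m hm => ?_
      rw [Finset.sum_ite_eq, if_pos hm, Complex.mul_conj']
    rw [hd, hV]
    simp only
    rw [← Finset.sum_sub_distrib, Finset.mul_sum, ← Finset.sum_add_distrib]
    refine Finset.sum_congr rfl fun m hm => ?_
    rw [intervalIntegral.integral_finsetSum
        (fun m _ => Continuous.intervalIntegrable (by fun_prop) _ _),
      ← Finset.sum_sub_distrib, Finset.mul_sum, ← Finset.sum_add_distrib]
    refine Finset.sum_congr rfl fun n hn => ?_
    rw [intervalIntegral.integral_const_mul]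
    split_ifs with h
    · subst h
      simp; ring
    · have hu : (Real.log m - Real.log n : ℝ) ≠ 0 := by
        intro h'
        have := Real.log_injOn_pos (Set.mem_Ioi.2 (Nat.cast_pos.2 (hs m hm)))
          (Set.mem_Ioi.2 (Nat.cast_pos.2 (hs n hn))) (by linarith)
        exact h (by exact_mod_cast this)
      have hu' : ((Real.log m - Real.log n : ℝ) : ℂ) ≠ 0 := by exact_mod_cast hu
      rw [integral_exp_mul_complex (mul_ne_zero (neg_ne_zero.2 hu') I_ne_zero)]
      have hc : ∀ t, x m * e t m * (starRingEnd ℂ) (x n * e t n) =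
          x m * (starRingEnd ℂ) (x n) * cexp ((-(Real.log m - Real.log n : ℝ) * I) * t) := by
        intro t
        rw [map_mul, ← hee, show (starRingEnd ℂ) (e t n) = (e t n)⁻¹ from conj_exp_I _]; ring
      rw [hc, hc]
      field_simp [I_ne_zero]
      ring_nf
      simp only [I_sq]
      ring
  have h2 : ‖((∫ t in a..b, ‖∑ n ∈ s, x n * e t n‖ ^ 2 : ℝ) : ℂ) -
      (((b - a) * ∑ n ∈ s, ‖x n‖ ^ 2 : ℝ) : ℂ)‖ ≤
      2 * (π * ∑ n ∈ s, n * ‖x n‖ ^ 2 + (∑ n ∈ s, ‖x n‖) ^ 2) := by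
    rw [main, add_sub_cancel_left, norm_mul, norm_I, one_mul]
    calc _ ≤ ‖V b‖ + ‖V a‖ := norm_sub_le _ _
      _ ≤ _ := by linarith [hVb a, hVb b]
  rwa [← Complex.ofReal_sub, Complex.norm_real, Real.norm_eq_abs] at h2

/-- `∑_{n ≤ x} f n ≤ C x log x` for `x ≥ 2`. -/
def LogBound (f : ℕ → ℝ) (C : ℝ) : Prop :=
  ∀ x : ℕ, 2 ≤ x → ∑ n ∈ Icc 1 x, f n ≤ C * x * Real.log x

lemma LogBound.nonneg {f : ℕ → ℝ} {C : ℝ} (h : LogBound f C) (hf : ∀ n, 0 ≤ f n) : 0 ≤ C := by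
  have h1 := h 2 le_rfl
  have h2 : 0 ≤ ∑ n ∈ Icc 1 2, f n := sum_nonneg fun n _ => hf n
  have h3 : 0 < Real.log 2 := Real.log_pos (by norm_num)
  push_cast at h1
  by_contra hc
  push Not at hc
  nlinarith

lemma LogBound.le_mul_log {f : ℕ → ℝ} {C : ℝ} (h : LogBound f C) (hf : ∀ n, 0 ≤ f n) {n N : ℕ}
    (hn : 1 ≤ n) (hnN : n ≤ N) (hN : 2 ≤ N) :
    ∑ k ∈ Icc 1 n, f k ≤ 2 * C * n * Real.log N := by
  have hC := h.nonneg hf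
  have hN' : (2:ℝ) ≤ N := by exact_mod_cast hN
  rcases Nat.lt_or_ge n 2 with h2 | h2
  · have : n = 1 := by omega
    subst this
    calc ∑ k ∈ Icc 1 1, f k ≤ ∑ k ∈ Icc 1 2, f k :=
          sum_le_sum_of_subset_of_nonneg (Icc_subset_Icc_right (by norm_num)) fun _ _ _ => hf _
      _ ≤ C * (2:ℕ) * Real.log (2:ℕ) := h 2 le_rfl
      _ ≤ _ := by
        push_cast
        have : Real.log 2 ≤ Real.log N := Real.log_le_log (by norm_num) hN'
        nlinarith
  · have hn' : (0:ℝ) < n := by positivity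
    have : Real.log n ≤ Real.log N := Real.log_le_log hn' (by exact_mod_cast hnN)
    have h0 : 0 ≤ Real.log n := Real.log_natCast_nonneg n
    calc _ ≤ C * n * Real.log n := h n h2
      _ ≤ C * n * Real.log N := by gcongr
      _ ≤ _ := by nlinarith [mul_nonneg (mul_nonneg hC hn'.le) (h0.trans this)]

lemma sum_Icc_succ {f : ℕ → ℝ} (M : ℕ) :
    ∑ n ∈ Icc 1 (M+1), f n = ∑ n ∈ Icc 1 M, f n + f (M+1) :=
  Finset.sum_Icc_succ_top (by omega) f

lemma inv_sqrt_step (M : ℕ) (hM : 1 ≤ M) :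
    (M:ℝ) * (1/√M - 1/√((M+1:ℕ):ℝ)) ≤ √((M+1:ℕ):ℝ) - √M := by
  have hp : (0:ℝ) < M := by exact_mod_cast hM
  have p1 := Real.sqrt_pos.2 hp
  have h1 : √(M:ℝ) ≤ √((M+1:ℕ):ℝ) := Real.sqrt_le_sqrt (by push_cast; linarith)
  have p2 : 0 < √((M+1:ℕ):ℝ) := by linarith
  rw [div_sub_div _ _ p1.ne' p2.ne', mul_div_assoc', div_le_iff₀ (by positivity)]
  have q1 := Real.mul_self_sqrt hp.le
  nlinarith [mul_nonneg (sub_nonneg.2 h1) p1.le, mul_nonneg (mul_nonneg (sub_nonneg.2 h1) p1.le)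
    (sub_nonneg.2 h1)]

/-- Weighted partial sums of half-integral weight. -/
lemma LogBound.sum_inv_sqrt {f : ℕ → ℝ} {C : ℝ} (h : LogBound f C) (hf : ∀ n, 0 ≤ f n) {N : ℕ}
    (hN : 2 ≤ N) : ∑ n ∈ Icc 1 N, f n / √n ≤ 4 * C * √N * Real.log N := by
  have hC := h.nonneg hf
  have hL : 0 ≤ Real.log N := Real.log_natCast_nonneg N
  have key : ∀ M : ℕ, 1 ≤ M → M ≤ N → ∑ n ∈ Icc 1 M, f n / √n ≤
      (∑ n ∈ Icc 1 M, f n) / √M + 2 * C * Real.log N * √M := by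
    intro M hM
    induction M, hM using Nat.le_induction with
    | base => intro _; simp; positivity
    | succ M hM ih =>
      intro hMN
      have ih := ih (by omega)
      rw [sum_Icc_succ, sum_Icc_succ]
      have hS := h.le_mul_log hf hM (by omega : M ≤ N) hN
      have hst := inv_sqrt_step M hM
      set S := ∑ n ∈ Icc 1 M, f n
      have hp : (0:ℝ) < M := by exact_mod_cast hM
      have p1 := Real.sqrt_pos.2 hp
      have h1 : √(M:ℝ) ≤ √((M+1:ℕ):ℝ) := Real.sqrt_le_sqrt (by push_cast; linarith)
      have hd : 0 ≤ 1/√(M:ℝ) - 1/√((M+1:ℕ):ℝ) := by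
        rw [sub_nonneg]; exact one_div_le_one_div_of_le p1 h1
      have e : S / √M - S / √((M+1:ℕ):ℝ) ≤ 2 * C * Real.log N * (√((M+1:ℕ):ℝ) - √M) := by
        calc _ = S * (1/√(M:ℝ) - 1/√((M+1:ℕ):ℝ)) := by ring
          _ ≤ (2 * C * M * Real.log N) * (1/√(M:ℝ) - 1/√((M+1:ℕ):ℝ)) := by gcongr
          _ = 2 * C * Real.log N * (M * (1/√(M:ℝ) - 1/√((M+1:ℕ):ℝ))) := by ring
          _ ≤ _ := by gcongr
      rw [add_div]
      linarith
  have hk := key N (by omega) le_rfl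
  have hS := h.le_mul_log hf (by omega : 1 ≤ N) le_rfl hN
  have hp : (0:ℝ) < N := by positivity
  have : (∑ n ∈ Icc 1 N, f n) / √N ≤ 2 * C * √N * Real.log N := by
    rw [div_le_iff₀ (Real.sqrt_pos.2 hp)]
    calc _ ≤ _ := hS
      _ = 2 * C * (√(N:ℝ) * √N) * Real.log N := by rw [Real.mul_self_sqrt hp.le]
      _ = _ := by ring
  linarith

lemma sum_one_div_sqrt_le (N : ℕ) : ∑ n ∈ Icc 1 N, 1 / √(n:ℝ) ≤ 2 * √N := by
  induction N with
  | zero => simp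
  | succ M ih =>
    rw [sum_Icc_succ]
    have h1 : √(M:ℝ) ≤ √((M+1:ℕ):ℝ) := Real.sqrt_le_sqrt (by push_cast; linarith)
    have p2 : 0 < √((M+1:ℕ):ℝ) := Real.sqrt_pos.2 (by positivity)
    have q1 := Real.mul_self_sqrt (show (0:ℝ) ≤ M by positivity)
    have q2 := Real.mul_self_sqrt (show (0:ℝ) ≤ ((M+1:ℕ):ℝ) by positivity)
    have : 1 / √((M+1:ℕ):ℝ) ≤ 2 * (√((M+1:ℕ):ℝ) - √M) := by
      rw [div_le_iff₀ p2]
      push_cast at q2 h1 ⊢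
      nlinarith [sq_nonneg (√((M:ℝ)+1) - √M)]
    linarith

/-- First-moment consequence of a second-moment bound. -/
lemma sum_norm_div_sqrt_le {a : ℕ → ℂ} {C : ℝ} (h : LogBound (fun n => ‖a n‖ ^ 2) C) {N : ℕ}
    (hN : 2 ≤ N) : (∑ n ∈ Icc 1 N, ‖a n‖ / √n) ^ 2 ≤ 8 * C * N * Real.log N := by
  have h1 := h.sum_inv_sqrt (fun n => by positivity) hN
  have h2 := sum_one_div_sqrt_le N
  have hC := h.nonneg (fun n => by positivity)
  have cs := Finset.sum_mul_sq_le_sq_mul_sq (Icc 1 N) (fun n => ‖a n‖ / √(√n)) (fun n => 1 / √(√n))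
  have e1 : ∀ n : ℕ, ‖a n‖ / √(√n) * (1 / √(√n)) = ‖a n‖ / √n := fun n => by
    rw [div_mul_div_comm, mul_one, Real.mul_self_sqrt (Real.sqrt_nonneg _)]
  have e2 : ∀ n : ℕ, (‖a n‖ / √(√n)) ^ 2 = ‖a n‖ ^ 2 / √n := fun n => by
    rw [div_pow, Real.sq_sqrt (Real.sqrt_nonneg _)]
  have e3 : ∀ n : ℕ, (1 / √(√n)) ^ 2 = 1 / √n := fun n => by
    rw [div_pow, Real.sq_sqrt (Real.sqrt_nonneg _), one_pow]
  simp only [e1, e2, e3] at cs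
  calc _ ≤ _ := cs
    _ ≤ (4 * C * √N * Real.log N) * (2 * √N) := by
        have : 0 ≤ 4 * C * √N * Real.log N := by
          have := Real.log_natCast_nonneg N; positivity
        gcongr
    _ = 8 * C * (√N * √N) * Real.log N := by ring
    _ = _ := by rw [Real.mul_self_sqrt (by positivity)]

lemma log_le_rpow_mul {n N : ℕ} (hN : 2 ≤ N) (hn : N ≤ n) :
    Real.log n ≤ 7 * Real.log N * ((n:ℝ) / N) ^ (1/4 : ℝ) := by
  have hN' : (2:ℝ) ≤ N := by exact_mod_cast hN
  have hNn : (N:ℝ) ≤ n := by exact_mod_cast hn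
  have hpos : (0:ℝ) < N := by linarith
  have hr : 1 ≤ (n:ℝ) / N := by rwa [one_le_div hpos]
  have h1 : Real.log n = Real.log N + Real.log (n / N) := by
    rw [Real.log_div (by linarith) (by linarith)]; ring
  have h2 := Real.log_le_rpow_div (show 0 ≤ (n:ℝ)/N by positivity) (show (0:ℝ) < 1/4 by norm_num)
  have h3 : 1 ≤ ((n:ℝ) / N) ^ (1/4 : ℝ) := Real.one_le_rpow hr (by norm_num)
  have h4 : Real.log 2 ≤ Real.log N := Real.log_le_log (by norm_num) hN'
  have h5 := Real.log_two_gt_d9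
  rw [h1]
  set u := ((n:ℝ) / N) ^ (1/4 : ℝ)
  nlinarith

lemma rpow_step (M : ℕ) (hM : 1 ≤ M) :
    (M:ℝ) ^ (5/4:ℝ) * ((M:ℝ) ^ (-(3/2):ℝ) - ((M+1:ℕ):ℝ) ^ (-(3/2):ℝ)) ≤
      6 * ((M:ℝ) ^ (-(1/4):ℝ) - ((M+1:ℕ):ℝ) ^ (-(1/4):ℝ)) := by
  have hp : (0:ℝ) < M := by exact_mod_cast hM
  have hp' : (0:ℝ) < ((M+1:ℕ):ℝ) := by positivity
  set u := (M:ℝ) ^ (-(1/4):ℝ) with hu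
  set v := ((M+1:ℕ):ℝ) ^ (-(1/4):ℝ) with hv
  have up : 0 < u := Real.rpow_pos_of_pos hp _
  have vp : 0 < v := Real.rpow_pos_of_pos hp' _
  have hvu : v ≤ u := by
    rw [hu, hv]
    exact Real.rpow_le_rpow_of_nonpos hp (by push_cast; linarith) (by norm_num)
  have e1 : (M:ℝ) ^ (-(3/2):ℝ) = u ^ 6 := by
    rw [hu, ← Real.rpow_natCast, ← Real.rpow_mul hp.le]; norm_num
  have e2 : ((M+1:ℕ):ℝ) ^ (-(3/2):ℝ) = v ^ 6 := by
    rw [hv, ← Real.rpow_natCast, ← Real.rpow_mul hp'.le]; norm_num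
  have e3 : (M:ℝ) ^ (5/4:ℝ) = (u ^ 5)⁻¹ := by
    rw [hu, ← Real.rpow_natCast, ← Real.rpow_mul hp.le, ← Real.rpow_neg hp.le]; norm_num
  rw [e1, e2, e3, inv_mul_le_iff₀ (by positivity)]
  have hb : u ^ 6 - v ^ 6 = (u - v) * (u^5+u^4*v+u^3*v^2+u^2*v^3+u*v^4+v^5) := by ring
  rw [hb]
  have hs : u^5+u^4*v+u^3*v^2+u^2*v^3+u*v^4+v^5 ≤ 6 * u ^ 5 := by
    have a1 : u^4*v ≤ u^4*u := by gcongr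
    have a2 : u^3*v^2 ≤ u^3*u^2 := by gcongr
    have a3 : u^2*v^3 ≤ u^2*u^3 := by gcongr
    have a4 : u*v^4 ≤ u*u^4 := by gcongr
    have a5 : v^5 ≤ u^5 := by gcongr
    nlinarith
  nlinarith [mul_le_mul_of_nonneg_left hs (sub_nonneg.2 hvu)]

/-- Weighted tails. -/
lemma LogBound.tail {f : ℕ → ℝ} {C : ℝ} (h : LogBound f C) (hf : ∀ n, 0 ≤ f n) {N M : ℕ}
    (hN : 2 ≤ N) (hM : N ≤ M) :
    ∑ n ∈ Ioc N M, f n * (n:ℝ) ^ (-(3/2):ℝ) ≤ 42 * C * Real.log N / √N := by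
  have hC := h.nonneg hf
  have hL : 0 ≤ Real.log N := Real.log_natCast_nonneg N
  have hpN : (0:ℝ) < N := by positivity
  set B : ℝ := 7 * C * Real.log N * (N:ℝ) ^ (-(1/4):ℝ) with hB
  have hB0 : 0 ≤ B := by positivity
  have hS : ∀ n, N ≤ n → ∑ k ∈ Icc 1 n, f k ≤ B * (n:ℝ) ^ (5/4:ℝ) := by
    intro n hn
    have hpn : (0:ℝ) < n := by
      have : (0:ℕ) < n := by omega
      exact_mod_cast this
    calc _ ≤ C * n * Real.log n := h n (by omega)
      _ ≤ C * n * (7 * Real.log N * ((n:ℝ) / N) ^ (1/4 : ℝ)) := by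
          gcongr; exact log_le_rpow_mul hN hn
      _ = _ := by
          rw [hB, Real.div_rpow hpn.le hpN.le, Real.rpow_neg hpN.le,
            show (5/4:ℝ) = 1 + 1/4 by norm_num, Real.rpow_add hpn, Real.rpow_one]
          ring
  have key : ∑ n ∈ Ioc N M, f n * (n:ℝ) ^ (-(3/2):ℝ) ≤
      (∑ k ∈ Icc 1 M, f k) * (M:ℝ) ^ (-(3/2):ℝ)
        + 6 * B * ((N:ℝ) ^ (-(1/4):ℝ) - (M:ℝ) ^ (-(1/4):ℝ)) := by
    induction M, hM using Nat.le_induction with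
    | base =>
      simp
      exact mul_nonneg (sum_nonneg fun _ _ => hf _) (by positivity)
    | succ M hM ih =>
      rw [Finset.sum_Ioc_succ_top hM, sum_Icc_succ]
      have hst := rpow_step M (by omega)
      have hpM : (0:ℝ) < M := by
        have : (0:ℕ) < M := by omega
        exact_mod_cast this
      have hd : 0 ≤ (M:ℝ) ^ (-(3/2):ℝ) - ((M+1:ℕ):ℝ) ^ (-(3/2):ℝ) := by
        rw [sub_nonneg]
        exact Real.rpow_le_rpow_of_nonpos hpM (by push_cast; linarith) (by norm_num)
      have := hS M hM
      have e : (∑ k ∈ Icc 1 M, f k) * ((M:ℝ) ^ (-(3/2):ℝ) - ((M+1:ℕ):ℝ) ^ (-(3/2):ℝ)) ≤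
          6 * B * ((M:ℝ) ^ (-(1/4):ℝ) - ((M+1:ℕ):ℝ) ^ (-(1/4):ℝ)) := by
        calc _ ≤ B * (M:ℝ) ^ (5/4:ℝ) * ((M:ℝ) ^ (-(3/2):ℝ) - ((M+1:ℕ):ℝ) ^ (-(3/2):ℝ)) := by gcongr
          _ = B * ((M:ℝ) ^ (5/4:ℝ) * ((M:ℝ) ^ (-(3/2):ℝ) - ((M+1:ℕ):ℝ) ^ (-(3/2):ℝ))) := by ring
          _ ≤ B * (6 * ((M:ℝ) ^ (-(1/4):ℝ) - ((M+1:ℕ):ℝ) ^ (-(1/4):ℝ))) :=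
              mul_le_mul_of_nonneg_left hst hB0
          _ = _ := by ring
      nlinarith
  have hpM : (0:ℝ) < M := by
    have : (0:ℕ) < M := by omega
    exact_mod_cast this
  have e1 : (∑ k ∈ Icc 1 M, f k) * (M:ℝ) ^ (-(3/2):ℝ) ≤ B * (M:ℝ) ^ (-(1/4):ℝ) := by
    calc _ ≤ B * (M:ℝ) ^ (5/4:ℝ) * (M:ℝ) ^ (-(3/2):ℝ) := by gcongr; exact hS M hM
      _ = _ := by rw [mul_assoc, ← Real.rpow_add hpM]; norm_num
  have e2 : (N:ℝ) ^ (-(1/4):ℝ) * (N:ℝ) ^ (-(1/4):ℝ) = 1 / √N := by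
    rw [← Real.rpow_add hpN, Real.sqrt_eq_rpow, one_div ((N:ℝ) ^ (1/2:ℝ)), ← Real.rpow_neg hpN.le]
    norm_num
  have hm : 0 ≤ (M:ℝ) ^ (-(1/4):ℝ) := by positivity
  calc _ ≤ _ := key
    _ ≤ 6 * B * (N:ℝ) ^ (-(1/4):ℝ) := by nlinarith [mul_nonneg hB0 hm]
    _ = 42 * C * Real.log N * ((N:ℝ) ^ (-(1/4):ℝ) * (N:ℝ) ^ (-(1/4):ℝ)) := by rw [hB]; ring
    _ = _ := by rw [e2]; ring

lemma LogBound.tail_nat {f : ℕ → ℝ} {C : ℝ} (h : LogBound f C) (hf : ∀ n, 0 ≤ f n) {N M : ℕ}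
    (hN : 2 ≤ N) (hM : N ≤ M) :
    ∑ n ∈ Ioc N M, f n / (n:ℝ) ^ 2 ≤ 42 * C * Real.log N / N := by
  have h1 := h.tail hf hN hM
  have hpN : (0:ℝ) < N := by positivity
  have hs := Real.sqrt_pos.2 hpN
  calc ∑ n ∈ Ioc N M, f n / (n:ℝ) ^ 2 ≤ ∑ n ∈ Ioc N M, (1/√N) * (f n * (n:ℝ) ^ (-(3/2):ℝ)) := by
        refine sum_le_sum fun n hn => ?_
        have hNn : (N:ℝ) ≤ n := by exact_mod_cast (mem_Ioc.1 hn).1.le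
        have hpn : (0:ℝ) < n := by linarith
        have e : f n / (n:ℝ)^2 = (1/√n) * (f n * (n:ℝ) ^ (-(3/2):ℝ)) := by
          rw [Real.sqrt_eq_rpow, one_div, ← Real.rpow_neg hpn.le, mul_left_comm,
            ← Real.rpow_add hpn, div_eq_mul_inv, ← Real.rpow_natCast, ← Real.rpow_neg hpn.le]
          norm_num
        rw [e]
        have : 0 ≤ f n * (n:ℝ) ^ (-(3/2):ℝ) := mul_nonneg (hf n) (by positivity)
        gcongr
    _ = (1/√N) * ∑ n ∈ Ioc N M, f n * (n:ℝ) ^ (-(3/2):ℝ) := by rw [mul_sum]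
    _ ≤ (1/√N) * (42 * C * Real.log N / √N) := by gcongr
    _ = 42 * C * Real.log N / (√N * √N) := by field_simp
    _ = _ := by rw [Real.mul_self_sqrt hpN.le]

lemma sum_rpow_tail {N M : ℕ} (hN : 1 ≤ N) (hM : N ≤ M) :
    ∑ n ∈ Ioc N M, (n:ℝ) ^ (-(3/2):ℝ) ≤ 2 / √N := by
  have key : ∑ n ∈ Ioc N M, (n:ℝ) ^ (-(3/2):ℝ) ≤ 2 / √N - 2 / √M := by
    induction M, hM using Nat.le_induction with
    | base => simp
    | succ M hM ih =>
      rw [Finset.sum_Ioc_succ_top hM]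
      have hpM : (0:ℝ) < M := by
        have : (0:ℕ) < M := by omega
        exact_mod_cast this
      have hp' : (0:ℝ) < ((M+1:ℕ):ℝ) := by positivity
      have h1 : √(M:ℝ) ≤ √((M+1:ℕ):ℝ) := Real.sqrt_le_sqrt (by push_cast; linarith)
      have p1 := Real.sqrt_pos.2 hpM
      have p2 := Real.sqrt_pos.2 hp'
      have e : ((M+1:ℕ):ℝ) ^ (-(3/2):ℝ) = 1 / (√((M+1:ℕ):ℝ))^3 := by
        rw [Real.sqrt_eq_rpow, ← Real.rpow_natCast, ← Real.rpow_mul hp'.le, one_div,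
          ← Real.rpow_neg hp'.le]; norm_num
      have q1 := Real.mul_self_sqrt hpM.le
      have q2 := Real.mul_self_sqrt hp'.le
      rw [e]
      have hstep : 1 / (√((M+1:ℕ):ℝ))^3 ≤ 2 / √(M:ℝ) - 2 / √((M+1:ℕ):ℝ) := by
        rw [div_sub_div _ _ p1.ne' p2.ne', div_le_div_iff₀ (by positivity) (by positivity)]
        set u := √((M+1:ℕ):ℝ)
        set v := √(M:ℝ)
        have huv : u * u - v * v = 1 := by rw [q1, q2]; push_cast; ring
        have h3 : 1 ≤ (2 * u - 2 * v) * u := by nlinarith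
        have h4 : v * u ≤ u ^ 2 := by nlinarith
        calc 1 * (v * u) ≤ ((2 * u - 2 * v) * u) * u ^ 2 := by
              apply mul_le_mul h3 h4 (by positivity) (by linarith)
          _ = _ := by ring
      linarith
  have : 0 ≤ 2 / √(M:ℝ) := by positivity
  linarith

lemma sum_norm_tail {a : ℕ → ℂ} {C : ℝ} (h : LogBound (fun n => ‖a n‖ ^ 2) C) {N M : ℕ}
    (hN : 2 ≤ N) (hM : N ≤ M) :
    (∑ n ∈ Ioc N M, ‖a n‖ * (n:ℝ) ^ (-(3/2):ℝ)) ^ 2 ≤ 84 * C * Real.log N / N := by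
  have h1 := h.tail (fun n => by positivity) hN hM
  have h2 := sum_rpow_tail (by omega : 1 ≤ N) hM
  have hC := h.nonneg (fun n => by positivity)
  have hpN : (0:ℝ) < N := by positivity
  have cs := Finset.sum_mul_sq_le_sq_mul_sq (Ioc N M) (fun n => ‖a n‖ * √((n:ℝ) ^ (-(3/2):ℝ)))
    (fun n => √((n:ℝ) ^ (-(3/2):ℝ)))
  have e0 : ∀ n : ℕ, 0 ≤ (n:ℝ) ^ (-(3/2):ℝ) := fun n => by positivity
  have e1 : ∀ n : ℕ, ‖a n‖ * √((n:ℝ) ^ (-(3/2):ℝ)) * √((n:ℝ) ^ (-(3/2):ℝ)) =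
      ‖a n‖ * (n:ℝ) ^ (-(3/2):ℝ) := fun n => by rw [mul_assoc, Real.mul_self_sqrt (e0 n)]
  have e2 : ∀ n : ℕ, (‖a n‖ * √((n:ℝ) ^ (-(3/2):ℝ))) ^ 2 = ‖a n‖ ^ 2 * (n:ℝ) ^ (-(3/2):ℝ) :=
    fun n => by rw [mul_pow, Real.sq_sqrt (e0 n)]
  simp only [e1, e2, Real.sq_sqrt (e0 _)] at cs
  calc _ ≤ _ := cs
    _ ≤ (42 * C * Real.log N / √N) * (2 / √N) := by
        have : 0 ≤ 42 * C * Real.log N / √N := by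
          have := Real.log_natCast_nonneg N; positivity
        gcongr
    _ = 84 * C * Real.log N / (√N * √N) := by field_simp; ring
    _ = _ := by rw [Real.mul_self_sqrt (by positivity)]

lemma one_add_pow_four_mul_exp (y : ℝ) : (1 + |y|) ^ 4 * Real.exp (-y ^ 2) ≤ 64 := by
  have h1 : 1 + y ^ 2 + y ^ 4 / 2 ≤ Real.exp (y ^ 2) := by
    have := Real.quadratic_le_exp_of_nonneg (sq_nonneg y)
    nlinarith
  rw [Real.exp_neg, ← div_eq_mul_inv, div_le_iff₀ (Real.exp_pos _)]
  have h2 : (1 + |y|) ^ 4 ≤ 64 * (1 + y ^ 2 + y ^ 4 / 2) := by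
    have e : y ^ 2 = |y| ^ 2 := (sq_abs y).symm
    have e4 : y ^ 4 = |y| ^ 4 := by rw [show y^4 = (y^2)^2 by ring, e]; ring
    rw [e, e4]
    have : 0 ≤ |y| := abs_nonneg y
    nlinarith [sq_nonneg (|y| - 1), sq_nonneg (|y|^2 - |y|), sq_nonneg (|y|^2 - 1), sq_nonneg (|y|^2)]
  linarith

/-- A Phragmén–Lindelöf interpolation in the strip `-1/2 ≤ re z ≤ 3/2`. -/
lemma three_lines {f : ℂ → ℂ} {B M R : ℝ} (hf : DifferentiableOn ℂ f (re ⁻¹' Set.Ioo (-1) 2))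
    (hB : 0 ≤ B)
    (hgrow : ∀ z : ℂ, -1/2 ≤ z.re → z.re ≤ 3/2 → ‖f z‖ ≤ B * Real.exp (B * |z.im|))
    (hR : 1 ≤ R) (hM : 0 ≤ M)
    (h1 : ∀ y : ℝ, ‖f (3/2 + y * I)‖ ≤ M * (1 + |y|) ^ 4)
    (h2 : ∀ y : ℝ, ‖f (-1/2 + y * I)‖ ≤ M * R ^ 2 * (1 + |y|) ^ 4)
    {σ : ℝ} (hσ1 : -1/2 ≤ σ) (hσ2 : σ ≤ 3/2) :
    ‖f σ‖ ≤ 64 * Real.exp (9/4) * M * R ^ (3/2 - σ) := by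
  have hR0 : 0 < R := by linarith
  have hRc : (R:ℂ) ≠ 0 := by exact_mod_cast hR0.ne'
  set g : ℂ → ℂ := fun z => f z * (R:ℂ) ^ (z - 3/2) * cexp (z ^ 2) with hg
  have hnorm : ∀ z : ℂ, ‖g z‖ = ‖f z‖ * R ^ (z.re - 3/2) * Real.exp (z.re ^ 2 - z.im ^ 2) := by
    intro z
    rw [hg]
    simp only [norm_mul]
    rw [Complex.norm_cpow_eq_rpow_re_of_pos hR0, Complex.norm_exp]
    congr 3
    · simp
    · simp [pow_two]
  have hsub : re ⁻¹' Set.Icc (-1/2:ℝ) (3/2) ⊆ re ⁻¹' Set.Ioo (-1) 2 := by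
    intro z hz
    simp only [Set.mem_preimage, Set.mem_Icc, Set.mem_Ioo] at hz ⊢
    constructor <;> linarith [hz.1, hz.2]
  have hdg : DifferentiableOn ℂ g (re ⁻¹' Set.Ioo (-1) 2) := by
    intro z hz
    refine ((hf z hz).mul ?_).mul ?_
    · refine DifferentiableAt.differentiableWithinAt ?_
      exact ((differentiableAt_id.sub_const _).const_cpow (Or.inl hRc))
    · refine DifferentiableAt.differentiableWithinAt ?_
      fun_prop
  have hcl : DiffContOnCl ℂ g (re ⁻¹' Set.Ioo (-1/2) (3/2)) := by
    refine DifferentiableOn.diffContOnCl ?_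
    refine hdg.mono (subset_trans ?_ hsub)
    refine closure_minimal (Set.preimage_mono Set.Ioo_subset_Icc_self) ?_
    exact isClosed_Icc.preimage continuous_re
  have key : ‖g σ‖ ≤ 64 * Real.exp (9/4) * M := by
    refine PhragmenLindelof.vertical_strip (a := -1/2) (b := 3/2) hcl ?_ ?_ ?_ (by simpa using hσ1) (by simpa using hσ2)
    · refine ⟨1, by norm_num; linarith [Real.pi_gt_three], 2 * B + 9/4, ?_⟩
      refine Asymptotics.IsBigO.of_bound 1 ?_
      refine Filter.Eventually.filter_mono inf_le_right ?_
      rw [Filter.eventually_principal]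
      intro z hz
      simp only [Set.mem_preimage, Set.mem_Ioo] at hz
      rw [hnorm, one_mul, Real.norm_eq_abs, abs_of_pos (Real.exp_pos _)]
      have g1 := hgrow z (by linarith [hz.1]) (by linarith [hz.2])
      have g2 : R ^ (z.re - 3/2) ≤ 1 := Real.rpow_le_one_of_one_le_of_nonpos hR (by linarith [hz.2])
      have g3 : z.re ^ 2 - z.im ^ 2 ≤ 9/4 := by nlinarith [hz.1, hz.2, sq_nonneg z.im]
      have g4 : B ≤ Real.exp B := by linarith [Real.add_one_le_exp B]
      have e1 : 1 ≤ Real.exp (1 * |z.im|) := Real.one_le_exp (by positivity)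
      have e2 : |z.im| ≤ Real.exp (1 * |z.im|) := by rw [one_mul]; linarith [Real.add_one_le_exp |z.im|]
      calc ‖f z‖ * R ^ (z.re - 3/2) * Real.exp (z.re ^ 2 - z.im ^ 2)
          ≤ (Real.exp B * Real.exp (B * |z.im|)) * 1 * Real.exp (9/4) := by
            have : ‖f z‖ ≤ Real.exp B * Real.exp (B * |z.im|) := g1.trans (by gcongr)
            gcongr
        _ = Real.exp (B + B * |z.im| + 9/4) := by rw [mul_one, ← Real.exp_add, ← Real.exp_add]
        _ ≤ _ := by
            apply Real.exp_le_exp.2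
            nlinarith
    · intro z hz
      have hz' : z = -1/2 + z.im * I := by
        apply Complex.ext <;> simp [hz]
      rw [hnorm]
      have := h2 z.im
      rw [← hz'] at this
      rw [hz]
      have e : R ^ ((-1/2:ℝ) - 3/2) = (R ^ 2)⁻¹ := by
        rw [show ((-1/2:ℝ) - 3/2) = -(2:ℕ) by norm_num, Real.rpow_neg hR0.le, Real.rpow_natCast]
      rw [e]
      have p := one_add_pow_four_mul_exp z.im
      calc _ ≤ M * R ^ 2 * (1 + |z.im|) ^ 4 * (R^2)⁻¹ * Real.exp ((-1/2)^2 - z.im ^ 2) := by gcongr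
        _ = M * ((1 + |z.im|) ^ 4 * Real.exp (-z.im ^ 2)) * Real.exp (1/4) := by
            rw [show ((-1/2:ℝ))^2 - z.im^2 = -z.im^2 + 1/4 by ring, Real.exp_add]; field_simp
        _ ≤ M * 64 * Real.exp (9/4) := by gcongr; norm_num
        _ = _ := by ring
    · intro z hz
      have hz' : z = 3/2 + z.im * I := by
        apply Complex.ext <;> simp [hz]
      rw [hnorm]
      have := h1 z.im
      rw [← hz'] at this
      rw [hz]
      have p := one_add_pow_four_mul_exp z.im
      calc _ ≤ M * (1 + |z.im|) ^ 4 * 1 * Real.exp ((3/2)^2 - z.im ^ 2) := by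
            have : R ^ ((3/2:ℝ) - 3/2) = 1 := by norm_num
            rw [this]; gcongr
        _ = M * ((1 + |z.im|) ^ 4 * Real.exp (-z.im ^ 2)) * Real.exp (9/4) := by
            rw [show ((3/2:ℝ))^2 - z.im^2 = -z.im^2 + 9/4 by ring, Real.exp_add]; ring
        _ ≤ M * 64 * Real.exp (9/4) := by gcongr
        _ = _ := by ring
  rw [hnorm] at key
  simp only [ofReal_re, ofReal_im] at key
  have e1 : 1 ≤ Real.exp (σ ^ 2 - 0 ^ 2) := Real.one_le_exp (by nlinarith [sq_nonneg σ])
  have e2 : R ^ (σ - 3/2) * R ^ (3/2 - σ) = 1 := by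
    rw [← Real.rpow_add hR0]; simp
  have p1 : 0 < R ^ (3/2 - σ) := by positivity
  have p2 : 0 < R ^ (σ - 3/2) := by positivity
  calc ‖f σ‖ = ‖f σ‖ * (R ^ (σ - 3/2) * R ^ (3/2 - σ)) * 1 := by rw [e2]; ring
    _ ≤ ‖f σ‖ * (R ^ (σ - 3/2) * R ^ (3/2 - σ)) * Real.exp (σ ^ 2 - 0 ^ 2) := by gcongr
    _ = (‖f σ‖ * R ^ (σ - 3/2) * Real.exp (σ ^ 2 - 0 ^ 2)) * R ^ (3/2 - σ) := by ring
    _ ≤ _ := by gcongr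

/-- The Dirichlet polynomial `∑_{n ≤ N} a n n^{-z}`. -/
noncomputable def dsum (a : ℕ → ℂ) (N : ℕ) (z : ℂ) : ℂ := ∑ n ∈ Icc 1 N, a n * (n:ℂ) ^ (-z)

lemma conj_natCast_cpow (n : ℕ) (z : ℂ) :
    (starRingEnd ℂ) ((n:ℂ) ^ z) = (n:ℂ) ^ ((starRingEnd ℂ) z) := by
  rw [← Complex.conj_natCast n, Complex.cpow_conj, Complex.conj_conj]
  · simp
  · rw [Complex.conj_natCast, Complex.natCast_arg]; exact Real.pi_pos.ne

lemma dsum_conj (a : ℕ → ℂ) (N : ℕ) (z : ℂ) :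
    dsum (fun n => (starRingEnd ℂ) (a n)) N z = (starRingEnd ℂ) (dsum a N ((starRingEnd ℂ) z)) := by
  unfold dsum
  rw [map_sum]
  refine sum_congr rfl fun n _ => ?_
  rw [map_mul, conj_natCast_cpow]
  simp

lemma differentiable_dsum (a : ℕ → ℂ) (N : ℕ) : Differentiable ℂ (dsum a N) := by
  unfold dsum
  refine Differentiable.fun_sum fun n hn => ?_
  have : (n:ℂ) ≠ 0 := by exact_mod_cast (by have := (mem_Icc.1 hn).1; omega)
  refine Differentiable.const_mul ?_ _
  intro z
  exact (differentiableAt_id.neg).const_cpow (Or.inl this)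

lemma norm_natCast_cpow {n : ℕ} (hn : 0 < n) (z : ℂ) : ‖(n:ℂ) ^ z‖ = (n:ℝ) ^ z.re :=
  Complex.norm_natCast_cpow_of_pos hn z

lemma mean_value_rpow (s : Finset ℕ) (hs : ∀ n ∈ s, 0 < n) (a : ℕ → ℂ) (σ α β : ℝ) :
    |(∫ t in α..β, ‖∑ n ∈ s, a n * (n:ℂ) ^ (-(σ + t * I))‖ ^ 2)
      - (β - α) * ∑ n ∈ s, ‖a n‖ ^ 2 * (n:ℝ) ^ (-(2 * σ))|
      ≤ 2 * (π * ∑ n ∈ s, n * (‖a n‖ ^ 2 * (n:ℝ) ^ (-(2 * σ)))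
        + (∑ n ∈ s, ‖a n‖ * (n:ℝ) ^ (-σ)) ^ 2) := by
  have h := mean_value s hs (fun n => a n * (n:ℂ) ^ (-(σ:ℂ))) α β
  have e0 : ∀ n ∈ s, ‖a n * (n:ℂ) ^ (-(σ:ℂ))‖ = ‖a n‖ * (n:ℝ) ^ (-σ) := by
    intro n hn
    rw [norm_mul, norm_natCast_cpow (hs n hn)]
    simp
  have e1 : ∀ n ∈ s, ‖a n * (n:ℂ) ^ (-(σ:ℂ))‖ ^ 2 = ‖a n‖ ^ 2 * (n:ℝ) ^ (-(2 * σ)) := by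
    intro n hn
    rw [e0 n hn, mul_pow, ← Real.rpow_natCast ((n:ℝ) ^ (-σ)) 2, ← Real.rpow_mul (Nat.cast_nonneg n)]
    congr 2
    push_cast; ring
  have e2 : ∀ t : ℝ, ∑ n ∈ s, a n * (n:ℂ) ^ (-(σ:ℂ)) * (n:ℂ) ^ (-(t:ℂ) * I) =
      ∑ n ∈ s, a n * (n:ℂ) ^ (-(σ + t * I)) := by
    intro t
    refine sum_congr rfl fun n hn => ?_
    have : (n:ℂ) ≠ 0 := by exact_mod_cast (hs n hn).ne'
    rw [mul_assoc, ← Complex.cpow_add _ _ this]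
    congr 2
    ring
  simp only [e2] at h
  rw [sum_congr rfl e1, sum_congr rfl e0] at h
  rw [sum_congr rfl (fun n hn => by rw [e1 n hn] : ∀ n ∈ s, (n:ℝ) * ‖a n * (n:ℂ) ^ (-(σ:ℂ))‖ ^ 2 =
    n * (‖a n‖ ^ 2 * (n:ℝ) ^ (-(2 * σ))))] at h
  exact h

lemma LogBound.dsum_left {a : ℕ → ℂ} {C : ℝ} (h : LogBound (fun n => ‖a n‖ ^ 2) C) {N : ℕ}
    (hN : 2 ≤ N) {α β : ℝ} (h2 : β - α ≤ N + 1) :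
    ∫ t in α..β, ‖dsum a N (-1/2 + t * I)‖ ^ 2 ≤ 26 * C * N ^ 3 * Real.log N := by
  have h1 := (abs_le.1 (mean_value_rpow (Icc 1 N) (fun n hn => (mem_Icc.1 hn).1) a (-1/2) α β)).2
  have hS := h N hN
  have hC := h.nonneg (fun n => by positivity)
  have hL : 0 ≤ Real.log N := Real.log_natCast_nonneg N
  have hN' : (2:ℝ) ≤ N := by exact_mod_cast hN
  have hb := sum_norm_div_sqrt_le h hN
  have s1 : ∑ n ∈ Icc 1 N, ‖a n‖ ^ 2 * (n:ℝ) ^ (-(2 * (-1/2)):ℝ) ≤ N * (C * N * Real.log N) := by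
    refine le_trans (sum_le_sum (g := fun n => N * ‖a n‖ ^ 2) fun n hn => ?_) (by rw [← mul_sum]; gcongr)
    rw [show (-(2 * (-1/2)):ℝ) = 1 by norm_num, Real.rpow_one, mul_comm]
    have : (n:ℝ) ≤ N := by exact_mod_cast (mem_Icc.1 hn).2
    gcongr
  have s2 : ∑ n ∈ Icc 1 N, (n:ℝ) * (‖a n‖ ^ 2 * (n:ℝ) ^ (-(2 * (-1/2)):ℝ)) ≤ N * (N * (C * N * Real.log N)) := by
    refine le_trans (sum_le_sum (g := fun n => N * (‖a n‖ ^ 2 * (n:ℝ) ^ (-(2 * (-1/2)):ℝ))) fun n hn => ?_) (by rw [← mul_sum]; gcongr)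
    have : (n:ℝ) ≤ N := by exact_mod_cast (mem_Icc.1 hn).2
    gcongr
  have s3 : ∑ n ∈ Icc 1 N, ‖a n‖ * (n:ℝ) ^ (-(-1/2):ℝ) ≤ N * ∑ n ∈ Icc 1 N, ‖a n‖ / √n := by
    rw [mul_sum]
    refine sum_le_sum fun n hn => ?_
    have : (n:ℝ) ≤ N := by exact_mod_cast (mem_Icc.1 hn).2
    have hn0 : (0:ℝ) < n := by exact_mod_cast (mem_Icc.1 hn).1
    have e : (n:ℝ) ^ (-(-1/2):ℝ) = n / √n := by
      rw [show (-(-1/2):ℝ) = 1/2 by norm_num, ← Real.sqrt_eq_rpow, Real.div_sqrt]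
    rw [e]
    calc ‖a n‖ * (n / √n) = n * (‖a n‖ / √n) := by ring
      _ ≤ _ := by gcongr
  have s4 : (∑ n ∈ Icc 1 N, ‖a n‖ * (n:ℝ) ^ (-(-1/2):ℝ)) ^ 2 ≤ N ^ 2 * (8 * C * N * Real.log N) := by
    calc _ ≤ (N * ∑ n ∈ Icc 1 N, ‖a n‖ / √n) ^ 2 := by
          gcongr
      _ = N ^ 2 * (∑ n ∈ Icc 1 N, ‖a n‖ / √n) ^ 2 := by ring
      _ ≤ _ := by gcongr
  have s0 : 0 ≤ ∑ n ∈ Icc 1 N, ‖a n‖ ^ 2 * (n:ℝ) ^ (-(2 * (-1/2)):ℝ) := sum_nonneg fun n _ => by positivity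
  have s5 : (β - α) * ∑ n ∈ Icc 1 N, ‖a n‖ ^ 2 * (n:ℝ) ^ (-(2 * (-1/2)):ℝ) ≤
      (2 * N) * (N * (C * N * Real.log N)) := by
    refine mul_le_mul (by linarith) s1 s0 (by positivity)
  have s6 : π * ∑ n ∈ Icc 1 N, (n:ℝ) * (‖a n‖ ^ 2 * (n:ℝ) ^ (-(2 * (-1/2)):ℝ)) ≤
      4 * (N * (N * (C * N * Real.log N))) := by
    refine mul_le_mul Real.pi_le_four s2 (sum_nonneg fun n _ => by positivity) (by norm_num)
  have e : ∀ t : ℝ, dsum a N (-1/2 + t * I) = ∑ n ∈ Icc 1 N, a n * (n:ℂ) ^ (-(((-1/2:ℝ):ℂ) + t * I)) := by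
    intro t; unfold dsum; push_cast; rfl
  simp only [e]
  nlinarith

lemma LogBound.tail_pt {a : ℕ → ℂ} {C : ℝ} (h : LogBound (fun n => ‖a n‖ ^ 2) C) {N M : ℕ}
    (hN : 2 ≤ N) (hM : N ≤ M) (t : ℝ) :
    ‖∑ n ∈ Ioc N M, a n * (n:ℂ) ^ (-(3/2 + t * I))‖ ^ 2 ≤ 84 * C * Real.log N / N := by
  refine le_trans ?_ (sum_norm_tail h hN hM)
  gcongr
  refine (norm_sum_le _ _).trans (sum_le_sum fun n hn => ?_)
  have : 0 < n := by have := (mem_Ioc.1 hn).1; omega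
  rw [norm_mul, norm_natCast_cpow this]
  simp

lemma LogBound.tail_meansq {a : ℕ → ℂ} {C : ℝ} (h : LogBound (fun n => ‖a n‖ ^ 2) C) {N M : ℕ}
    (hN : 2 ≤ N) (hM : N ≤ M) {α β : ℝ} (h2 : β - α ≤ N + 1) :
    ∫ t in α..β, ‖∑ n ∈ Ioc N M, a n * (n:ℂ) ^ (-(3/2 + t * I))‖ ^ 2 ≤ 588 * C * Real.log N / N := by
  have hpos : ∀ n ∈ Ioc N M, 0 < n := fun n hn => by have := (mem_Ioc.1 hn).1; omega
  have h1 := (abs_le.1 (mean_value_rpow (Ioc N M) hpos a (3/2) α β)).2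
  have hS := h.tail_nat (fun n => by positivity) hN hM
  have hb := sum_norm_tail h hN hM
  have hC := h.nonneg (fun n => by positivity)
  have hL : 0 ≤ Real.log N := Real.log_natCast_nonneg N
  have hN' : (2:ℝ) ≤ N := by exact_mod_cast hN
  have hN0 : (0:ℝ) < N := by linarith
  have e3 : ∀ n : ℕ, 0 < n → (n:ℝ) ^ (-(2 * (3/2)):ℝ) = ((n:ℝ) ^ 3)⁻¹ := by
    intro n hn
    rw [show (-(2 * (3/2)):ℝ) = -((3:ℕ):ℝ) by norm_num, Real.rpow_neg (by positivity), Real.rpow_natCast]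
  set X := 42 * C * Real.log N / N with hX
  have hX0 : 0 ≤ X := by positivity
  have s2 : ∑ n ∈ Ioc N M, (n:ℝ) * (‖a n‖ ^ 2 * (n:ℝ) ^ (-(2 * (3/2)):ℝ)) ≤ X := by
    refine le_trans (le_of_eq (sum_congr rfl fun n hn => ?_)) hS
    have hn0 : (0:ℝ) < n := by exact_mod_cast hpos n hn
    rw [e3 n (hpos n hn)]
    field_simp
  have s1 : N * ∑ n ∈ Ioc N M, ‖a n‖ ^ 2 * (n:ℝ) ^ (-(2 * (3/2)):ℝ) ≤ X := by
    refine le_trans ?_ s2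
    rw [mul_sum]
    refine sum_le_sum fun n hn => ?_
    have : (N:ℝ) ≤ n := by exact_mod_cast (mem_Ioc.1 hn).1.le
    gcongr
  have s0 : 0 ≤ ∑ n ∈ Ioc N M, ‖a n‖ ^ 2 * (n:ℝ) ^ (-(2 * (3/2)):ℝ) := sum_nonneg fun n _ => by positivity
  have s6 : π * ∑ n ∈ Ioc N M, (n:ℝ) * (‖a n‖ ^ 2 * (n:ℝ) ^ (-(2 * (3/2)):ℝ)) ≤ 4 * X := by
    refine mul_le_mul Real.pi_le_four s2 (sum_nonneg fun n _ => by positivity) (by norm_num)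
  have s5 : (β - α) * ∑ n ∈ Ioc N M, ‖a n‖ ^ 2 * (n:ℝ) ^ (-(2 * (3/2)):ℝ) ≤ 2 * X := by
    have : (β - α) * ∑ n ∈ Ioc N M, ‖a n‖ ^ 2 * (n:ℝ) ^ (-(2 * (3/2)):ℝ) ≤
      (2 * N) * ∑ n ∈ Ioc N M, ‖a n‖ ^ 2 * (n:ℝ) ^ (-(2 * (3/2)):ℝ) :=
        mul_le_mul_of_nonneg_right (by linarith) s0
    nlinarith
  have e : ∀ t : ℝ, ∑ n ∈ Ioc N M, a n * (n:ℂ) ^ (-(3/2 + t * I)) =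
      ∑ n ∈ Ioc N M, a n * (n:ℂ) ^ (-(((3/2:ℝ):ℂ) + t * I)) := by
    intro t; push_cast; rfl
  simp only [e]
  have e8 : 84 * C * Real.log N / N = 2 * X := by rw [hX]; ring
  have e9 : 588 * C * Real.log N / N = 14 * X := by rw [hX]; ring
  rw [e8] at hb
  rw [e9]
  have hb' : (∑ n ∈ Ioc N M, ‖a n‖ * (n:ℝ) ^ (-(3/2):ℝ)) ^ 2 ≤ 2 * X := hb
  nlinarith

lemma dsum_sub {a : ℕ → ℂ} {N M : ℕ} (hM : N ≤ M) (z : ℂ) :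
    dsum a M z - dsum a N z = ∑ n ∈ Ioc N M, a n * (n:ℂ) ^ (-z) := by
  unfold dsum
  rw [sub_eq_iff_eq_add']
  have : Icc 1 M = Icc 1 N ∪ Ioc N M := by ext n; simp; omega
  rw [this, sum_union]
  rw [Finset.disjoint_left]; intro n; simp; omega

lemma LogBound.lim_pt {a : ℕ → ℂ} {C : ℝ} (h : LogBound (fun n => ‖a n‖ ^ 2) C) {N : ℕ}
    (hN : 2 ≤ N) {t : ℝ} {S : ℂ}
    (hS : Tendsto (fun M => dsum a M (3/2 + t * I)) atTop (𝓝 S)) :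
    ‖S - dsum a N (3/2 + t * I)‖ ^ 2 ≤ 84 * C * Real.log N / N := by
  have := ((hS.sub_const (dsum a N (3/2 + t * I))).norm.pow 2)
  refine le_of_tendsto this ?_
  filter_upwards [eventually_ge_atTop N] with M hM
  rw [dsum_sub hM]
  exact h.tail_pt hN hM t

lemma LogBound.lim_meansq {a : ℕ → ℂ} {C : ℝ} (h : LogBound (fun n => ‖a n‖ ^ 2) C) {N : ℕ}
    (hN : 2 ≤ N) {S : ℝ → ℂ}
    (hS : ∀ t : ℝ, Tendsto (fun M => dsum a M (3/2 + t * I)) atTop (𝓝 (S t))) {α β : ℝ}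
    (h2 : β - α ≤ N + 1) :
    ∫ t in α..β, ‖S t - dsum a N (3/2 + t * I)‖ ^ 2 ≤ 588 * C * Real.log N / N := by
  have hlim : Tendsto (fun M => ∫ t in α..β, ‖dsum a M (3/2 + t * I) - dsum a N (3/2 + t * I)‖ ^ 2) atTop
      (𝓝 (∫ t in α..β, ‖S t - dsum a N (3/2 + t * I)‖ ^ 2)) := by
    refine intervalIntegral.tendsto_integral_filter_of_dominated_convergence
      (fun _ => 84 * C * Real.log N / N) ?_ ?_ ?_ ?_
    · filter_upwards with M
      refine Continuous.aestronglyMeasurable ?_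
      have h1 := (differentiable_dsum a M).continuous
      have h2 := (differentiable_dsum a N).continuous
      fun_prop
    · filter_upwards [eventually_ge_atTop N] with M hM
      filter_upwards with t _
      rw [dsum_sub hM, Real.norm_eq_abs, abs_of_nonneg (by positivity)]
      exact h.tail_pt hN hM t
    · exact intervalIntegrable_const
    · filter_upwards with t _
      exact ((hS t).sub_const _).norm.pow 2
  refine le_of_tendsto hlim ?_
  filter_upwards [eventually_ge_atTop N] with M hM
  simp only [dsum_sub hM]
  exact h.tail_meansq hN hM h2

/-- Trivial bound for the dual Dirichlet polynomial to the right of the critical line. -/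
lemma LogBound.dsum_pt {a : ℕ → ℂ} {C : ℝ} (h : LogBound (fun n => ‖a n‖ ^ 2) C) {N : ℕ}
    (hN : 2 ≤ N) {z : ℂ} (hz : z.re ≤ 1/2) :
    ‖dsum a N z‖ ^ 2 ≤ 8 * C * (N:ℝ) ^ (2 - 2 * z.re) * Real.log N := by
  have hN0 : (0:ℝ) < N := by positivity
  have h1 : ‖dsum a N z‖ ≤ (N:ℝ) ^ (1/2 - z.re) * ∑ n ∈ Icc 1 N, ‖a n‖ / √n := by
    rw [mul_sum]
    refine (norm_sum_le _ _).trans (sum_le_sum fun n hn => ?_)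
    have hn1 := mem_Icc.1 hn
    have hn0 : (0:ℝ) < n := by exact_mod_cast hn1.1
    have hnN : (n:ℝ) ≤ N := by exact_mod_cast hn1.2
    rw [norm_mul, norm_natCast_cpow hn1.1, Real.sqrt_eq_rpow, div_eq_mul_inv (‖a n‖), ← Real.rpow_neg hn0.le,
      neg_re, show -z.re = (1/2 - z.re) + -(1/2) by ring, Real.rpow_add hn0]
    calc _ = (n:ℝ) ^ (1/2 - z.re) * (‖a n‖ * (n:ℝ) ^ (-(1/2):ℝ)) := by ring
      _ ≤ _ := by
        have : (n:ℝ) ^ (1/2 - z.re) ≤ (N:ℝ) ^ (1/2 - z.re) := Real.rpow_le_rpow hn0.le hnN (by linarith)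
        gcongr
  have hb := sum_norm_div_sqrt_le h hN
  calc _ ≤ ((N:ℝ) ^ (1/2 - z.re) * ∑ n ∈ Icc 1 N, ‖a n‖ / √n) ^ 2 := by gcongr
    _ = ((N:ℝ) ^ (1/2 - z.re)) ^ 2 * (∑ n ∈ Icc 1 N, ‖a n‖ / √n) ^ 2 := by ring
    _ ≤ ((N:ℝ) ^ (1/2 - z.re)) ^ 2 * (8 * C * N * Real.log N) := by gcongr
    _ = 8 * C * ((N:ℝ) ^ (1 - 2 * z.re) * (N:ℝ) ^ (1:ℝ)) * Real.log N := by
      rw [← Real.rpow_natCast, ← Real.rpow_mul hN0.le, Real.rpow_one,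
        show (1/2 - z.re) * (2:ℕ) = 1 - 2 * z.re by push_cast; ring]
      ring
    _ = _ := by rw [← Real.rpow_add hN0]; ring_nf

/-- At most exponential growth in the strip `-1/2 ≤ re z ≤ 3/2`. -/
def ExpGrowth (f : ℂ → ℂ) : Prop :=
  ∃ B : ℝ, 0 ≤ B ∧ ∀ z : ℂ, -1/2 ≤ z.re → z.re ≤ 3/2 → ‖f z‖ ≤ B * Real.exp (B * |z.im|)

lemma ExpGrowth.of_le {f : ℂ → ℂ} {B C : ℝ} (hB : 0 ≤ B) (hC : 0 ≤ C)
    (h : ∀ z : ℂ, -1/2 ≤ z.re → z.re ≤ 3/2 → ‖f z‖ ≤ B * Real.exp (C * |z.im|)) : ExpGrowth f := by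
  refine ⟨B + C, by positivity, fun z h1 h2 => (h z h1 h2).trans ?_⟩
  gcongr <;> linarith

lemma ExpGrowth.add {f g : ℂ → ℂ} (hf : ExpGrowth f) (hg : ExpGrowth g) :
    ExpGrowth (fun z => f z + g z) := by
  obtain ⟨B, hB, h1⟩ := hf
  obtain ⟨C, hC, h2⟩ := hg
  refine ExpGrowth.of_le (B := B + C) (C := B + C) (by positivity) (by positivity) fun z hz1 hz2 => ?_
  calc _ ≤ B * Real.exp (B * |z.im|) + C * Real.exp (C * |z.im|) :=
        (norm_add_le _ _).trans (add_le_add (h1 z hz1 hz2) (h2 z hz1 hz2))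
    _ ≤ B * Real.exp ((B + C) * |z.im|) + C * Real.exp ((B + C) * |z.im|) := by
        gcongr <;> linarith
    _ = _ := by ring

lemma ExpGrowth.mul {f g : ℂ → ℂ} (hf : ExpGrowth f) (hg : ExpGrowth g) :
    ExpGrowth (fun z => f z * g z) := by
  obtain ⟨B, hB, h1⟩ := hf
  obtain ⟨C, hC, h2⟩ := hg
  refine ExpGrowth.of_le (B := B * C) (C := B + C) (by positivity) (by positivity) fun z hz1 hz2 => ?_
  calc _ ≤ B * Real.exp (B * |z.im|) * (C * Real.exp (C * |z.im|)) := by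
        rw [norm_mul]
        exact mul_le_mul (h1 z hz1 hz2) (h2 z hz1 hz2) (norm_nonneg _) (by positivity)
    _ = _ := by rw [add_mul, Real.exp_add]; ring

lemma ExpGrowth.const (c : ℂ) : ExpGrowth (fun _ => c) :=
  ExpGrowth.of_le (B := ‖c‖) (C := 0) (by positivity) le_rfl fun z _ _ => by simp

lemma ExpGrowth.neg {f : ℂ → ℂ} (hf : ExpGrowth f) : ExpGrowth (fun z => -f z) := by
  obtain ⟨B, hB, h1⟩ := hf
  exact ⟨B, hB, fun z hz1 hz2 => by rw [norm_neg]; exact h1 z hz1 hz2⟩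

lemma ExpGrowth.id : ExpGrowth (fun z => z) := by
  refine ExpGrowth.of_le (B := 2) (C := 1) (by norm_num) (by norm_num) fun z hz1 hz2 => ?_
  have h1 := Complex.norm_le_abs_re_add_abs_im z
  have h2 : |z.re| ≤ 3/2 := abs_le.2 ⟨by linarith, hz2⟩
  have h3 := Real.add_one_le_exp |z.im|
  have := abs_nonneg z.im
  rw [one_mul]
  linarith

lemma ExpGrowth.of_bounded {f : ℂ → ℂ} {B : ℝ}
    (h : ∀ z : ℂ, -1/2 ≤ z.re → z.re ≤ 3/2 → ‖f z‖ ≤ B) : ExpGrowth f := by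
  have hB : 0 ≤ B := (norm_nonneg _).trans (h 0 (by rw [zero_re]; norm_num) (by rw [zero_re]; norm_num))
  exact ExpGrowth.of_le (B := B) (C := 0) hB le_rfl fun z h1 h2 => by simpa using h z h1 h2

lemma ExpGrowth.shift {f : ℂ → ℂ} (hf : ExpGrowth f) (U : ℝ) : ExpGrowth (fun z => f (z + U * I)) := by
  obtain ⟨B, hB, h1⟩ := hf
  refine ExpGrowth.of_le (B := B * Real.exp (B * |U|)) (C := B) (by positivity) hB fun z hz1 hz2 => ?_
  refine (h1 _ (by simpa using hz1) (by simpa using hz2)).trans ?_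
  rw [mul_assoc, ← Real.exp_add]
  gcongr
  have := abs_add_le z.im U
  simp
  nlinarith

lemma dsum_bounded (a : ℕ → ℂ) (N : ℕ) {z : ℂ} (hz : -1/2 ≤ z.re) :
    ‖dsum a N z‖ ≤ ∑ n ∈ Icc 1 N, ‖a n‖ * (n:ℝ) ^ (1/2:ℝ) := by
  refine (norm_sum_le _ _).trans (sum_le_sum fun n hn => ?_)
  have hn1 := (mem_Icc.1 hn).1
  rw [norm_mul, norm_natCast_cpow hn1]
  have : (n:ℝ) ^ (-z).re ≤ (n:ℝ) ^ (1/2:ℝ) :=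
    Real.rpow_le_rpow_of_exponent_le (by exact_mod_cast hn1) (by rw [neg_re]; linarith)
  gcongr

/-- Data of a Dirichlet series `F = ∑ a n n^{-z}` of degree two with functional equation
`F z = Ψ z * conj (F (1 - conj z))`, where `G z = (z-1)^2 F z` and `H z = (z-1)^2 Ψ z`. The
function `S` gives the values of `F` on the line `re z = 3/2`. -/
structure FE (a : ℕ → ℂ) (S : ℝ → ℂ) (G H : ℂ → ℂ) (A : ℝ) : Prop where
  one_le : 1 ≤ A
  bound : LogBound (fun n => ‖a n‖ ^ 2) A
  diffG : DifferentiableOn ℂ G (re ⁻¹' Set.Ioo (-1) 2)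
  diffH : DifferentiableOn ℂ H (re ⁻¹' Set.Ioo (-1) 2)
  growG : ExpGrowth G
  growH : ExpGrowth H
  tendsS : ∀ t : ℝ, Tendsto (fun M => dsum a M (3/2 + t * I)) atTop (𝓝 (S t))
  right : ∀ t : ℝ, G (3/2 + t * I) = (1/2 + t * I) ^ 2 * S t
  left : ∀ t : ℝ, G (-1/2 + t * I) = H (-1/2 + t * I) * (starRingEnd ℂ) (S t)
  critical : ∀ t : ℝ, G (1/2 + t * I) * (starRingEnd ℂ) ((-1/2 + t * I) ^ 2) =
    H (1/2 + t * I) * (starRingEnd ℂ) (G (1/2 + t * I))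
  normH : ∀ t : ℝ, ‖H (1/2 + t * I)‖ = ‖(-1/2 + t * I : ℂ)‖ ^ 2
  bdR : ∀ t : ℝ, ‖H (3/2 + t * I)‖ ≤ A
  bdL : ∀ t : ℝ, ‖H (-1/2 + t * I)‖ ≤ A * (1 + |t|) ^ 4

/-- The error term, multiplied by `(z-1)^2`, of the approximate functional equation. -/
noncomputable def afeErr (a : ℕ → ℂ) (G H : ℂ → ℂ) (N : ℕ) (z : ℂ) : ℂ :=
  G z - (z - 1) ^ 2 * dsum a N z - H z * dsum (fun n => (starRingEnd ℂ) (a n)) N (1 - z)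

section Core

variable {a : ℕ → ℂ} {S : ℝ → ℂ} {G H : ℂ → ℂ} {A : ℝ}

lemma FE.differentiableOn_afeErr (fe : FE a S G H A) (N : ℕ) :
    DifferentiableOn ℂ (afeErr a G H N) (re ⁻¹' Set.Ioo (-1) 2) := by
  unfold afeErr
  have h1 := differentiable_dsum a N
  have h2 := (differentiable_dsum (fun n => (starRingEnd ℂ) (a n)) N).comp
    (differentiable_id.const_sub (1:ℂ))
  exact (fe.diffG.sub (Differentiable.differentiableOn (by fun_prop))).sub
    (fe.diffH.mul h2.differentiableOn)

lemma FE.expGrowth_afeErr (fe : FE a S G H A) (N : ℕ) : ExpGrowth (afeErr a G H N) := by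
  have h1 : ExpGrowth (fun z => dsum a N z) :=
    ExpGrowth.of_bounded fun z hz1 _ => dsum_bounded a N hz1
  have h2 : ExpGrowth (fun z => dsum (fun n => (starRingEnd ℂ) (a n)) N (1 - z)) :=
    ExpGrowth.of_bounded fun z _ hz2 => dsum_bounded _ N (by rw [sub_re, one_re]; linarith)
  have h3 : ExpGrowth (fun z => z + -1) := ExpGrowth.id.add (ExpGrowth.const (-1))
  have h4 := (fe.growG.add ((h3.mul h3).mul h1).neg).add (fe.growH.mul h2).neg
  have e : afeErr a G H N = fun z => G z + -((z + -1) * (z + -1) * dsum a N z)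
      + -(H z * dsum (fun n => (starRingEnd ℂ) (a n)) N (1 - z)) := by
    funext z; unfold afeErr; ring
  rw [e]
  exact h4

lemma continuous_vertical {f : ℂ → ℂ} (hf : DifferentiableOn ℂ f (re ⁻¹' Set.Ioo (-1) 2)) {z : ℂ}
    (h1 : -1 < z.re) (h2 : z.re < 2) : Continuous (fun t : ℝ => f (z + t * I)) := by
  refine hf.continuousOn.comp_continuous (by fun_prop) fun t => ?_
  simp [h1, h2]

lemma afeErr_right (fe : FE a S G H A) (N : ℕ) (t : ℝ) :
    afeErr a G H N (3/2 + t * I) = (1/2 + t * I) ^ 2 * (S t - dsum a N (3/2 + t * I))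
      - H (3/2 + t * I) * (starRingEnd ℂ) (dsum a N (-1/2 + t * I)) := by
  unfold afeErr
  rw [fe.right, dsum_conj]
  have : (starRingEnd ℂ) (1 - (3/2 + t * I)) = -1/2 + t * I := by
    rw [show (1 - (3/2 + t * I) : ℂ) = ((-1/2:ℝ):ℂ) - t * I by push_cast; ring, map_sub, map_mul,
      conj_ofReal, conj_ofReal, conj_I]
    push_cast; ring
  rw [this]
  ring

lemma afeErr_left (fe : FE a S G H A) (N : ℕ) (t : ℝ) :
    afeErr a G H N (-1/2 + t * I) = H (-1/2 + t * I) * (starRingEnd ℂ) (S t - dsum a N (3/2 + t * I))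
      - (-3/2 + t * I) ^ 2 * dsum a N (-1/2 + t * I) := by
  unfold afeErr
  rw [fe.left, dsum_conj]
  have : (starRingEnd ℂ) (1 - (-1/2 + t * I)) = 3/2 + t * I := by
    rw [show (1 - (-1/2 + t * I) : ℂ) = ((3/2:ℝ):ℂ) - t * I by push_cast; ring, map_sub, map_mul,
      conj_ofReal, conj_ofReal, conj_I]
    push_cast; ring
  rw [this, map_sub]
  ring

lemma FE.continuous_S (fe : FE a S G H A) : Continuous S := by
  have h := continuous_vertical fe.diffG (z := 3/2) (by norm_num) (by norm_num)
  have hne : ∀ t : ℝ, (1/2 + t * I : ℂ) ^ 2 ≠ 0 := by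
    intro t
    refine pow_ne_zero _ fun h => ?_
    have := congrArg re h
    simp at this
  have : S = fun t : ℝ => G (3/2 + t * I) / (1/2 + t * I) ^ 2 := by
    funext t
    rw [fe.right, mul_div_cancel_left₀ _ (hne t)]
  rw [this]
  exact h.div (by fun_prop) hne

lemma norm_sub_sq_le (u v : ℂ) : ‖u - v‖ ^ 2 ≤ 2 * ‖u‖ ^ 2 + 2 * ‖v‖ ^ 2 := by
  have := norm_sub_le u v
  have h0 := norm_nonneg (u - v)
  calc ‖u - v‖ ^ 2 ≤ (‖u‖ + ‖v‖) ^ 2 := by gcongr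
    _ ≤ _ := by nlinarith [sq_nonneg (‖u‖ - ‖v‖)]

lemma norm_re_add_I_le (x t : ℝ) : ‖(x + t * I : ℂ)‖ ≤ |x| + |t| := by
  refine (norm_add_le _ _).trans ?_
  simp

lemma FE.sq_right (fe : FE a S G H A) (N : ℕ) {T y t : ℝ} (hT : 1 ≤ T) (h0 : 0 ≤ t) (h1 : t ≤ 2 * T) :
    ‖afeErr a G H N (3/2 + (y + t : ℝ) * I)‖ ^ 2 ≤
      162 * T ^ 4 * (1 + |y|) ^ 4 * ‖S (y + t) - dsum a N (3/2 + (y + t : ℝ) * I)‖ ^ 2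
      + 2 * A ^ 2 * ‖dsum a N (-1/2 + (y + t : ℝ) * I)‖ ^ 2 := by
  rw [afeErr_right fe]
  refine (norm_sub_sq_le _ _).trans ?_
  have hy : 1 + |y + t| ≤ 3 * T * (1 + |y|) := by
    have := abs_add_le y t
    rw [abs_of_nonneg h0] at this
    nlinarith [abs_nonneg y]
  have e1 : ‖(1/2 + (y + t : ℝ) * I : ℂ)‖ ≤ 3 * T * (1 + |y|) := by
    have := norm_re_add_I_le (1/2) (y + t)
    rw [abs_of_pos (by norm_num : (0:ℝ) < 1/2)] at this
    push_cast at this ⊢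
    linarith
  have e2 := fe.bdR (y + t)
  rw [norm_mul, norm_mul, norm_pow, RCLike.norm_conj]
  calc _ ≤ 2 * ((3 * T * (1 + |y|)) ^ 2 * ‖S (y + t) - dsum a N (3/2 + (y + t : ℝ) * I)‖) ^ 2
        + 2 * (A * ‖dsum a N (-1/2 + (y + t : ℝ) * I)‖) ^ 2 := by gcongr
    _ = _ := by ring

lemma FE.sq_left (fe : FE a S G H A) (N : ℕ) {T y t : ℝ} (hT : 1 ≤ T) (h0 : 0 ≤ t) (h1 : t ≤ 2 * T) :
    ‖afeErr a G H N (-1/2 + (y + t : ℝ) * I)‖ ^ 2 ≤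
      13122 * A ^ 2 * T ^ 8 * (1 + |y|) ^ 8 * ‖S (y + t) - dsum a N (3/2 + (y + t : ℝ) * I)‖ ^ 2
      + 2592 * T ^ 4 * (1 + |y|) ^ 8 * ‖dsum a N (-1/2 + (y + t : ℝ) * I)‖ ^ 2 := by
  rw [afeErr_left fe]
  refine (norm_sub_sq_le _ _).trans ?_
  have hA := fe.one_le
  have hy : 1 + |y + t| ≤ 3 * T * (1 + |y|) := by
    have := abs_add_le y t
    rw [abs_of_nonneg h0] at this
    nlinarith [abs_nonneg y]
  have e1 : ‖(-3/2 + (y + t : ℝ) * I : ℂ)‖ ≤ 2 * (3 * T * (1 + |y|)) := by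
    have := norm_re_add_I_le (-3/2) (y + t)
    rw [abs_of_neg (by norm_num : (-3/2:ℝ) < 0)] at this
    push_cast at this ⊢
    linarith [abs_nonneg (y + t)]
  have e2 := fe.bdL (y + t)
  have e3 : ‖H (-1/2 + (y + t : ℝ) * I)‖ ≤ A * (3 * T * (1 + |y|)) ^ 4 := e2.trans (by gcongr)
  have e4 : (1 + |y|) ^ 4 ≤ (1 + |y|) ^ 8 :=
    pow_le_pow_right₀ (by linarith [abs_nonneg y]) (by norm_num)
  rw [norm_mul, norm_mul, norm_pow, RCLike.norm_conj]
  calc _ ≤ 2 * (A * (3 * T * (1 + |y|)) ^ 4 * ‖S (y + t) - dsum a N (3/2 + (y + t : ℝ) * I)‖) ^ 2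
        + 2 * ((2 * (3 * T * (1 + |y|))) ^ 2 * ‖dsum a N (-1/2 + (y + t : ℝ) * I)‖) ^ 2 := by gcongr
    _ = 13122 * A ^ 2 * T ^ 8 * (1 + |y|) ^ 8 * ‖S (y + t) - dsum a N (3/2 + (y + t : ℝ) * I)‖ ^ 2
      + 2592 * T ^ 4 * (1 + |y|) ^ 4 * ‖dsum a N (-1/2 + (y + t : ℝ) * I)‖ ^ 2 := by ring
    _ ≤ _ := by gcongr

/-- Numerical bookkeeping common to the pointwise and mean square estimates. -/
lemma right_arith {A T L y u v : ℝ} {N : ℕ} (hA : 1 ≤ A) (hN : 2 ≤ N) (hNT : (N:ℝ) ≤ T) (hTN : T ≤ N + 1)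
    (hL : L = Real.log T) (hu : u ≤ 588 * A * Real.log N / N) (hv : v ≤ 26 * A * N ^ 3 * Real.log N) :
    162 * T ^ 4 * (1 + |y|) ^ 4 * u + 2 * A ^ 2 * v ≤
      20000000 * A ^ 3 * T ^ 3 * L * (1 + |y|) ^ 4 := by
  have hN' : (2:ℝ) ≤ N := by exact_mod_cast hN
  have hT0 : 0 < T := by linarith
  have hLN : Real.log N ≤ L := by rw [hL]; exact Real.log_le_log (by linarith) hNT
  have hL0 : 0 ≤ Real.log N := Real.log_natCast_nonneg N
  have hu' : u ≤ 1176 * A * L / T := by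
    refine hu.trans ?_
    rw [div_le_div_iff₀ (by linarith) hT0]
    have hL1 : 0 ≤ L := hL0.trans hLN
    calc 588 * A * Real.log N * T ≤ 588 * A * L * (2 * N) := by gcongr; linarith
      _ = _ := by ring
  have hv' : v ≤ 26 * A * T ^ 3 * L := hv.trans (by gcongr)
  have h1 : (1:ℝ) ≤ (1 + |y|) ^ 4 := one_le_pow₀ (by linarith [abs_nonneg y])
  have hL1 : 0 ≤ L := hL0.trans hLN
  have hAA : A ≤ A ^ 3 := by nlinarith [sq_nonneg (A-1), mul_pos (by linarith : 0 < A) (by linarith : 0 < A)]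
  calc _ ≤ 162 * T ^ 4 * (1 + |y|) ^ 4 * (1176 * A * L / T) + 2 * A ^ 2 * (26 * A * T ^ 3 * L) := by gcongr
    _ = 190512 * A * (T ^ 3 * L * (1 + |y|) ^ 4) + 52 * A ^ 3 * (T ^ 3 * L * 1) := by field_simp; ring
    _ ≤ 190512 * A ^ 3 * (T ^ 3 * L * (1 + |y|) ^ 4) + 52 * A ^ 3 * (T ^ 3 * L * (1 + |y|) ^ 4) := by gcongr
    _ = 190564 * (A ^ 3 * (T ^ 3 * L * (1 + |y|) ^ 4)) := by ring
    _ ≤ 20000000 * (A ^ 3 * (T ^ 3 * L * (1 + |y|) ^ 4)) := by gcongr; norm_num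
    _ = _ := by ring

lemma left_arith {A T L y u v : ℝ} {N : ℕ} (hA : 1 ≤ A) (hN : 2 ≤ N) (hNT : (N:ℝ) ≤ T) (hTN : T ≤ N + 1)
    (hL : L = Real.log T) (hu : u ≤ 588 * A * Real.log N / N) (hv : v ≤ 26 * A * N ^ 3 * Real.log N) :
    13122 * A ^ 2 * T ^ 8 * (1 + |y|) ^ 8 * u + 2592 * T ^ 4 * (1 + |y|) ^ 8 * v ≤
      20000000 * A ^ 3 * T ^ 7 * L * (1 + |y|) ^ 8 := by
  have hN' : (2:ℝ) ≤ N := by exact_mod_cast hN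
  have hT0 : 0 < T := by linarith
  have hLN : Real.log N ≤ L := by rw [hL]; exact Real.log_le_log (by linarith) hNT
  have hL0 : 0 ≤ Real.log N := Real.log_natCast_nonneg N
  have hu' : u ≤ 1176 * A * L / T := by
    refine hu.trans ?_
    rw [div_le_div_iff₀ (by linarith) hT0]
    have hL1 : 0 ≤ L := hL0.trans hLN
    calc 588 * A * Real.log N * T ≤ 588 * A * L * (2 * N) := by gcongr; linarith
      _ = _ := by ring
  have hv' : v ≤ 26 * A * T ^ 3 * L := hv.trans (by gcongr)
  have hL1 : 0 ≤ L := hL0.trans hLN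
  have hAA : A ≤ A ^ 3 := by nlinarith [sq_nonneg (A-1), mul_pos (by linarith : 0 < A) (by linarith : 0 < A)]
  calc _ ≤ 13122 * A ^ 2 * T ^ 8 * (1 + |y|) ^ 8 * (1176 * A * L / T)
        + 2592 * T ^ 4 * (1 + |y|) ^ 8 * (26 * A * T ^ 3 * L) := by gcongr
    _ = 15431472 * A ^ 3 * (T ^ 7 * L * (1 + |y|) ^ 8) + 67392 * A * (T ^ 7 * L * (1 + |y|) ^ 8) := by
        field_simp; ring
    _ ≤ 15431472 * A ^ 3 * (T ^ 7 * L * (1 + |y|) ^ 8) + 67392 * A ^ 3 * (T ^ 7 * L * (1 + |y|) ^ 8) := by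
        gcongr
    _ = 15498864 * (A ^ 3 * (T ^ 7 * L * (1 + |y|) ^ 8)) := by ring
    _ ≤ 20000000 * (A ^ 3 * (T ^ 7 * L * (1 + |y|) ^ 8)) := by gcongr; norm_num
    _ = _ := by ring

lemma pt_arith {A : ℝ} (hA : 1 ≤ A) {N : ℕ} : 84 * A * Real.log N / N ≤ 588 * A * Real.log N / N := by
  have hL0 : 0 ≤ Real.log N := Real.log_natCast_nonneg N
  gcongr
  norm_num

lemma FE.dsum_left_pt (fe : FE a S G H A) {N : ℕ} (hN : 2 ≤ N) (t : ℝ) :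
    ‖dsum a N (-1/2 + t * I)‖ ^ 2 ≤ 26 * A * N ^ 3 * Real.log N := by
  have h := fe.bound.dsum_pt hN (z := -1/2 + t * I) (by simp; norm_num)
  have e : (N:ℝ) ^ (2 - 2 * (-1/2 + t * I : ℂ).re) = N ^ 3 := by
    rw [← Real.rpow_natCast]; congr 1; simp; norm_num
  rw [e] at h
  have hL0 : 0 ≤ Real.log N := Real.log_natCast_nonneg N
  have hA := fe.one_le
  refine h.trans ?_
  gcongr; norm_num

lemma FE.pt_right (fe : FE a S G H A) {T U y : ℝ} {N : ℕ} (hN : 2 ≤ N) (hNT : (N:ℝ) ≤ T)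
    (hTN : T ≤ N + 1) (h0 : 0 ≤ U) (h1 : U ≤ 2 * T) :
    ‖afeErr a G H N (3/2 + (y + U : ℝ) * I)‖ ^ 2 ≤
      20000000 * A ^ 3 * T ^ 3 * Real.log T * (1 + |y|) ^ 4 := by
  have hN' : (2:ℝ) ≤ N := by exact_mod_cast hN
  refine (fe.sq_right N (by linarith) h0 h1).trans ?_
  exact right_arith fe.one_le hN hNT hTN rfl ((fe.bound.lim_pt hN (fe.tendsS _)).trans (pt_arith fe.one_le))
    (fe.dsum_left_pt hN _)

lemma FE.pt_left (fe : FE a S G H A) {T U y : ℝ} {N : ℕ} (hN : 2 ≤ N) (hNT : (N:ℝ) ≤ T)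
    (hTN : T ≤ N + 1) (h0 : 0 ≤ U) (h1 : U ≤ 2 * T) :
    ‖afeErr a G H N (-1/2 + (y + U : ℝ) * I)‖ ^ 2 ≤
      20000000 * A ^ 3 * T ^ 7 * Real.log T * (1 + |y|) ^ 8 := by
  have hN' : (2:ℝ) ≤ N := by exact_mod_cast hN
  refine (fe.sq_left N (by linarith) h0 h1).trans ?_
  exact left_arith fe.one_le hN hNT hTN rfl ((fe.bound.lim_pt hN (fe.tendsS _)).trans (pt_arith fe.one_le))
    (fe.dsum_left_pt hN _)

lemma FE.ms_tail (fe : FE a S G H A) {T y : ℝ} {N : ℕ} (hN : 2 ≤ N) (hTN : T ≤ N + 1) :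
    ∫ t in T..(2*T), ‖S (y + t) - dsum a N (3/2 + (y + t : ℝ) * I)‖ ^ 2 ≤ 588 * A * Real.log N / N := by
  rw [intervalIntegral.integral_comp_add_left (fun u => ‖S u - dsum a N (3/2 + (u:ℝ) * I)‖ ^ 2)]
  exact fe.bound.lim_meansq hN fe.tendsS (by linarith)

lemma FE.ms_dsum (fe : FE a S G H A) {T y : ℝ} {N : ℕ} (hN : 2 ≤ N) (hTN : T ≤ N + 1) :
    ∫ t in T..(2*T), ‖dsum a N (-1/2 + (y + t : ℝ) * I)‖ ^ 2 ≤ 26 * A * N ^ 3 * Real.log N := by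
  rw [intervalIntegral.integral_comp_add_left (fun u => ‖dsum a N (-1/2 + (u:ℝ) * I)‖ ^ 2)]
  exact fe.bound.dsum_left hN (by linarith)

lemma FE.continuous_tail (fe : FE a S G H A) (N : ℕ) (y : ℝ) :
    Continuous fun t : ℝ => ‖S (y + t) - dsum a N (3/2 + (y + t : ℝ) * I)‖ ^ 2 := by
  have h1 := fe.continuous_S
  have h2 := (differentiable_dsum a N).continuous
  fun_prop

lemma continuous_dsum_left (a : ℕ → ℂ) (N : ℕ) (y : ℝ) :
    Continuous fun t : ℝ => ‖dsum a N (-1/2 + (y + t : ℝ) * I)‖ ^ 2 := by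
  have h2 := (differentiable_dsum a N).continuous
  fun_prop

lemma FE.continuous_err (fe : FE a S G H A) (N : ℕ) (y : ℝ) {σ : ℂ} (h1 : -1 < σ.re) (h2 : σ.re < 2) :
    Continuous fun t : ℝ => afeErr a G H N (σ + (y + t : ℝ) * I) :=
  (continuous_vertical (fe.differentiableOn_afeErr N) h1 h2).comp (continuous_const.add continuous_id)

lemma FE.ms_right (fe : FE a S G H A) {T y : ℝ} {N : ℕ} (hN : 2 ≤ N) (hNT : (N:ℝ) ≤ T)
    (hTN : T ≤ N + 1) :
    ∫ t in T..(2*T), ‖afeErr a G H N (3/2 + (y + t : ℝ) * I)‖ ^ 2 ≤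
      20000000 * A ^ 3 * T ^ 3 * Real.log T * (1 + |y|) ^ 4 := by
  have hN' : (2:ℝ) ≤ N := by exact_mod_cast hN
  have c1 := fe.continuous_tail N y
  have c2 := continuous_dsum_left a N y
  have c3 := (fe.continuous_err N y (σ := 3/2) (by norm_num) (by norm_num)).norm.pow 2
  calc _ ≤ ∫ t in T..(2*T), (162 * T ^ 4 * (1 + |y|) ^ 4 * ‖S (y + t) - dsum a N (3/2 + (y + t : ℝ) * I)‖ ^ 2
      + 2 * A ^ 2 * ‖dsum a N (-1/2 + (y + t : ℝ) * I)‖ ^ 2) := by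
        refine intervalIntegral.integral_mono_on (by linarith) (c3.intervalIntegrable _ _)
          (((c1.const_mul _).add (c2.const_mul _)).intervalIntegrable _ _) fun t ht => ?_
        exact fe.sq_right N (by linarith) (by linarith [ht.1]) ht.2
    _ = 162 * T ^ 4 * (1 + |y|) ^ 4 * (∫ t in T..(2*T), ‖S (y + t) - dsum a N (3/2 + (y + t : ℝ) * I)‖ ^ 2)
      + 2 * A ^ 2 * ∫ t in T..(2*T), ‖dsum a N (-1/2 + (y + t : ℝ) * I)‖ ^ 2 := by
        rw [intervalIntegral.integral_add ((c1.const_mul _).intervalIntegrable _ _)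
          ((c2.const_mul _).intervalIntegrable _ _), intervalIntegral.integral_const_mul,
          intervalIntegral.integral_const_mul]
    _ ≤ _ := right_arith fe.one_le hN hNT hTN rfl (fe.ms_tail hN hTN) (fe.ms_dsum hN hTN)

lemma FE.ms_left (fe : FE a S G H A) {T y : ℝ} {N : ℕ} (hN : 2 ≤ N) (hNT : (N:ℝ) ≤ T)
    (hTN : T ≤ N + 1) :
    ∫ t in T..(2*T), ‖afeErr a G H N (-1/2 + (y + t : ℝ) * I)‖ ^ 2 ≤
      20000000 * A ^ 3 * T ^ 7 * Real.log T * (1 + |y|) ^ 8 := by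
  have hN' : (2:ℝ) ≤ N := by exact_mod_cast hN
  have c1 := fe.continuous_tail N y
  have c2 := continuous_dsum_left a N y
  have c3 := (fe.continuous_err N y (σ := -1/2) (by norm_num) (by norm_num)).norm.pow 2
  calc _ ≤ ∫ t in T..(2*T), (13122 * A ^ 2 * T ^ 8 * (1 + |y|) ^ 8 *
        ‖S (y + t) - dsum a N (3/2 + (y + t : ℝ) * I)‖ ^ 2
      + 2592 * T ^ 4 * (1 + |y|) ^ 8 * ‖dsum a N (-1/2 + (y + t : ℝ) * I)‖ ^ 2) := by
        refine intervalIntegral.integral_mono_on (by linarith) (c3.intervalIntegrable _ _)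
          (((c1.const_mul _).add (c2.const_mul _)).intervalIntegrable _ _) fun t ht => ?_
        exact fe.sq_left N (by linarith) (by linarith [ht.1]) ht.2
    _ = 13122 * A ^ 2 * T ^ 8 * (1 + |y|) ^ 8 *
        (∫ t in T..(2*T), ‖S (y + t) - dsum a N (3/2 + (y + t : ℝ) * I)‖ ^ 2)
      + 2592 * T ^ 4 * (1 + |y|) ^ 8 * ∫ t in T..(2*T), ‖dsum a N (-1/2 + (y + t : ℝ) * I)‖ ^ 2 := by
        rw [intervalIntegral.integral_add ((c1.const_mul _).intervalIntegrable _ _)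
          ((c2.const_mul _).intervalIntegrable _ _), intervalIntegral.integral_const_mul,
          intervalIntegral.integral_const_mul]
    _ ≤ _ := left_arith fe.one_le hN hNT hTN rfl (fe.ms_tail hN hTN) (fe.ms_dsum hN hTN)

end Core

lemma isOpen_strip : IsOpen (re ⁻¹' Set.Ioo (-1:ℝ) 2) := isOpen_Ioo.preimage continuous_re

lemma differentiableOn_integral_shift {f : ℂ → ℂ} (hf : DifferentiableOn ℂ f (re ⁻¹' Set.Ioo (-1) 2))
    {φ : ℝ → ℂ} (hφ : Continuous φ) (α β : ℝ) :
    DifferentiableOn ℂ (fun z => ∫ t in α..β, f (z + t * I) * φ t) (re ⁻¹' Set.Ioo (-1) 2) := by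
  intro z₀ hz₀
  obtain ⟨ε, hε, hball⟩ := Metric.isOpen_iff.1 isOpen_strip z₀ hz₀
  have hcl : Metric.closedBall z₀ (ε/2) ⊆ re ⁻¹' Set.Ioo (-1) 2 :=
    (Metric.closedBall_subset_ball (by linarith)).trans hball
  have hmem : ∀ z ∈ re ⁻¹' Set.Ioo (-1:ℝ) 2, ∀ t : ℝ, z + t * I ∈ re ⁻¹' Set.Ioo (-1:ℝ) 2 := by
    intro z hz t; simpa using hz
  have hd : DifferentiableOn ℂ (deriv f) (re ⁻¹' Set.Ioo (-1) 2) := hf.deriv isOpen_strip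
  have hcont : ContinuousOn (fun p : ℂ × ℝ => deriv f (p.1 + p.2 * I) * φ p.2)
      (Metric.closedBall z₀ (ε/2) ×ˢ Set.uIcc α β) := by
    refine ContinuousOn.mul ?_ (by fun_prop)
    exact hd.continuousOn.comp (by fun_prop) fun p hp => hmem _ (hcl hp.1) _
  obtain ⟨K, hK⟩ := ((isCompact_closedBall z₀ (ε/2)).prod isCompact_uIcc).exists_bound_of_continuousOn hcont
  have key := intervalIntegral.hasDerivAt_integral_of_dominated_loc_of_deriv_le (μ := volume) (a := α) (b := β)
    (F := fun z t => f (z + t * I) * φ t) (F' := fun z t => deriv f (z + t * I) * φ t) (x₀ := z₀)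
    (s := Metric.closedBall z₀ (ε/2)) (bound := fun _ => K)
    (Metric.closedBall_mem_nhds _ (by linarith)) ?_ ?_ ?_ ?_ intervalIntegrable_const ?_
  · exact key.2.differentiableAt.differentiableWithinAt
  · filter_upwards [isOpen_strip.mem_nhds hz₀] with z hz
    exact ((continuous_vertical hf hz.1 hz.2).mul hφ).aestronglyMeasurable
  · exact ((continuous_vertical hf hz₀.1 hz₀.2).mul hφ).intervalIntegrable _ _
  · exact ((continuous_vertical hd hz₀.1 hz₀.2).mul hφ).aestronglyMeasurable
  · refine Eventually.of_forall fun t ht z hz => hK (z, t) ⟨hz, Set.uIoc_subset_uIcc ht⟩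
  · refine Eventually.of_forall fun t ht z hz => ?_
    have h1 : DifferentiableAt ℂ f (z + t * I) :=
      (hf _ (hmem _ (hcl hz) t)).differentiableAt (isOpen_strip.mem_nhds (hmem _ (hcl hz) t))
    exact (h1.hasDerivAt.comp_add_const z (t * I)).mul_const _

lemma cauchy_schwarz_interval {f g : ℝ → ℂ} (hf : Continuous f) (hg : Continuous g) {α β : ℝ} (h : α ≤ β) :
    ‖∫ t in α..β, f t * g t‖ ≤ √(∫ t in α..β, ‖f t‖ ^ 2) * √(∫ t in α..β, ‖g t‖ ^ 2) := by
  set X := ∫ t in α..β, ‖f t‖ ^ 2 with hX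
  set Y := ∫ t in α..β, ‖g t‖ ^ 2 with hY
  set Z := ∫ t in α..β, ‖f t‖ * ‖g t‖ with hZ
  have h1 : ‖∫ t in α..β, f t * g t‖ ≤ Z := by
    refine (intervalIntegral.norm_integral_le_integral_norm h).trans (le_of_eq ?_)
    simp only [norm_mul, hZ]
  refine h1.trans ?_
  have hX0 : 0 ≤ X := intervalIntegral.integral_nonneg h fun t _ => by positivity
  have hY0 : 0 ≤ Y := intervalIntegral.integral_nonneg h fun t _ => by positivity
  have hZ0 : 0 ≤ Z := intervalIntegral.integral_nonneg h fun t _ => by positivity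
  have q : ∀ x : ℝ, 0 ≤ X * (x * x) + (-2 * Z) * x + Y := by
    intro x
    have e : X * (x * x) + (-2 * Z) * x + Y = ∫ t in α..β, (x * ‖f t‖ - ‖g t‖) ^ 2 := by
      have e1 : (fun t => (x * ‖f t‖ - ‖g t‖) ^ 2) =
          fun t => (x * x) * ‖f t‖ ^ 2 + (-2 * x) * (‖f t‖ * ‖g t‖) + ‖g t‖ ^ 2 := by
        funext t; ring
      rw [e1, intervalIntegral.integral_add, intervalIntegral.integral_add,
        intervalIntegral.integral_const_mul, intervalIntegral.integral_const_mul]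
      · ring
      all_goals exact Continuous.intervalIntegrable (by fun_prop) _ _
    rw [e]
    exact intervalIntegral.integral_nonneg h fun t _ => by positivity
  have d := discrim_le_zero q
  rw [← Real.sqrt_mul hX0]
  refine Real.le_sqrt_of_sq_le ?_
  unfold discrim at d
  nlinarith

section Core

variable {a : ℕ → ℂ} {S : ℝ → ℂ} {G H : ℂ → ℂ} {A : ℝ}

lemma ExpGrowth.integral {f : ℂ → ℂ} (hf : ExpGrowth f) {φ : ℝ → ℂ} (hφ : Continuous φ) (α β : ℝ) :
    ExpGrowth (fun z => ∫ t in α..β, f (z + t * I) * φ t) := by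
  obtain ⟨B, hB, h1⟩ := hf
  obtain ⟨K, hK⟩ := (isCompact_uIcc (a := α) (b := β)).exists_bound_of_continuousOn hφ.continuousOn
  have hK0 : 0 ≤ K := (norm_nonneg _).trans (hK α Set.left_mem_uIcc)
  set W := max |α| |β|
  refine ExpGrowth.of_le (B := B * Real.exp (B * W) * K * |β - α|) (C := B) (by positivity) hB
    fun z hz1 hz2 => ?_
  have : ∀ t ∈ Set.uIoc α β, ‖f (z + t * I) * φ t‖ ≤ B * Real.exp (B * W) * K * Real.exp (B * |z.im|) := by
    intro t ht
    have ht' := Set.uIoc_subset_uIcc ht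
    have hW : |t| ≤ W := by
      rcases Set.mem_uIcc.1 ht' with h | h
      · exact abs_le_max_abs_abs h.1 h.2
      · rw [show W = max |β| |α| from max_comm _ _]; exact abs_le_max_abs_abs h.1 h.2
    have h2 := h1 (z + t * I) (by simpa using hz1) (by simpa using hz2)
    have h3 : |(z + t * I).im| ≤ |z.im| + W := by
      simp only [add_im, mul_im, ofReal_re, I_im, mul_one, ofReal_im, I_re, mul_zero, add_zero]
      exact (abs_add_le _ _).trans (by linarith)
    rw [norm_mul]
    calc _ ≤ (B * Real.exp (B * (|z.im| + W))) * K := by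
          refine mul_le_mul (h2.trans ?_) (hK t ht') (norm_nonneg _) (by positivity)
          gcongr
      _ = _ := by rw [mul_add, Real.exp_add]; ring
  refine (intervalIntegral.norm_integral_le_of_norm_le_const this).trans (le_of_eq ?_)
  ring

lemma FE.ms_err (fe : FE a S G H A) {T : ℝ} {N : ℕ} (hN : 2 ≤ N) (hNT : (N:ℝ) ≤ T)
    (hTN : T ≤ N + 1) :
    ∫ t in T..(2*T), ‖afeErr a G H N (1/2 + t * I)‖ ^ 2 ≤
      (64 * Real.exp (9/4)) ^ 2 * (20000000 * A ^ 3) * T ^ 5 * Real.log T := by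
  have hN' : (2:ℝ) ≤ N := by exact_mod_cast hN
  have hT1 : 1 ≤ T := by linarith
  have hA := fe.one_le
  have hL : 0 ≤ Real.log T := Real.log_nonneg hT1
  have hTT : T ≤ 2 * T := by linarith
  have hd := fe.differentiableOn_afeErr N
  set φ : ℝ → ℂ := fun t => (starRingEnd ℂ) (afeErr a G H N (1/2 + t * I)) with hφ
  have hcφ : Continuous φ := by
    have := continuous_vertical hd (z := 1/2) (by norm_num) (by norm_num)
    exact continuous_conj.comp this
  set J := ∫ t in T..(2*T), ‖afeErr a G H N (1/2 + t * I)‖ ^ 2 with hJ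
  have hJ0 : 0 ≤ J := intervalIntegral.integral_nonneg hTT fun t _ => by positivity
  have hφJ : ∫ t in T..(2*T), ‖φ t‖ ^ 2 = J := by simp [hφ, hJ]
  set K := 20000000 * A ^ 3 with hK
  have hK0 : 0 ≤ K := by positivity
  set M := √(K * T ^ 3 * Real.log T) * √J with hM
  have hb : ∀ x : ℂ, -1 < x.re → x.re < 2 → ∀ y B : ℝ, 0 ≤ B →
      ∫ t in T..(2*T), ‖afeErr a G H N (x + (y + t : ℝ) * I)‖ ^ 2 ≤ B →
      ‖∫ t in T..(2*T), afeErr a G H N (x + y * I + t * I) * φ t‖ ≤ √B * √J := by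
    intro x hx1 hx2 y B hB h
    have e : ∀ t : ℝ, x + y * I + t * I = x + (y + t : ℝ) * I := by intro t; push_cast; ring
    simp only [e]
    refine (cauchy_schwarz_interval (fe.continuous_err N y hx1 hx2) hcφ hTT).trans ?_
    rw [hφJ]
    gcongr
  obtain ⟨B, hB, hgrow⟩ := (fe.expGrowth_afeErr N).integral hcφ T (2*T)
  have key := three_lines (R := T) (M := M) (σ := 1/2)
    (differentiableOn_integral_shift hd hcφ T (2*T)) hB hgrow hT1 (by positivity) ?_ ?_ (by norm_num) (by norm_num)
  · have e1 : ∫ t in T..(2*T), afeErr a G H N (((1/2:ℝ):ℂ) + t * I) * φ t = (J:ℂ) := by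
      rw [hJ, ← intervalIntegral.integral_ofReal]
      refine intervalIntegral.integral_congr fun t _ => ?_
      simp only [hφ]
      rw [show (((1/2:ℝ):ℂ) + t * I) = 1/2 + t * I by push_cast; ring, Complex.mul_conj, Complex.normSq_eq_norm_sq]
    rw [e1, Complex.norm_real, Real.norm_eq_abs, abs_of_nonneg hJ0, hM] at key
    norm_num only [Real.rpow_one] at key
    rcases hJ0.eq_or_lt with h0 | hpos
    · rw [← h0]; positivity
    · have hs := Real.sqrt_pos.2 hpos
      have hs2 := Real.mul_self_sqrt hJ0
      set s := √J
      set r := √(K * T ^ 3 * Real.log T) with hr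
      have hr2 : r ^ 2 = K * T ^ 3 * Real.log T := Real.sq_sqrt (by positivity)
      have : s ≤ 64 * Real.exp (9/4) * r * T := by
        have : s * s ≤ (64 * Real.exp (9/4) * r * T) * s := by rw [hs2]; linarith
        exact le_of_mul_le_mul_right this hs
      calc J = s ^ 2 := by rw [← hs2]; ring
        _ ≤ (64 * Real.exp (9/4) * r * T) ^ 2 := by gcongr
        _ = (64 * Real.exp (9/4)) ^ 2 * r ^ 2 * T ^ 2 := by ring
        _ = _ := by rw [hr2]; ring
  · intro y
    refine (hb (3/2) (by norm_num) (by norm_num) y _ ?_ (fe.ms_right hN hNT hTN)).trans ?_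
    · positivity
    · rw [show 20000000 * A ^ 3 * T ^ 3 * Real.log T * (1 + |y|) ^ 4 =
        (K * T ^ 3 * Real.log T) * ((1 + |y|) ^ 2) ^ 2 by rw [hK]; ring, Real.sqrt_mul (by positivity),
        Real.sqrt_sq (by positivity)]
      have : (1 + |y|) ^ 2 ≤ (1 + |y|) ^ 4 := pow_le_pow_right₀ (by linarith [abs_nonneg y]) (by norm_num)
      calc _ = M * (1 + |y|) ^ 2 := by rw [hM]; ring
        _ ≤ _ := by gcongr
  · intro y
    refine (hb (-1/2) (by norm_num) (by norm_num) y _ ?_ (fe.ms_left hN hNT hTN)).trans ?_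
    · positivity
    · rw [show 20000000 * A ^ 3 * T ^ 7 * Real.log T * (1 + |y|) ^ 8 =
        (K * T ^ 3 * Real.log T) * (T ^ 2 * (1 + |y|) ^ 4) ^ 2 by rw [hK]; ring, Real.sqrt_mul (by positivity),
        Real.sqrt_sq (by positivity)]
      rw [hM]
      apply le_of_eq
      ring

/-- Pointwise bound of the error term to the right of the critical line. -/
lemma FE.pt_err (fe : FE a S G H A) {T U σ : ℝ} {N : ℕ} (hN : 2 ≤ N) (hNT : (N:ℝ) ≤ T)
    (hTN : T ≤ N + 1) (h0 : 0 ≤ U) (h1 : U ≤ 2 * T) (hσ1 : -1/2 ≤ σ) (hσ2 : σ ≤ 3/2) :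
    ‖afeErr a G H N (σ + U * I)‖ ≤
      64 * Real.exp (9/4) * √(20000000 * A ^ 3 * T ^ 3 * Real.log T) * T ^ (3/2 - σ) := by
  have hN' : (2:ℝ) ≤ N := by exact_mod_cast hN
  have hT1 : 1 ≤ T := by linarith
  have hA := fe.one_le
  have hL : 0 ≤ Real.log T := Real.log_nonneg hT1
  obtain ⟨B, hB, hgrow⟩ := (fe.expGrowth_afeErr N).shift U
  have hd : DifferentiableOn ℂ (fun z => afeErr a G H N (z + U * I)) (re ⁻¹' Set.Ioo (-1) 2) := by
    refine (fe.differentiableOn_afeErr N).comp (by fun_prop) fun z hz => ?_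
    simpa using hz
  refine three_lines hd hB hgrow hT1 (by positivity) ?_ ?_ hσ1 hσ2
  · intro y
    have h := fe.pt_right (y := y) hN hNT hTN h0 h1
    have e : (3/2 + y * I + U * I : ℂ) = 3/2 + (y + U : ℝ) * I := by push_cast; ring
    rw [e, ← Real.sqrt_sq (norm_nonneg (afeErr a G H N (3/2 + (y + U : ℝ) * I)))]
    refine (Real.sqrt_le_sqrt h).trans ?_
    rw [show 20000000 * A ^ 3 * T ^ 3 * Real.log T * (1 + |y|) ^ 4 =
        (20000000 * A ^ 3 * T ^ 3 * Real.log T) * ((1 + |y|) ^ 2) ^ 2 by ring, Real.sqrt_mul (by positivity),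
        Real.sqrt_sq (by positivity)]
    have : (1 + |y|) ^ 2 ≤ (1 + |y|) ^ 4 := pow_le_pow_right₀ (by linarith [abs_nonneg y]) (by norm_num)
    gcongr
  · intro y
    have h := fe.pt_left (y := y) hN hNT hTN h0 h1
    have e : (-1/2 + y * I + U * I : ℂ) = -1/2 + (y + U : ℝ) * I := by push_cast; ring
    rw [e, ← Real.sqrt_sq (norm_nonneg (afeErr a G H N (-1/2 + (y + U : ℝ) * I)))]
    refine (Real.sqrt_le_sqrt h).trans ?_
    rw [show 20000000 * A ^ 3 * T ^ 7 * Real.log T * (1 + |y|) ^ 8 =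
        (20000000 * A ^ 3 * T ^ 3 * Real.log T) * (T ^ 2 * (1 + |y|) ^ 4) ^ 2 by ring, Real.sqrt_mul (by positivity),
        Real.sqrt_sq (by positivity)]
    apply le_of_eq
    ring

lemma FE.pt_H (fe : FE a S G H A) {T U σ : ℝ} (hT1 : 1 ≤ T)
    (h0 : 0 ≤ U) (h1 : U ≤ 2 * T) (hσ1 : -1/2 ≤ σ) (hσ2 : σ ≤ 3/2) :
    ‖H (σ + U * I)‖ ≤ 64 * Real.exp (9/4) * (81 * A) * (T ^ 2) ^ (3/2 - σ) := by
  have hA := fe.one_le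
  obtain ⟨B, hB, hgrow⟩ := fe.growH.shift U
  have hd : DifferentiableOn ℂ (fun z => H (z + U * I)) (re ⁻¹' Set.Ioo (-1) 2) := by
    refine fe.diffH.comp (by fun_prop) fun z hz => ?_
    simpa using hz
  refine three_lines hd hB hgrow (one_le_pow₀ hT1) (by positivity) ?_ ?_ hσ1 hσ2
  · intro y
    have e : (3/2 + y * I + U * I : ℂ) = 3/2 + (y + U : ℝ) * I := by push_cast; ring
    rw [e]
    have : (1:ℝ) ≤ (1 + |y|) ^ 4 := one_le_pow₀ (by linarith [abs_nonneg y])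
    exact (fe.bdR _).trans (by nlinarith)
  · intro y
    have e : (-1/2 + y * I + U * I : ℂ) = -1/2 + (y + U : ℝ) * I := by push_cast; ring
    rw [e]
    refine (fe.bdL _).trans ?_
    have hy : 1 + |y + U| ≤ 3 * T * (1 + |y|) := by
      have := abs_add_le y U
      rw [abs_of_nonneg h0] at this
      nlinarith [abs_nonneg y]
    calc _ ≤ A * (3 * T * (1 + |y|)) ^ 4 := by gcongr
      _ = _ := by ring

end Core

lemma shift_contour {f : ℂ → ℂ} {T B : ℝ} (hT : 0 ≤ T)
    (hf : DifferentiableOn ℂ f {z : ℂ | 1/2 ≤ z.re ∧ z.re ≤ 3/2 ∧ T ≤ z.im})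
    (hB : ∀ σ U : ℝ, 1/2 ≤ σ → σ ≤ 3/2 → T ≤ U → U ≤ 2 * T → ‖f (σ + U * I)‖ ≤ B) :
    ‖∫ t in T..(2*T), f (1/2 + t * I)‖ ≤ ‖∫ t in T..(2*T), f (3/2 + t * I)‖ + 2 * B := by
  have h := Complex.integral_boundary_rect_eq_zero_of_differentiableOn f (1/2 + T * I) (3/2 + (2*T:ℝ) * I) ?_
  · have r1 : (1/2 + T * I : ℂ).re = 1/2 := by simp
    have r2 : (3/2 + (2*T:ℝ) * I : ℂ).re = 3/2 := by simp
    have i1 : (1/2 + T * I : ℂ).im = T := by simp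
    have i2 : (3/2 + (2*T:ℝ) * I : ℂ).im = 2*T := by simp
    rw [r1, r2, i1, i2] at h
    have hor : ∀ U : ℝ, T ≤ U → U ≤ 2 * T → ‖∫ x in (1/2:ℝ)..(3/2:ℝ), f (x + U * I)‖ ≤ B := by
      intro U h1 h2
      refine (intervalIntegral.norm_integral_le_of_norm_le_const (C := B) fun x hx => ?_).trans (le_of_eq ?_)
      · rw [Set.uIoc_of_le (by norm_num)] at hx
        exact hB x U hx.1.le hx.2 h1 h2
      · norm_num
    have h1 := hor T le_rfl (by linarith)
    have h2 := hor (2*T) (by linarith) le_rfl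
    push_cast at h h1 h2
    simp only [smul_eq_mul] at h
    have e : ∫ t in T..(2*T), f (1/2 + t * I) = (∫ t in T..(2*T), f (3/2 + t * I))
        + -I * ((∫ x in (1/2:ℝ)..(3/2:ℝ), f (x + T * I)) - ∫ x in (1/2:ℝ)..(3/2:ℝ), f (x + 2 * T * I)) := by
      linear_combination (I) * h - ((∫ t in T..(2*T), f (3/2 + t * I)) - ∫ t in T..(2*T), f (1/2 + t * I)) * I_sq
    rw [e]
    refine (norm_add_le _ _).trans ?_
    gcongr
    rw [norm_mul, norm_neg, norm_I, one_mul]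
    refine (norm_sub_le _ _).trans ?_
    linarith
  · refine hf.mono fun z hz => ?_
    rw [Complex.mem_reProdIm] at hz
    have h1 := hz.1
    have h2 := hz.2
    simp only [add_re, mul_re, I_re, mul_zero, ofReal_re, ofReal_im, I_im, add_im, mul_im] at h1 h2
    norm_num at h1 h2
    rw [Set.uIcc_of_le (by linarith)] at h2
    exact ⟨by linarith [h1.1], h1.2, h2.1⟩

section Core

variable {a : ℕ → ℂ} {S : ℝ → ℂ} {G H : ℂ → ℂ} {A : ℝ}

/-- The dual Dirichlet polynomial `z ↦ ∑_{n ≤ N} conj (a n) n^{z-1}`. -/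
noncomputable def dual (a : ℕ → ℂ) (N : ℕ) (z : ℂ) : ℂ :=
  dsum (fun n => (starRingEnd ℂ) (a n)) N (1 - z)

lemma differentiable_dual (a : ℕ → ℂ) (N : ℕ) : Differentiable ℂ (dual a N) :=
  (differentiable_dsum _ N).comp (differentiable_id.const_sub (1:ℂ))

lemma dual_critical (a : ℕ → ℂ) (N : ℕ) (t : ℝ) :
    dual a N (1/2 + t * I) = (starRingEnd ℂ) (dsum a N (1/2 + t * I)) := by
  unfold dual
  rw [dsum_conj, show (1 - (1/2 + t * I) : ℂ) = ((1/2:ℝ):ℂ) - t * I by push_cast; ring, map_sub, map_mul,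
      conj_ofReal, conj_ofReal, conj_I]
  push_cast; ring_nf

lemma dual_right (a : ℕ → ℂ) (N : ℕ) (t : ℝ) :
    dual a N (3/2 + t * I) = (starRingEnd ℂ) (dsum a N (-1/2 + t * I)) := by
  unfold dual
  rw [dsum_conj, show (1 - (3/2 + t * I) : ℂ) = ((-1/2:ℝ):ℂ) - t * I by push_cast; ring, map_sub, map_mul,
      conj_ofReal, conj_ofReal, conj_I]
  push_cast; ring_nf

/-- `P z * conj (P (1 - conj z))` for the Dirichlet polynomial `P`; on the critical line it
is `‖P z‖ ^ 2`. -/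
noncomputable def weight (c : ℕ → ℂ) (Q : ℕ) (z : ℂ) : ℂ := dsum c Q z * dual c Q z

/-- A bound for a Dirichlet polynomial in the strip. -/
noncomputable def wbound (c : ℕ → ℂ) (Q : ℕ) : ℝ := ∑ n ∈ Icc 1 Q, ‖c n‖ * (n:ℝ) ^ (1/2:ℝ)

lemma wbound_nonneg (c : ℕ → ℂ) (Q : ℕ) : 0 ≤ wbound c Q := sum_nonneg fun n _ => by positivity

lemma differentiable_weight (c : ℕ → ℂ) (Q : ℕ) : Differentiable ℂ (weight c Q) :=
  (differentiable_dsum c Q).mul (differentiable_dual c Q)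

lemma norm_weight_le (c : ℕ → ℂ) (Q : ℕ) {z : ℂ} (h1 : -1/2 ≤ z.re) (h2 : z.re ≤ 3/2) :
    ‖weight c Q z‖ ≤ wbound c Q ^ 2 := by
  have e1 : ‖dsum c Q z‖ ≤ wbound c Q := dsum_bounded c Q h1
  have e2 : ‖dual c Q z‖ ≤ wbound c Q := by
    unfold dual
    refine (dsum_bounded _ Q (by rw [sub_re, one_re]; linarith)).trans (le_of_eq ?_)
    simp [wbound]
  unfold weight
  rw [norm_mul, pow_two]
  exact mul_le_mul e1 e2 (norm_nonneg _) (wbound_nonneg _ _)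

lemma weight_critical (c : ℕ → ℂ) (Q : ℕ) (t : ℝ) :
    weight c Q (1/2 + t * I) = ((‖dsum c Q (1/2 + t * I)‖ ^ 2 : ℝ) : ℂ) := by
  unfold weight
  rw [dual_critical, Complex.mul_conj, Complex.normSq_eq_norm_sq]

lemma FE.dual_pt (fe : FE a S G H A) {T σ U : ℝ} {N : ℕ} (hN : 2 ≤ N) (hNT : (N:ℝ) ≤ T)
    (hσ : 1/2 ≤ σ) : ‖dual a N (σ + U * I)‖ ^ 2 ≤ 8 * A * T ^ (2 * σ) * Real.log T := by
  have hA := fe.one_le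
  have hN' : (2:ℝ) ≤ N := by exact_mod_cast hN
  have hL0 : 0 ≤ Real.log N := Real.log_natCast_nonneg N
  have hb : LogBound (fun n => ‖(starRingEnd ℂ) (a n)‖ ^ 2) A := by simpa using fe.bound
  have h := hb.dsum_pt hN (z := 1 - (σ + U * I)) (by simp; linarith)
  have e : 2 - 2 * (1 - (σ + U * I) : ℂ).re = 2 * σ := by simp; ring
  rw [e] at h
  unfold dual
  refine h.trans ?_
  have h1 : (N:ℝ) ^ (2 * σ) ≤ T ^ (2 * σ) := Real.rpow_le_rpow (by linarith) hNT (by linarith)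
  have h2 : Real.log N ≤ Real.log T := Real.log_le_log (by linarith) hNT
  have hT0 : 0 ≤ T := by linarith
  gcongr

lemma sq_le_norm_sub_one_sq (z : ℂ) {T : ℝ} (hT : 0 ≤ T) (h : T ≤ z.im) : T ^ 2 ≤ ‖(z - 1) ^ 2‖ := by
  rw [norm_pow]
  have : T ≤ ‖z - 1‖ := by
    refine h.trans ?_
    have := Complex.abs_im_le_norm (z - 1)
    simp at this
    exact (le_abs_self _).trans this
  gcongr

lemma sub_one_ne {z : ℂ} {T : ℝ} (hT : 0 < T) (h : T ≤ z.im) : (z - 1) ^ 2 ≠ 0 := by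
  have := sq_le_norm_sub_one_sq z hT.le h
  have h2 : 0 < T ^ 2 := by positivity
  exact norm_pos_iff.1 (by linarith)

lemma FE.cross_err (fe : FE a S G H A) (c : ℕ → ℂ) (Q : ℕ) :
    ∃ K : ℝ, ∀ (T : ℝ) (N : ℕ), 2 ≤ N → (N:ℝ) ≤ T → T ≤ N + 1 →
      ‖∫ t in T..(2*T), weight c Q (1/2 + t * I) * (afeErr a G H N (1/2 + t * I) / (1/2 + t * I - 1) ^ 2) *
        dual a N (1/2 + t * I)‖ ≤ K * T * Real.log T := by
  set W := wbound c Q ^ 2 with hW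
  have hW0 : 0 ≤ W := by positivity
  have hA := fe.one_le
  refine ⟨W * √(20000000 * A ^ 3) * √(26 * A) +
    2 * (W * (64 * Real.exp (9/4)) * √(20000000 * A ^ 3) * √(8 * A)), fun T N hN hNT hTN => ?_⟩
  have hN' : (2:ℝ) ≤ N := by exact_mod_cast hN
  have hT0 : 0 < T := by linarith
  have hTT : T ≤ 2 * T := by linarith
  have hL : 0 ≤ Real.log T := Real.log_nonneg (by linarith)
  refine (shift_contour (f := fun z => weight c Q z * (afeErr a G H N z / (z - 1) ^ 2) * dual a N z)
    (B := W * (64 * Real.exp (9/4)) * √(20000000 * A ^ 3) * √(8 * A) * T * Real.log T) hT0.le ?_ ?_).trans ?_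
  · refine ((differentiable_weight c Q).differentiableOn.mul (DifferentiableOn.div ?_ ?_ ?_)).mul
      (differentiable_dual a N).differentiableOn
    · refine (fe.differentiableOn_afeErr N).mono fun z hz => ?_
      exact ⟨by linarith [hz.1], by linarith [hz.2.1]⟩
    · exact Differentiable.differentiableOn (by fun_prop)
    · intro z hz
      exact sub_one_ne hT0 hz.2.2
  · intro σ U h1 h2 h3 h4
    have w1 := norm_weight_le c Q (z := σ + U * I) (by simp; linarith) (by simp; linarith)
    have w2 := fe.pt_err hN hNT hTN (U := U) (σ := σ) (by linarith) h4 (by linarith) h2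
    have w3 := fe.dual_pt hN hNT (σ := σ) (U := U) h1
    have w4 := sq_le_norm_sub_one_sq (σ + U * I) hT0.le (by simpa using h3)
    have w5 : ‖dual a N (σ + U * I)‖ ≤ √(8 * A) * √(Real.log T) * T ^ σ := by
      refine abs_le_of_sq_le_sq' (w3.trans (le_of_eq ?_)) (by positivity) |>.2
      rw [mul_pow, mul_pow, Real.sq_sqrt (by positivity), Real.sq_sqrt hL, ← Real.rpow_natCast (T ^ σ),
        ← Real.rpow_mul hT0.le, mul_comm σ]
      push_cast
      ring
    have w6 : √(20000000 * A ^ 3 * T ^ 3 * Real.log T) * T ^ (3/2 - σ) =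
        √(20000000 * A ^ 3) * √(Real.log T) * T ^ (3 - σ) := by
      rw [Real.sqrt_mul (by positivity), Real.sqrt_mul (by positivity), Real.sqrt_eq_rpow (T ^ 3),
        ← Real.rpow_natCast T 3, ← Real.rpow_mul hT0.le,
        show 3 - σ = ((3:ℕ) * (1/2) : ℝ) + (3/2 - σ) by push_cast; ring, Real.rpow_add hT0]
      ring
    rw [norm_mul, norm_mul, norm_div]
    rw [mul_assoc (64 * Real.exp (9/4)), w6] at w2
    calc _ ≤ W * ((64 * Real.exp (9/4) * (√(20000000 * A ^ 3) * √(Real.log T) * T ^ (3 - σ))) / T ^ 2) *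
          (√(8 * A) * √(Real.log T) * T ^ σ) := by gcongr
      _ = W * (64 * Real.exp (9/4)) * √(20000000 * A ^ 3) * √(8 * A) *
          (T ^ (3 - σ) * T ^ σ) / T ^ 2 * (√(Real.log T) * √(Real.log T)) := by ring
      _ = _ := by
        rw [Real.mul_self_sqrt hL, ← Real.rpow_add hT0, show 3 - σ + σ = ((3:ℕ):ℝ) by push_cast; ring, Real.rpow_natCast]
        field_simp
  · have hE := fe.continuous_err N 0 (σ := 3/2) (by norm_num) (by norm_num)
    simp only [zero_add] at hE
    have hcd : Continuous fun t : ℝ => dual a N (3/2 + t * I) := by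
      have := (differentiable_dual a N).continuous
      fun_prop
    have hne : ∀ t : ℝ, (3/2 + t * I - 1 : ℂ) ^ 2 ≠ 0 := by
      intro t
      refine pow_ne_zero _ fun h => ?_
      have := congrArg re h
      norm_num at this
    have hcg : Continuous fun t : ℝ => weight c Q (3/2 + t * I) * dual a N (3/2 + t * I) / (3/2 + t * I - 1) ^ 2 := by
      have := (differentiable_weight c Q).continuous
      exact Continuous.div (by fun_prop) (by fun_prop) hne
    have cs := cauchy_schwarz_interval hE hcg hTT
    have m1 := fe.ms_right (y := 0) hN hNT hTN
    have m2 := fe.ms_dsum (y := 0) hN hTN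
    simp only [zero_add, abs_zero, add_zero, one_pow, mul_one] at m1 m2
    have m3 : ∫ t in T..(2*T), ‖weight c Q (3/2 + t * I) * dual a N (3/2 + t * I) / (3/2 + t * I - 1) ^ 2‖ ^ 2
        ≤ W ^ 2 / T ^ 4 * (26 * A * T ^ 3 * Real.log T) := by
      calc _ ≤ ∫ t in T..(2*T), W ^ 2 / T ^ 4 * ‖dsum a N (-1/2 + t * I)‖ ^ 2 := by
            refine intervalIntegral.integral_mono_on hTT ((hcg.norm.pow 2).intervalIntegrable _ _) ?_ fun t ht => ?_
            · have := continuous_dsum_left a N 0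
              simp only [zero_add] at this
              exact (this.const_mul _).intervalIntegrable _ _
            · have w1 := norm_weight_le c Q (z := 3/2 + t * I) (by simp; linarith) (by simp)
              have w4 := sq_le_norm_sub_one_sq (3/2 + t * I) hT0.le (by simpa using ht.1)
              rw [norm_div, norm_mul, dual_right, RCLike.norm_conj]
              calc _ ≤ (W * ‖dsum a N (-1/2 + t * I)‖ / T ^ 2) ^ 2 := by gcongr
                _ = _ := by field_simp
        _ = W ^ 2 / T ^ 4 * ∫ t in T..(2*T), ‖dsum a N (-1/2 + t * I)‖ ^ 2 := by
            rw [intervalIntegral.integral_const_mul]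
        _ ≤ W ^ 2 / T ^ 4 * (26 * A * N ^ 3 * Real.log N) := by gcongr
        _ ≤ _ := by
            have h2 : Real.log N ≤ Real.log T := Real.log_le_log (by linarith) hNT
            have : 0 ≤ Real.log N := Real.log_natCast_nonneg N
            gcongr
    have e : ∀ t : ℝ, weight c Q (3/2 + t * I) * (afeErr a G H N (3/2 + t * I) / (3/2 + t * I - 1) ^ 2) *
        dual a N (3/2 + t * I) = afeErr a G H N (3/2 + t * I) *
        (weight c Q (3/2 + t * I) * dual a N (3/2 + t * I) / (3/2 + t * I - 1) ^ 2) := by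
      intro t; ring
    simp only [e]
    have fin : √(∫ t in T..(2*T), ‖afeErr a G H N (3/2 + t * I)‖ ^ 2) *
        √(∫ t in T..(2*T), ‖weight c Q (3/2 + t * I) * dual a N (3/2 + t * I) / (3/2 + t * I - 1) ^ 2‖ ^ 2) ≤
        W * √(20000000 * A ^ 3) * √(26 * A) * T * Real.log T := by
      refine (mul_le_mul (Real.sqrt_le_sqrt m1) (Real.sqrt_le_sqrt m3) (Real.sqrt_nonneg _) (Real.sqrt_nonneg _)).trans
        (le_of_eq ?_)
      rw [← Real.sqrt_mul (by positivity)]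
      have : 20000000 * A ^ 3 * T ^ 3 * Real.log T * (W ^ 2 / T ^ 4 * (26 * A * T ^ 3 * Real.log T)) =
          ((20000000 * A ^ 3) * (26 * A)) * (W * T * Real.log T) ^ 2 := by field_simp
      rw [this, Real.sqrt_mul (by positivity), Real.sqrt_sq (by positivity), Real.sqrt_mul (by positivity)]
      ring
    have := cs.trans fin
    linarith

lemma FE.cross_dual (fe : FE a S G H A) (c : ℕ → ℂ) (Q : ℕ) :
    ∃ K : ℝ, ∀ (T : ℝ) (N : ℕ), 2 ≤ N → (N:ℝ) ≤ T → T ≤ N + 1 →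
      ‖∫ t in T..(2*T), weight c Q (1/2 + t * I) * (H (1/2 + t * I) / (1/2 + t * I - 1) ^ 2) *
        dual a N (1/2 + t * I) ^ 2‖ ≤ K * T * Real.log T := by
  set W := wbound c Q ^ 2 with hW
  have hW0 : 0 ≤ W := by positivity
  have hA := fe.one_le
  refine ⟨W * A * (26 * A) + 2 * (W * (64 * Real.exp (9/4) * (81 * A)) * (8 * A)), fun T N hN hNT hTN => ?_⟩
  have hN' : (2:ℝ) ≤ N := by exact_mod_cast hN
  have hT0 : 0 < T := by linarith
  have hTT : T ≤ 2 * T := by linarith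
  have hL : 0 ≤ Real.log T := Real.log_nonneg (by linarith)
  refine (shift_contour (f := fun z => weight c Q z * (H z / (z - 1) ^ 2) * dual a N z ^ 2)
    (B := W * (64 * Real.exp (9/4) * (81 * A)) * (8 * A) * T * Real.log T) hT0.le ?_ ?_).trans ?_
  · refine ((differentiable_weight c Q).differentiableOn.mul (DifferentiableOn.div ?_ ?_ ?_)).mul
      ((differentiable_dual a N).pow 2).differentiableOn
    · refine fe.diffH.mono fun z hz => ?_
      exact ⟨by linarith [hz.1], by linarith [hz.2.1]⟩
    · exact Differentiable.differentiableOn (by fun_prop)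
    · intro z hz
      exact sub_one_ne hT0 hz.2.2
  · intro σ U h1 h2 h3 h4
    have w1 := norm_weight_le c Q (z := σ + U * I) (by simp; linarith) (by simp; linarith)
    have w2 := fe.pt_H (T := T) (U := U) (σ := σ) (by linarith) (by linarith) h4 (by linarith) h2
    have w3 := fe.dual_pt hN hNT (σ := σ) (U := U) h1
    have w4 := sq_le_norm_sub_one_sq (σ + U * I) hT0.le (by simpa using h3)
    rw [norm_mul, norm_mul, norm_div, norm_pow (dual a N _)]
    calc _ ≤ W * ((64 * Real.exp (9/4) * (81 * A) * (T ^ 2) ^ (3/2 - σ)) / T ^ 2) *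
          (8 * A * T ^ (2 * σ) * Real.log T) := by gcongr
      _ = W * (64 * Real.exp (9/4) * (81 * A)) * (8 * A) * ((T ^ 2) ^ (3/2 - σ) * T ^ (2 * σ)) / T ^ 2 * Real.log T := by ring
      _ = _ := by
        rw [← Real.rpow_natCast T 2, ← Real.rpow_mul hT0.le, ← Real.rpow_add hT0,
          show ((2:ℕ):ℝ) * (3/2 - σ) + 2 * σ = ((3:ℕ):ℝ) by push_cast; ring, Real.rpow_natCast, Real.rpow_natCast]
        field_simp
  · have m2 := fe.ms_dsum (y := 0) hN hTN
    simp only [zero_add] at m2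
    have h2 : Real.log N ≤ Real.log T := Real.log_le_log (by linarith) hNT
    have h0 : 0 ≤ Real.log N := Real.log_natCast_nonneg N
    have main : ‖∫ t in T..(2*T), weight c Q (3/2 + t * I) * (H (3/2 + t * I) / (3/2 + t * I - 1) ^ 2) *
        dual a N (3/2 + t * I) ^ 2‖ ≤ W * A * (26 * A) * T * Real.log T := by
      calc _ ≤ ∫ t in T..(2*T), W * A / T ^ 2 * ‖dsum a N (-1/2 + t * I)‖ ^ 2 := by
            refine intervalIntegral.norm_integral_le_of_norm_le hTT ?_ ?_
            · refine Eventually.of_forall fun t ht => ?_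
              have w1 := norm_weight_le c Q (z := 3/2 + t * I) (by simp; linarith) (by simp)
              have w4 := sq_le_norm_sub_one_sq (3/2 + t * I) hT0.le (by simpa using ht.1.le)
              have w5 := fe.bdR t
              rw [norm_mul, norm_mul, norm_div, norm_pow (dual a N _), dual_right, RCLike.norm_conj]
              calc _ ≤ W * (A / T ^ 2) * ‖dsum a N (-1/2 + t * I)‖ ^ 2 := by gcongr
                _ = _ := by ring
            · have := continuous_dsum_left a N 0
              simp only [zero_add] at this
              exact (this.const_mul _).intervalIntegrable _ _
        _ = W * A / T ^ 2 * ∫ t in T..(2*T), ‖dsum a N (-1/2 + t * I)‖ ^ 2 := by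
            rw [intervalIntegral.integral_const_mul]
        _ ≤ W * A / T ^ 2 * (26 * A * N ^ 3 * Real.log N) := by gcongr
        _ ≤ W * A / T ^ 2 * (26 * A * T ^ 3 * Real.log T) := by gcongr
        _ = _ := by field_simp
    linarith

/-- The algebraic identity behind the mean square of the approximate functional equation. -/
lemma norm_sq_identity {F D E Ψ : ℂ} (hE : E = F - D - Ψ * (starRingEnd ℂ) D)
    (hF : F = Ψ * (starRingEnd ℂ) F) (hΨ : ‖Ψ‖ = 1) :
    ‖F‖ ^ 2 = ‖E‖ ^ 2 + 2 * ‖D‖ ^ 2 + 4 * (E * (starRingEnd ℂ) D).re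
      + 2 * (Ψ * (starRingEnd ℂ) D ^ 2).re := by
  have hΨ1 : Ψ * (starRingEnd ℂ) Ψ = 1 := by
    rw [Complex.mul_conj, Complex.normSq_eq_norm_sq, hΨ]; simp
  have hEc : (starRingEnd ℂ) E = (starRingEnd ℂ) F - (starRingEnd ℂ) D - (starRingEnd ℂ) Ψ * D := by
    rw [hE]; simp
  have hE2 : E = Ψ * (starRingEnd ℂ) E := by
    rw [hEc, hE]
    linear_combination hF + D * hΨ1
  have key : ∀ z : ℂ, ((‖z‖ ^ 2 : ℝ) : ℂ) = z * (starRingEnd ℂ) z := by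
    intro z; rw [Complex.mul_conj, Complex.normSq_eq_norm_sq]
  have re2 : ∀ z : ℂ, ((2 * z.re : ℝ) : ℂ) = z + (starRingEnd ℂ) z := by
    intro z; rw [Complex.add_conj]
  have : ((‖F‖ ^ 2 : ℝ) : ℂ) = ((‖E‖ ^ 2 + 2 * ‖D‖ ^ 2 + 4 * (E * (starRingEnd ℂ) D).re
      + 2 * (Ψ * (starRingEnd ℂ) D ^ 2).re : ℝ) : ℂ) := by
    have e4 : ((4 * (E * (starRingEnd ℂ) D).re : ℝ) : ℂ) = 2 * (E * (starRingEnd ℂ) D + (starRingEnd ℂ) E * D) := by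
      rw [show 4 * (E * (starRingEnd ℂ) D).re = 2 * (2 * (E * (starRingEnd ℂ) D).re) by ring, ofReal_mul, re2]
      simp
    rw [ofReal_add, ofReal_add, ofReal_add, ofReal_mul 2, key, key, key, e4, re2]
    have hFe : F = E + D + Ψ * (starRingEnd ℂ) D := by rw [hE]; ring
    have hFc : (starRingEnd ℂ) F = (starRingEnd ℂ) E + (starRingEnd ℂ) D + (starRingEnd ℂ) Ψ * D := by rw [hEc]; ring
    rw [hFc, map_mul, map_pow, Complex.conj_conj, hFe]
    push_cast
    linear_combination (D * (starRingEnd ℂ) D + (starRingEnd ℂ) E * D) * hΨ1 +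
      (D * (starRingEnd ℂ) Ψ - (starRingEnd ℂ) D) * hE2
  exact_mod_cast this

end Core

section Core

variable {a : ℕ → ℂ} {S : ℝ → ℂ} {G H : ℂ → ℂ} {A : ℝ}

lemma FE.pointwise (fe : FE a S G H A) (c : ℕ → ℂ) (Q N : ℕ) (t : ℝ) (ht : 0 < t) :
    ‖dsum c Q (1/2 + t * I) * (G (1/2 + t * I) / (1/2 + t * I - 1) ^ 2)‖ ^ 2 =
      ‖dsum c Q (1/2 + t * I) * (afeErr a G H N (1/2 + t * I) / (1/2 + t * I - 1) ^ 2)‖ ^ 2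
      + 2 * ‖dsum c Q (1/2 + t * I) * dsum a N (1/2 + t * I)‖ ^ 2
      + 4 * (weight c Q (1/2 + t * I) * (afeErr a G H N (1/2 + t * I) / (1/2 + t * I - 1) ^ 2) *
        dual a N (1/2 + t * I)).re
      + 2 * (weight c Q (1/2 + t * I) * (H (1/2 + t * I) / (1/2 + t * I - 1) ^ 2) *
        dual a N (1/2 + t * I) ^ 2).re := by
  have hne : (1/2 + t * I - 1 : ℂ) ^ 2 ≠ 0 := sub_one_ne (z := 1/2 + t * I) ht (by simp)
  have e1 : (1/2 + t * I - 1 : ℂ) = -1/2 + t * I := by ring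
  have hne' : (starRingEnd ℂ) ((1/2 + t * I - 1 : ℂ) ^ 2) ≠ 0 :=
    (map_ne_zero (starRingEnd ℂ)).2 hne
  have hcr := fe.critical t
  have hd := dual_critical a N t
  have key := norm_sq_identity (F := G (1/2 + t * I) / (1/2 + t * I - 1) ^ 2)
    (D := dsum a N (1/2 + t * I)) (E := afeErr a G H N (1/2 + t * I) / (1/2 + t * I - 1) ^ 2)
    (Ψ := H (1/2 + t * I) / (1/2 + t * I - 1) ^ 2) ?_ ?_ ?_
  · rw [weight_critical, mul_assoc, mul_assoc, re_ofReal_mul, re_ofReal_mul, hd, norm_mul, mul_pow, key, norm_mul,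
      norm_mul]
    ring
  · rw [← hd]
    unfold afeErr dual
    rw [sub_div, sub_div, mul_div_cancel_left₀ _ hne, mul_div_right_comm (H _)]
  · rw [map_div₀]
    rw [← e1] at hcr
    rw [div_mul_div_comm, div_eq_div_iff hne (mul_ne_zero hne hne')]
    linear_combination (1/2 + t * I - 1) ^ 2 * hcr
  · rw [norm_div, fe.normH, e1, norm_pow]
    refine div_self ?_
    rw [← norm_pow, ← e1]
    exact (norm_pos_iff.2 hne).ne'

lemma FE.ms_weighted_err (fe : FE a S G H A) (c : ℕ → ℂ) (Q : ℕ) {T : ℝ} {N : ℕ} (hN : 2 ≤ N)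
    (hNT : (N:ℝ) ≤ T) (hTN : T ≤ N + 1) :
    ∫ t in T..(2*T), ‖dsum c Q (1/2 + t * I) * (afeErr a G H N (1/2 + t * I) / (1/2 + t * I - 1) ^ 2)‖ ^ 2 ≤
      wbound c Q ^ 2 * ((64 * Real.exp (9/4)) ^ 2 * (20000000 * A ^ 3)) * T * Real.log T := by
  have hN' : (2:ℝ) ≤ N := by exact_mod_cast hN
  have hT0 : 0 < T := by linarith
  have hTT : T ≤ 2 * T := by linarith
  have hE := fe.continuous_err N 0 (σ := 1/2) (by norm_num) (by norm_num)
  simp only [zero_add] at hE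
  calc _ ≤ ∫ t in T..(2*T), wbound c Q ^ 2 / T ^ 4 * ‖afeErr a G H N (1/2 + t * I)‖ ^ 2 := by
        refine intervalIntegral.integral_mono_on_of_le_Ioo hTT ?_ ?_ fun t ht => ?_
        · refine ContinuousOn.intervalIntegrable ?_
          refine ContinuousOn.pow (ContinuousOn.norm (ContinuousOn.mul ?_ (ContinuousOn.div hE.continuousOn ?_ ?_))) 2
          · have := (differentiable_dsum c Q).continuous
            exact Continuous.continuousOn (by fun_prop)
          · exact Continuous.continuousOn (by fun_prop)
          · intro t ht
            rw [Set.uIcc_of_le hTT] at ht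
            exact sub_one_ne hT0 (by simpa using ht.1)
        · exact ((hE.norm.pow 2).const_mul _).intervalIntegrable _ _
        · have w1 : ‖dsum c Q (1/2 + t * I)‖ ≤ wbound c Q := dsum_bounded c Q (by simp; linarith)
          have w4 := sq_le_norm_sub_one_sq (1/2 + t * I) hT0.le (by simpa using ht.1.le)
          have w0 := wbound_nonneg c Q
          rw [norm_mul, norm_div]
          calc _ ≤ (wbound c Q * (‖afeErr a G H N (1/2 + t * I)‖ / T ^ 2)) ^ 2 := by gcongr
            _ = _ := by field_simp
    _ = wbound c Q ^ 2 / T ^ 4 * ∫ t in T..(2*T), ‖afeErr a G H N (1/2 + t * I)‖ ^ 2 := by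
        rw [intervalIntegral.integral_const_mul]
    _ ≤ wbound c Q ^ 2 / T ^ 4 * ((64 * Real.exp (9/4)) ^ 2 * (20000000 * A ^ 3) * T ^ 5 * Real.log T) := by
        gcongr
        exact fe.ms_err hN hNT hTN
    _ = _ := by field_simp

lemma FE.sq_main (fe : FE a S G H A) (c : ℕ → ℂ) (Q : ℕ) :
    ∃ K : ℝ, ∀ (T : ℝ) (N : ℕ), 2 ≤ N → (N:ℝ) ≤ T → T ≤ N + 1 →
      |(∫ t in T..(2*T), ‖dsum c Q (1/2 + t * I) * (G (1/2 + t * I) / (1/2 + t * I - 1) ^ 2)‖ ^ 2)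
        - 2 * ∫ t in T..(2*T), ‖dsum c Q (1/2 + t * I) * dsum a N (1/2 + t * I)‖ ^ 2| ≤
      K * T * Real.log T := by
  obtain ⟨K1, h1⟩ := fe.cross_err c Q
  obtain ⟨K2, h2⟩ := fe.cross_dual c Q
  refine ⟨wbound c Q ^ 2 * ((64 * Real.exp (9/4)) ^ 2 * (20000000 * A ^ 3)) + 4 * K1 + 2 * K2,
    fun T N hN hNT hTN => ?_⟩
  have h1 := h1 T N hN hNT hTN
  have h2 := h2 T N hN hNT hTN
  have h3 := fe.ms_weighted_err c Q hN hNT hTN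
  have hN' : (2:ℝ) ≤ N := by exact_mod_cast hN
  have hT0 : 0 < T := by linarith
  have hTT : T ≤ 2 * T := by linarith
  have hE := fe.continuous_err N 0 (σ := 1/2) (by norm_num) (by norm_num)
  simp only [zero_add] at hE
  have hH : Continuous fun t : ℝ => H (1/2 + t * I) := continuous_vertical fe.diffH (by norm_num) (by norm_num)
  have cP : Continuous fun t : ℝ => dsum c Q (1/2 + t * I) := by
    have := (differentiable_dsum c Q).continuous
    fun_prop
  have cW : Continuous fun t : ℝ => weight c Q (1/2 + t * I) := by
    have := (differentiable_weight c Q).continuous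
    fun_prop
  have cD : Continuous fun t : ℝ => dsum a N (1/2 + t * I) := by
    have := (differentiable_dsum a N).continuous
    fun_prop
  have cdu : Continuous fun t : ℝ => dual a N (1/2 + t * I) := by
    have := (differentiable_dual a N).continuous
    fun_prop
  have hne : ∀ t : ℝ, (1/2 + t * I - 1 : ℂ) ^ 2 ≠ 0 := by
    intro t
    refine pow_ne_zero _ fun h => ?_
    have := congrArg re h
    norm_num at this
  have cE : Continuous fun t : ℝ => afeErr a G H N (1/2 + t * I) / (1/2 + t * I - 1) ^ 2 :=
    hE.div (by fun_prop) hne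
  have cΨ : Continuous fun t : ℝ => H (1/2 + t * I) / (1/2 + t * I - 1) ^ 2 :=
    hH.div (by fun_prop) hne
  have i3 : Continuous fun t : ℝ => weight c Q (1/2 + t * I) *
      (afeErr a G H N (1/2 + t * I) / (1/2 + t * I - 1) ^ 2) * dual a N (1/2 + t * I) := (cW.mul cE).mul cdu
  have i4 : Continuous fun t : ℝ => weight c Q (1/2 + t * I) *
      (H (1/2 + t * I) / (1/2 + t * I - 1) ^ 2) * dual a N (1/2 + t * I) ^ 2 := (cW.mul cΨ).mul (cdu.pow 2)
  have i1 : Continuous fun t : ℝ => ‖dsum c Q (1/2 + t * I) *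
      (afeErr a G H N (1/2 + t * I) / (1/2 + t * I - 1) ^ 2)‖ ^ 2 := ((cP.mul cE).norm).pow 2
  have i2 : Continuous fun t : ℝ => ‖dsum c Q (1/2 + t * I) * dsum a N (1/2 + t * I)‖ ^ 2 :=
    ((cP.mul cD).norm).pow 2
  have r3 := Complex.reCLM.intervalIntegral_comp_comm (μ := volume) (i3.intervalIntegrable T (2*T))
  have r4 := Complex.reCLM.intervalIntegral_comp_comm (μ := volume) (i4.intervalIntegrable T (2*T))
  simp only [Complex.reCLM_apply] at r3 r4
  have e : ∫ t in T..(2*T), ‖dsum c Q (1/2 + t * I) * (G (1/2 + t * I) / (1/2 + t * I - 1) ^ 2)‖ ^ 2 =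
      (∫ t in T..(2*T), ‖dsum c Q (1/2 + t * I) * (afeErr a G H N (1/2 + t * I) / (1/2 + t * I - 1) ^ 2)‖ ^ 2)
      + 2 * (∫ t in T..(2*T), ‖dsum c Q (1/2 + t * I) * dsum a N (1/2 + t * I)‖ ^ 2)
      + 4 * (∫ t in T..(2*T), weight c Q (1/2 + t * I) * (afeErr a G H N (1/2 + t * I) / (1/2 + t * I - 1) ^ 2) *
        dual a N (1/2 + t * I)).re
      + 2 * (∫ t in T..(2*T), weight c Q (1/2 + t * I) * (H (1/2 + t * I) / (1/2 + t * I - 1) ^ 2) *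
        dual a N (1/2 + t * I) ^ 2).re := by
    rw [← r3, ← r4, ← intervalIntegral.integral_const_mul, ← intervalIntegral.integral_const_mul,
      ← intervalIntegral.integral_const_mul, ← intervalIntegral.integral_add, ← intervalIntegral.integral_add,
      ← intervalIntegral.integral_add]
    · refine intervalIntegral.integral_congr fun t ht => ?_
      rw [Set.uIcc_of_le hTT] at ht
      exact fe.pointwise c Q N t (by linarith [ht.1])
    · exact ((i1.add (i2.const_mul 2)).add ((continuous_re.comp i3).const_mul 4)).intervalIntegrable _ _
    · exact ((continuous_re.comp i4).const_mul 2).intervalIntegrable _ _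
    · exact (i1.add (i2.const_mul 2)).intervalIntegrable _ _
    · exact ((continuous_re.comp i3).const_mul 4).intervalIntegrable _ _
    · exact i1.intervalIntegrable _ _
    · exact (i2.const_mul 2).intervalIntegrable _ _
  have h0 : 0 ≤ ∫ t in T..(2*T), ‖dsum c Q (1/2 + t * I) * (afeErr a G H N (1/2 + t * I) / (1/2 + t * I - 1) ^ 2)‖ ^ 2 :=
    intervalIntegral.integral_nonneg hTT fun t _ => by positivity
  have h4 := (abs_le.1 ((Complex.abs_re_le_norm _).trans h1))
  have h5 := (abs_le.1 ((Complex.abs_re_le_norm _).trans h2))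
  rw [e, abs_le]
  constructor <;> nlinarith

/-- The coefficients of the product of the Dirichlet polynomials `dsum c Q` and `dsum a N`. -/
noncomputable def prodCoeff (c a : ℕ → ℂ) (Q N : ℕ) (k : ℕ) : ℂ :=
  ∑ p ∈ (Icc 1 Q ×ˢ Icc 1 N) with p.1 * p.2 = k, c p.1 * a p.2

lemma maps_prod {Q N : ℕ} : ∀ p ∈ Icc 1 Q ×ˢ Icc 1 N, p.1 * p.2 ∈ Icc 1 (Q * N) := by
  intro p hp
  rw [mem_product, mem_Icc, mem_Icc] at hp
  rw [mem_Icc]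
  exact ⟨Nat.mul_pos hp.1.1 hp.2.1, Nat.mul_le_mul hp.1.2 hp.2.2⟩

lemma dsum_mul_dsum (c a : ℕ → ℂ) (Q N : ℕ) (z : ℂ) :
    dsum c Q z * dsum a N z = dsum (prodCoeff c a Q N) (Q * N) z := by
  unfold dsum
  rw [sum_mul_sum, ← sum_product', ← sum_fiberwise_of_maps_to maps_prod]
  refine sum_congr rfl fun k _ => ?_
  rw [prodCoeff, sum_mul]
  refine sum_congr rfl fun p hp => ?_
  rw [mem_filter] at hp
  rw [← hp.2, Nat.cast_mul, natCast_mul_natCast_cpow]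
  ring

lemma norm_prodCoeff_sq_le (c a : ℕ → ℂ) (Q N k : ℕ) :
    ‖prodCoeff c a Q N k‖ ^ 2 ≤ (∑ d ∈ Icc 1 Q, ‖c d‖ ^ 2) *
      ∑ p ∈ (Icc 1 Q ×ˢ Icc 1 N) with p.1 * p.2 = k, ‖a p.2‖ ^ 2 := by
  have h1 : ‖prodCoeff c a Q N k‖ ≤ ∑ p ∈ (Icc 1 Q ×ˢ Icc 1 N) with p.1 * p.2 = k, ‖c p.1‖ * ‖a p.2‖ :=
    (norm_sum_le _ _).trans (le_of_eq (sum_congr rfl fun p _ => norm_mul _ _))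
  refine (pow_le_pow_left₀ (norm_nonneg _) h1 2).trans ((sum_mul_sq_le_sq_mul_sq _ _ _).trans ?_)
  gcongr
  have inj : Set.InjOn (fun p : ℕ × ℕ => p.1) ((Icc 1 Q ×ˢ Icc 1 N).filter (fun p => p.1 * p.2 = k) : Set (ℕ × ℕ)) := by
    intro p hp r hr h
    simp only [coe_filter, mem_product, mem_Icc, Set.mem_ofPred_eq] at hp hr h
    have : p.1 * p.2 = p.1 * r.2 := by rw [hp.2, ← hr.2, h]
    exact Prod.ext h (Nat.eq_of_mul_eq_mul_left hp.1.1.1 this)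
  rw [← sum_image (f := fun d => ‖c d‖ ^ 2) inj]
  refine sum_le_sum_of_subset_of_nonneg ?_ fun _ _ _ => by positivity
  intro d hd
  rw [mem_image] at hd
  obtain ⟨p, hp, rfl⟩ := hd
  exact (mem_product.1 (mem_filter.1 hp).1).1

lemma sum_norm_prodCoeff_sq_le (c a : ℕ → ℂ) (Q N : ℕ) :
    ∑ k ∈ Icc 1 (Q * N), ‖prodCoeff c a Q N k‖ ^ 2 ≤
      (∑ d ∈ Icc 1 Q, ‖c d‖ ^ 2) * (Q * ∑ n ∈ Icc 1 N, ‖a n‖ ^ 2) := by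
  calc _ ≤ ∑ k ∈ Icc 1 (Q * N), (∑ d ∈ Icc 1 Q, ‖c d‖ ^ 2) *
        ∑ p ∈ (Icc 1 Q ×ˢ Icc 1 N) with p.1 * p.2 = k, ‖a p.2‖ ^ 2 :=
        sum_le_sum fun k _ => norm_prodCoeff_sq_le c a Q N k
    _ = (∑ d ∈ Icc 1 Q, ‖c d‖ ^ 2) * ∑ p ∈ Icc 1 Q ×ˢ Icc 1 N, ‖a p.2‖ ^ 2 := by
        rw [← mul_sum, sum_fiberwise_of_maps_to maps_prod]
    _ = _ := by
        rw [sum_product]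
        simp

lemma sum_norm_prodCoeff_le (c a : ℕ → ℂ) (Q N : ℕ) :
    ∑ k ∈ Icc 1 (Q * N), ‖prodCoeff c a Q N k‖ / √k ≤
      (∑ d ∈ Icc 1 Q, ‖c d‖ / √d) * (∑ n ∈ Icc 1 N, ‖a n‖ / √n) := by
  rw [sum_mul_sum, ← sum_product', ← sum_fiberwise_of_maps_to maps_prod]
  refine sum_le_sum fun k _ => ?_
  rw [prodCoeff]
  calc _ ≤ (∑ p ∈ (Icc 1 Q ×ˢ Icc 1 N) with p.1 * p.2 = k, ‖c p.1 * a p.2‖) / √k := by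
        gcongr; exact norm_sum_le _ _
    _ = _ := by
        rw [sum_div]
        refine sum_congr rfl fun p hp => ?_
        rw [← (mem_filter.1 hp).2, norm_mul, Nat.cast_mul, Real.sqrt_mul (Nat.cast_nonneg _)]
        rw [mul_div_mul_comm]

lemma prodCoeff_eq {c a b : ℕ → ℂ} {Q N k : ℕ} (hc : ∀ d, Q < d → c d = 0)
    (hb : b k = ∑ p ∈ k.divisorsAntidiagonal, c p.1 * a p.2) (h1 : 1 ≤ k) (h2 : k ≤ N) :
    prodCoeff c a Q N k = b k := by
  rw [hb, prodCoeff]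
  refine sum_subset ?_ ?_
  · intro p hp
    rw [Nat.mem_divisorsAntidiagonal]
    exact ⟨(mem_filter.1 hp).2, by omega⟩
  · intro p hp hn
    rw [Nat.mem_divisorsAntidiagonal] at hp
    rw [hc, zero_mul]
    by_contra! hlt
    refine hn ?_
    have hp1 : 0 < p.1 := Nat.pos_of_ne_zero fun h => by rw [h, zero_mul] at hp; omega
    have hp2 : 0 < p.2 := Nat.pos_of_ne_zero fun h => by rw [h, mul_zero] at hp; omega
    rw [mem_filter, mem_product, mem_Icc, mem_Icc]
    refine ⟨⟨⟨hp1, hlt⟩, hp2, ?_⟩, hp.1⟩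
    calc p.2 ≤ p.1 * p.2 := Nat.le_mul_of_pos_left _ hp1
      _ ≤ N := by omega

lemma product_mean_square {a b c : ℕ → ℂ} {Q : ℕ} {A : ℝ} (h : LogBound (fun n => ‖a n‖ ^ 2) A)
    (hQ : 1 ≤ Q) (hc : ∀ d, Q < d → c d = 0)
    (hb : ∀ k, b k = ∑ p ∈ k.divisorsAntidiagonal, c p.1 * a p.2) :
    ∃ K : ℝ, ∀ (T : ℝ) (N : ℕ), 2 ≤ N → (N:ℝ) ≤ T → T ≤ N + 1 →
      |(∫ t in T..(2*T), ‖dsum c Q (1/2 + t * I) * dsum a N (1/2 + t * I)‖ ^ 2)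
        - T * ∑ k ∈ Icc 1 N, ‖b k‖ ^ 2 / k| ≤ K * T * Real.log T := by
  set C2 := ∑ d ∈ Icc 1 Q, ‖c d‖ ^ 2 with hC2
  set C1 := ∑ d ∈ Icc 1 Q, ‖c d‖ / √d with hC1
  have hC2' : 0 ≤ C2 := sum_nonneg fun _ _ => by positivity
  have hC1' : 0 ≤ C1 := sum_nonneg fun _ _ => by positivity
  have hA := h.nonneg fun n => by positivity
  refine ⟨2 * (π * (C2 * (Q * A)) + C1 ^ 2 * (8 * A)) + 2 * (C2 * (Q * A)), fun T N hN hNT hTN => ?_⟩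
  have hN' : (2:ℝ) ≤ N := by exact_mod_cast hN
  have hT0 : 0 < T := by linarith
  have hL1 : 0 ≤ Real.log N := Real.log_natCast_nonneg N
  have hL2 : Real.log N ≤ Real.log T := Real.log_le_log (by linarith) hNT
  set B := prodCoeff c a Q N with hB
  have mv := mean_value_rpow (Icc 1 (Q * N)) (fun n hn => (mem_Icc.1 hn).1) B (1/2) T (2 * T)
  have s1 : ∑ k ∈ Icc 1 (Q * N), ‖B k‖ ^ 2 ≤ C2 * (Q * A) * N * Real.log N := by
    refine (sum_norm_prodCoeff_sq_le c a Q N).trans ?_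
    calc _ ≤ C2 * (Q * (A * N * Real.log N)) := by
          gcongr
          exact h N hN
      _ = _ := by ring
  have s2 : (∑ k ∈ Icc 1 (Q * N), ‖B k‖ / √k) ^ 2 ≤ C1 ^ 2 * (8 * A * N * Real.log N) := by
    have := sum_norm_prodCoeff_le c a Q N
    refine (pow_le_pow_left₀ (sum_nonneg fun _ _ => by positivity) this 2).trans ?_
    rw [mul_pow]
    gcongr
    exact sum_norm_div_sqrt_le h hN
  have e1 : ∀ k ∈ Icc 1 (Q * N), (k:ℝ) * (‖B k‖ ^ 2 * (k:ℝ) ^ (-(2 * (1/2:ℝ)))) = ‖B k‖ ^ 2 := by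
    intro k hk
    have : (0:ℝ) < k := by exact_mod_cast (mem_Icc.1 hk).1
    rw [show -(2 * (1/2:ℝ)) = -1 by norm_num, Real.rpow_neg_one]
    field_simp
  have e2 : ∀ k ∈ Icc 1 (Q * N), ‖B k‖ * (k:ℝ) ^ (-(1/2:ℝ)) = ‖B k‖ / √k := by
    intro k hk
    rw [Real.rpow_neg (Nat.cast_nonneg _), Real.sqrt_eq_rpow]
    rfl
  have e3 : ∀ k ∈ Icc 1 (Q * N), ‖B k‖ ^ 2 * (k:ℝ) ^ (-(2 * (1/2:ℝ))) = ‖B k‖ ^ 2 / k := by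
    intro k hk
    rw [show -(2 * (1/2:ℝ)) = -1 by norm_num, Real.rpow_neg_one]
    rfl
  rw [sum_congr rfl e1, sum_congr rfl e2, sum_congr rfl e3] at mv
  have e4 : ∀ t : ℝ, ∑ n ∈ Icc 1 (Q * N), B n * (n:ℂ) ^ (-(((1/2:ℝ):ℂ) + t * I)) =
      dsum c Q (1/2 + t * I) * dsum a N (1/2 + t * I) := by
    intro t
    rw [dsum_mul_dsum]
    unfold dsum
    push_cast
    rfl
  simp only [e4] at mv
  have e5 : ∑ k ∈ Icc 1 (Q * N), ‖B k‖ ^ 2 / k = ∑ k ∈ Icc 1 N, ‖b k‖ ^ 2 / k +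
      ∑ k ∈ Ioc N (Q * N), ‖B k‖ ^ 2 / k := by
    have hle : N ≤ Q * N := Nat.le_mul_of_pos_left _ hQ
    have u : Icc 1 (Q * N) = Icc 1 N ∪ Ioc N (Q * N) := by
      ext x; simp only [mem_Icc, mem_union, mem_Ioc]; omega
    rw [u, sum_union]
    · congr 1
      refine sum_congr rfl fun k hk => ?_
      rw [mem_Icc] at hk
      rw [hB, prodCoeff_eq hc (hb k) hk.1 hk.2]
    · rw [disjoint_left]
      intro x; simp only [mem_Icc, mem_Ioc]; omega
  have s3 : ∑ k ∈ Ioc N (Q * N), ‖B k‖ ^ 2 / k ≤ C2 * (Q * A) * Real.log N := by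
    calc _ ≤ ∑ k ∈ Ioc N (Q * N), ‖B k‖ ^ 2 / N := by
          refine sum_le_sum fun k hk => ?_
          have : N ≤ k := (mem_Ioc.1 hk).1.le
          gcongr
      _ = (∑ k ∈ Ioc N (Q * N), ‖B k‖ ^ 2) / N := by rw [sum_div]
      _ ≤ (C2 * (Q * A) * N * Real.log N) / N := by
          gcongr
          refine (sum_le_sum_of_subset_of_nonneg ?_ fun _ _ _ => by positivity).trans s1
          intro x; simp only [mem_Icc, mem_Ioc]; omega
      _ = _ := by field_simp
  have s4 : 0 ≤ ∑ k ∈ Ioc N (Q * N), ‖B k‖ ^ 2 / k := sum_nonneg fun _ _ => by positivity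
  have hNL : (N:ℝ) * Real.log N ≤ T * Real.log T := by gcongr
  have hTL : T * Real.log N ≤ T * Real.log T := by gcongr
  have hTs : T * ∑ k ∈ Ioc N (Q * N), ‖B k‖ ^ 2 / k ≤ C2 * (Q * A) * (T * Real.log T) := by
    calc _ ≤ T * (C2 * (Q * A) * Real.log N) := by gcongr
      _ = C2 * (Q * A) * (T * Real.log N) := by ring
      _ ≤ _ := by gcongr
  have hTs0 : 0 ≤ T * ∑ k ∈ Ioc N (Q * N), ‖B k‖ ^ 2 / k := mul_nonneg hT0.le s4
  have s1' : π * ∑ k ∈ Icc 1 (Q * N), ‖B k‖ ^ 2 ≤ π * (C2 * (Q * A)) * (T * Real.log T) := by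
    calc _ ≤ π * (C2 * (Q * A) * N * Real.log N) := by gcongr
      _ = π * (C2 * (Q * A)) * (N * Real.log N) := by ring
      _ ≤ _ := by gcongr
  have s2' : (∑ k ∈ Icc 1 (Q * N), ‖B k‖ / √k) ^ 2 ≤ C1 ^ 2 * (8 * A) * (T * Real.log T) := by
    refine s2.trans ?_
    calc _ = C1 ^ 2 * (8 * A) * (N * Real.log N) := by ring
      _ ≤ _ := by gcongr
  rw [e5, show 2 * T - T = T by ring, mul_add] at mv
  rw [abs_le] at mv ⊢
  have hpos : 0 ≤ C2 * (Q * A) * (T * Real.log T) := hTs0.trans hTs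
  constructor <;> nlinarith [mv.1, mv.2]

/-- The mean square of `dsum c Q * G / (s-1)^2` on the critical line. -/
theorem FE.mean_square (fe : FE a S G H A) {b c : ℕ → ℂ} {Q : ℕ} (hQ : 1 ≤ Q) (hc : ∀ d, Q < d → c d = 0)
    (hb : ∀ k, b k = ∑ p ∈ k.divisorsAntidiagonal, c p.1 * a p.2) :
    ∃ K : ℝ, ∀ (T : ℝ) (N : ℕ), 2 ≤ N → (N:ℝ) ≤ T → T ≤ N + 1 →
      |(∫ t in T..(2*T), ‖dsum c Q (1/2 + t * I) * (G (1/2 + t * I) / (1/2 + t * I - 1) ^ 2)‖ ^ 2)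
        - 2 * T * ∑ k ∈ Icc 1 N, ‖b k‖ ^ 2 / k| ≤ K * T * Real.log T := by
  obtain ⟨K1, h1⟩ := fe.sq_main c Q
  obtain ⟨K2, h2⟩ := product_mean_square fe.bound hQ hc hb
  refine ⟨K1 + 2 * K2, fun T N hN hNT hTN => ?_⟩
  have h1 := abs_le.1 (h1 T N hN hNT hTN)
  have h2 := abs_le.1 (h2 T N hN hNT hTN)
  rw [abs_le]
  constructor <;> linarith [h1.1, h1.2, h2.1, h2.2]

end Core

lemma mellin_bounded_of_convergent {f : ℝ → ℂ} {x y : ℝ} (hx : MellinConvergent f x) (hy : MellinConvergent f y) :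
    ∃ B, ∀ s : ℂ, x ≤ s.re → s.re ≤ y → ‖mellin f s‖ ≤ B := by
  refine ⟨∫ t in Set.Ioi (0:ℝ), (‖(t:ℂ) ^ ((x:ℂ) - 1) • f t‖ + ‖(t:ℂ) ^ ((y:ℂ) - 1) • f t‖), fun s h1 h2 => ?_⟩
  refine norm_integral_le_of_norm_le (hx.norm.add hy.norm) ?_
  refine (ae_restrict_iff' measurableSet_Ioi).2 (ae_of_all _ fun t ht => ?_)
  have ht0 : (0:ℝ) < t := ht
  simp only [norm_smul, Complex.norm_cpow_eq_rpow_re_of_pos ht0, sub_re, ofReal_re, one_re,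
    ← add_mul]
  refine mul_le_mul_of_nonneg_right ?_ (norm_nonneg _)
  rcases le_total 1 t with h | h
  · have := Real.rpow_le_rpow_of_exponent_le h (show s.re - 1 ≤ y - 1 by linarith)
    have := Real.rpow_nonneg ht0.le (x - 1)
    linarith
  · have := Real.rpow_le_rpow_of_exponent_ge ht0 h (show x - 1 ≤ s.re - 1 by linarith)
    have := Real.rpow_nonneg ht0.le (y - 1)
    linarith

lemma weakFEPair_bounded (P : WeakFEPair ℂ) (x y : ℝ) :
    ∃ B, ∀ s : ℂ, x ≤ s.re → s.re ≤ y → ‖P.Λ₀ s‖ ≤ B :=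
  mellin_bounded_of_convergent (P.isStrongFEPair_toStrongFEPair.hasMellin x).1
    (P.isStrongFEPair_toStrongFEPair.hasMellin y).1

lemma weakFEPair_bounded_of_strong {P : WeakFEPair ℂ} (hP : IsStrongFEPair P) (x y : ℝ) :
    ∃ B, ∀ s : ℂ, x ≤ s.re → s.re ≤ y → ‖P.Λ s‖ ≤ B := by
  obtain ⟨B, hB⟩ := weakFEPair_bounded P x y
  refine ⟨B, fun s h1 h2 => ?_⟩
  have := hB s h1 h2
  rwa [P.Λ₀_eq, hP.hf₀, hP.hg₀, smul_zero, smul_zero, add_zero, add_zero] at this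

lemma completedHurwitzZetaEven₀_bounded (a : UnitAddCircle) :
    ∃ B, ∀ s : ℂ, -1/2 ≤ s.re → s.re ≤ 3/2 → ‖completedHurwitzZetaEven₀ a s‖ ≤ B := by
  obtain ⟨B, hB⟩ := weakFEPair_bounded (hurwitzEvenFEPair a) (-1/4) (3/4)
  refine ⟨B / 2, fun s h1 h2 => ?_⟩
  rw [completedHurwitzZetaEven₀, norm_div, RCLike.norm_ofNat]
  have h3 : (s / 2).re = s.re / 2 := by simp
  have := hB (s / 2) (by rw [h3]; linarith) (by rw [h3]; linarith)
  linarith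

lemma completedHurwitzZetaOdd_bounded (a : UnitAddCircle) :
    ∃ B, ∀ s : ℂ, -1/2 ≤ s.re → s.re ≤ 3/2 → ‖completedHurwitzZetaOdd a s‖ ≤ B := by
  obtain ⟨B, hB⟩ := weakFEPair_bounded_of_strong (isStrong_hurwitzOddFEPair a) (1/4) (5/4)
  refine ⟨B / 2, fun s h1 h2 => ?_⟩
  rw [completedHurwitzZetaOdd, norm_div, RCLike.norm_ofNat]
  have h3 : ((s + 1) / 2).re = (s.re + 1) / 2 := by simp
  have := hB ((s + 1) / 2) (by rw [h3]; linarith) (by rw [h3]; linarith)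
  linarith

lemma natCast_cpow_neg_bounded {N : ℕ} (hN : 0 < N) {z : ℂ} (hz : -1/2 ≤ z.re) :
    ‖(N:ℂ) ^ (-z)‖ ≤ (N:ℝ) ^ (1/2:ℝ) := by
  rw [norm_natCast_cpow hN]
  exact Real.rpow_le_rpow_of_exponent_le (by exact_mod_cast hN) (by rw [neg_re]; linarith)

lemma ExpGrowth.sum {ι : Type*} {s : Finset ι} {f : ι → ℂ → ℂ} (h : ∀ i ∈ s, ExpGrowth (f i)) :
    ExpGrowth (fun z => ∑ i ∈ s, f i z) := by
  induction s using Finset.induction_on with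
  | empty => simpa using ExpGrowth.const 0
  | insert a s ha ih =>
    simp only [sum_insert ha]
    exact (h a (mem_insert_self _ _)).add (ih fun i hi => h i (mem_insert_of_mem hi))

lemma ExpGrowth.natCast_cpow_neg {N : ℕ} (hN : 0 < N) : ExpGrowth (fun z => (N:ℂ) ^ (-z)) :=
  .of_bounded fun _ h _ => natCast_cpow_neg_bounded hN h

lemma expGrowth_completedLFunction₀ {N : ℕ} [NeZero N] (Φ : ZMod N → ℂ) :
    ExpGrowth (ZMod.completedLFunction₀ Φ) := by
  have h0 := ExpGrowth.natCast_cpow_neg (NeZero.pos N)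
  refine (h0.mul (.sum fun i _ => (ExpGrowth.const _).mul ?_)).add
    (h0.mul (.sum fun i _ => (ExpGrowth.const _).mul ?_))
  · obtain ⟨B, hB⟩ := completedHurwitzZetaEven₀_bounded (ZMod.toAddCircle i)
    exact .of_bounded hB
  · obtain ⟨B, hB⟩ := completedHurwitzZetaOdd_bounded (ZMod.toAddCircle i)
    exact .of_bounded hB

lemma norm_Gamma_le {x y : ℝ} (hx : 0 < x) (hxy : x ≤ y) :
    ∃ B, ∀ s : ℂ, x ≤ s.re → s.re ≤ y → ‖Gamma s‖ ≤ B := by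
  have hc : ∀ z : ℝ, 0 < z → MellinConvergent (fun t : ℝ => ((Real.exp (-t) : ℝ) : ℂ)) z := fun z hz => by
    have := Complex.GammaIntegral_convergent (s := z) (by simpa using hz)
    refine this.congr_fun (fun t _ => ?_) measurableSet_Ioi
    simp [mul_comm]
  obtain ⟨B, hB⟩ := mellin_bounded_of_convergent (hc x hx) (hc y (hx.trans_le hxy))
  refine ⟨B, fun s h1 h2 => ?_⟩
  have := hB s h1 h2
  rwa [← Complex.GammaIntegral_eq_mellin, ← Complex.Gamma_eq_integral (hx.trans_le h1)] at this

lemma norm_sin_le (z : ℂ) : ‖Complex.sin z‖ ≤ Real.exp |z.im| := by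
  have h1 : ‖cexp (-z * I)‖ ≤ Real.exp |z.im| := by
    rw [Complex.norm_exp]; simpa using le_abs_self z.im
  have h2 : ‖cexp (z * I)‖ ≤ Real.exp |z.im| := by
    rw [Complex.norm_exp]; simpa using neg_le_abs z.im
  rw [Complex.sin, norm_div, norm_mul, norm_I, mul_one, RCLike.norm_ofNat]
  have := norm_sub_le (cexp (-z * I)) (cexp (z * I))
  linarith

lemma norm_inv_Gamma_le : ∃ B, 0 ≤ B ∧ ∀ u : ℂ, -1 ≤ u.re → u.re ≤ 2 →
    ‖(Gamma u)⁻¹‖ ≤ B * Real.exp (π * |u.im|) := by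
  obtain ⟨B, hB⟩ := norm_Gamma_le (x := 1) (y := 4) one_pos (by norm_num)
  have hK : IsCompact (Set.Icc (-1:ℝ) 2 ×ℂ Set.Icc (-1:ℝ) 1) := isCompact_Icc.reProdIm isCompact_Icc
  obtain ⟨C, hC⟩ := hK.exists_bound_of_continuousOn
    (Complex.differentiable_one_div_Gamma.continuous.continuousOn)
  have hB0 : 0 ≤ B := (norm_nonneg _).trans (hB 1 (by simp) (by simp))
  refine ⟨max B C, le_max_of_le_left hB0, fun u h1 h2 => ?_⟩
  have he : 1 ≤ Real.exp (π * |u.im|) := Real.one_le_exp (by positivity)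
  rcases le_total |u.im| 1 with h | h
  · have := hC u ⟨⟨h1, h2⟩, abs_le.1 h⟩
    calc _ ≤ C := this
      _ ≤ max B C * 1 := by rw [mul_one]; exact le_max_right _ _
      _ ≤ _ := by gcongr
  · have hu : u.im ≠ 0 := fun h0 => by rw [h0, abs_zero] at h; linarith
    have hs : Complex.sin (π * u) ≠ 0 := by
      intro h0
      obtain ⟨k, hk⟩ := Complex.sin_eq_zero_iff.1 h0
      have := congrArg Complex.im hk
      simp [Real.pi_ne_zero] at this
      exact hu this
    have hG : (Gamma u)⁻¹ = Gamma (1 - u) * Complex.sin (π * u) / π := by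
      have h3 := Complex.Gamma_mul_Gamma_one_sub u
      have h4 : Gamma u ≠ 0 := by
        intro h0
        rw [h0, zero_mul, eq_comm, div_eq_zero_iff] at h3
        simp [hs, Real.pi_ne_zero] at h3
      have hpi : (π:ℂ) ≠ 0 := by exact_mod_cast Real.pi_ne_zero
      rw [eq_div_iff hs] at h3
      rw [eq_div_iff hpi, inv_mul_eq_iff_eq_mul₀ h4, ← mul_assoc, h3]
    have h5 : ∀ r : ℝ, 1 ≤ ‖(r:ℂ) - u‖ := fun r => by
      refine h.trans ?_
      have := Complex.abs_im_le_norm ((r:ℂ) - u)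
      simpa using this
    have hne : ∀ r : ℝ, (r:ℂ) - u ≠ 0 := fun r h0 => by
      have := h5 r; rw [h0, norm_zero] at this; linarith
    have h6 : Gamma (3 - u) = (2 - u) * ((1 - u) * Gamma (1 - u)) := by
      have e1 := Complex.Gamma_add_one (1 - u) (by simpa using hne 1)
      have e2 := Complex.Gamma_add_one (2 - u) (by simpa using hne 2)
      rw [show (2:ℂ) - u + 1 = 3 - u by ring] at e2
      rw [show (1:ℂ) - u + 1 = 2 - u by ring] at e1
      rw [e2, e1]
    have h7 : ‖Gamma (1 - u)‖ ≤ B := by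
      have h8 := hB (3 - u) (by simp; linarith) (by simp; linarith)
      rw [h6, norm_mul, norm_mul] at h8
      have a1 := h5 1
      have a2 := h5 2
      push_cast at a1 a2
      refine le_trans ?_ h8
      rw [← mul_assoc]
      refine le_mul_of_one_le_left (norm_nonneg _) ?_
      nlinarith
    rw [hG, norm_div, norm_mul, Complex.norm_real, Real.norm_eq_abs, abs_of_pos Real.pi_pos]
    have h9 : ‖Complex.sin (π * u)‖ ≤ Real.exp (π * |u.im|) := by
      refine (norm_sin_le _).trans (le_of_eq ?_)
      simp [abs_mul, abs_of_pos Real.pi_pos]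
    calc ‖Gamma (1 - u)‖ * ‖Complex.sin (π * u)‖ / π ≤ B * Real.exp (π * |u.im|) / 1 := by
          gcongr
          linarith [Real.pi_gt_three]
      _ ≤ _ := by rw [div_one]; gcongr; exact le_max_left _ _

lemma expGrowth_inv_Gamma {a : ℝ} (h0 : 0 ≤ a) (h1 : a ≤ 1) : ExpGrowth (fun z => (Gamma (z / 2 + a))⁻¹) := by
  obtain ⟨B, hB, h⟩ := norm_inv_Gamma_le
  refine .of_le (B := B) (C := π / 2) hB (by positivity) fun z hz1 hz2 => ?_
  have hre : (z / 2 + a).re = z.re / 2 + a := by simp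
  have him : (z / 2 + a).im = z.im / 2 := by simp
  refine (h _ (by rw [hre]; linarith) (by rw [hre]; linarith)).trans (le_of_eq ?_)
  rw [him, abs_div, abs_two]
  congr 2
  ring

lemma expGrowth_rpow {x : ℝ} (hx : 0 < x) (c d : ℝ) : ExpGrowth (fun z => (x:ℂ) ^ (c * z + d)) := by
  refine .of_bounded (B := Real.exp (|Real.log x| * (2 * |c| + |d|))) fun z h1 h2 => ?_
  rw [Complex.norm_cpow_eq_rpow_re_of_pos hx, Real.rpow_def_of_pos hx]
  refine Real.exp_le_exp.2 ((le_abs_self _).trans ?_)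
  rw [abs_mul]
  gcongr
  have : ((c:ℂ) * z + d).re = c * z.re + d := by simp
  rw [this]
  refine (abs_add_le _ _).trans ?_
  rw [abs_mul]
  have : |z.re| ≤ 2 := abs_le.2 ⟨by linarith, by linarith⟩
  nlinarith [abs_nonneg c]

section Entire

open DirichletCharacter

variable {N : ℕ} (χ : DirichletCharacter ℂ N)

lemma gammaFactor_mul (z : ℂ) (hz : z ≠ 0) (h : gammaFactor χ z ≠ 0) :
    χ 0 * ((π:ℂ) ^ (z / 2) * (2 * Gamma (z / 2 + 1))⁻¹) = χ 0 / z * (gammaFactor χ z)⁻¹ := by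
  rcases χ.even_or_odd with hχ | hχ
  · rw [hχ.gammaFactor_def] at h ⊢
    rw [Gammaℝ_def] at h ⊢
    have hpi : (π:ℂ) ≠ 0 := by exact_mod_cast Real.pi_ne_zero
    rw [Gamma_add_one _ (div_ne_zero hz two_ne_zero), neg_div, cpow_neg]
    have := (mul_ne_zero_iff.1 h).2
    field_simp
  · have : χ 0 = 0 := by
      have := hχ.to_fun 0
      rw [neg_zero] at this
      exact self_eq_neg.1 this
    simp [this]

lemma gammaFactor_ne_zero {z : ℂ} (h : 0 < z.re) : gammaFactor χ z ≠ 0 := by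
  rcases χ.even_or_odd with hχ | hχ
  · rw [hχ.gammaFactor_def]
    exact Gammaℝ_ne_zero_of_re_pos h
  · rw [hχ.gammaFactor_def]
    exact Gammaℝ_ne_zero_of_re_pos (by simp; linarith)

lemma gammaFactor_ne_zero_left {z : ℂ} (h1 : -2 < z.re) (h2 : z.re < 0) (h3 : z.re ≠ -1) :
    gammaFactor χ z ≠ 0 := by
  rcases χ.even_or_odd with hχ | hχ
  · rw [hχ.gammaFactor_def, Ne, Gammaℝ_eq_zero_iff]
    rintro ⟨n, rfl⟩
    simp at h1 h2
    rcases n with _ | n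
    · simp at h2
    · push_cast at h1
  · rw [hχ.gammaFactor_def, Ne, Gammaℝ_eq_zero_iff]
    rintro ⟨n, hn⟩
    have := congrArg re hn
    simp at this
    rcases n with _ | n
    · simp at this; exact h3 (by linarith)
    · push_cast at this; linarith

lemma differentiable_inv_gammaFactor : Differentiable ℂ (fun z => (gammaFactor χ z)⁻¹) := by
  rcases χ.even_or_odd with hχ | hχ
  · simp only [hχ.gammaFactor_def]
    exact differentiable_Gammaℝ_inv
  · simp only [hχ.gammaFactor_def]
    exact differentiable_Gammaℝ_inv.comp (differentiable_id.add_const 1)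

lemma expGrowth_inv_Gammaℝ {a : ℝ} (h0 : 0 ≤ a) (h1 : a ≤ 1) : ExpGrowth (fun z => (Gammaℝ (z + a))⁻¹) := by
  have h2 := (expGrowth_rpow Real.pi_pos (1/2) (a/2)).mul
    (expGrowth_inv_Gamma (a := a / 2) (by linarith) (by linarith))
  convert h2 using 2 with z
  rw [Gammaℝ_def, mul_inv, ← cpow_neg]
  congr 2
  · push_cast; ring
  · push_cast; ring_nf

lemma expGrowth_inv_gammaFactor : ExpGrowth (fun z => (gammaFactor χ z)⁻¹) := by
  rcases χ.even_or_odd with hχ | hχ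
  · simp only [hχ.gammaFactor_def]
    simpa using expGrowth_inv_Gammaℝ (a := 0) le_rfl (by norm_num)
  · simp only [hχ.gammaFactor_def]
    simpa using expGrowth_inv_Gammaℝ (a := 1) (by norm_num) le_rfl

lemma inv_apply_conj (n : ZMod N) : χ⁻¹ n = (starRingEnd ℂ) (χ n) :=
  (MulChar.star_apply' χ n).symm

lemma expGrowth_sub_one : ExpGrowth (fun z => z - 1) := by
  simpa [sub_eq_add_neg] using ExpGrowth.id.add (.const (-1))

lemma conj_Gammaℝ (z : ℂ) : (starRingEnd ℂ) (Gammaℝ z) = Gammaℝ ((starRingEnd ℂ) z) := by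
  have h : (starRingEnd ℂ) ((π:ℂ) ^ (-z / 2)) = (π:ℂ) ^ (-(starRingEnd ℂ) z / 2) := by
    rw [show -(starRingEnd ℂ) z / 2 = (starRingEnd ℂ) (-z / 2) by rw [map_div₀, map_neg, conj_ofNat], cpow_conj, conj_ofReal]
    rw [arg_ofReal_of_nonneg Real.pi_pos.le]
    exact Real.pi_pos.ne
  rw [Gammaℝ_def, Gammaℝ_def, map_mul, h, ← Gamma_conj, map_div₀, conj_ofNat]

variable [NeZero N]

/-- The entire function `(z - 1) L(z, χ)`. -/
noncomputable def entireL (z : ℂ) : ℂ :=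
  ((z - 1) * ZMod.completedLFunction₀ χ z + (N:ℂ) ^ (-z) * ∑ j, χ j) * (gammaFactor χ z)⁻¹
    - (z - 1) * ((N:ℂ) ^ (-z) * χ 0) * ((π:ℂ) ^ (z / 2) * (2 * Gamma (z / 2 + 1))⁻¹)

lemma entireL_eq {z : ℂ} (h0 : z ≠ 0) (h1 : z ≠ 1) (h : gammaFactor χ z ≠ 0) :
    entireL χ z = (z - 1) * LFunction χ z := by
  have h2 : (1:ℂ) - z ≠ 0 := sub_ne_zero.2 h1.symm
  rw [LFunction_eq_completed_div_gammaFactor χ z (.inl h0), completedLFunction, ZMod.completedLFunction_eq,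
    entireL, mul_assoc (z - 1), mul_assoc ((N:ℂ) ^ (-z)), gammaFactor_mul χ z h0 h]
  field_simp
  ring

lemma differentiable_entireL : Differentiable ℂ (entireL χ) := by
  have hN : (N:ℂ) ≠ 0 := NeZero.ne _
  have hpi : (π:ℂ) ≠ 0 := by exact_mod_cast Real.pi_ne_zero
  have h1 := ZMod.differentiable_completedLFunction₀ χ
  have h2 := differentiable_inv_gammaFactor χ
  have h3 : Differentiable ℂ (fun z : ℂ => (2 * Gamma (z / 2 + 1))⁻¹) := by
    simp only [mul_inv]
    exact (differentiable_one_div_Gamma.comp ((differentiable_id.div_const 2).add_const 1)).const_mul _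
  have h4 : Differentiable ℂ (fun z : ℂ => (N:ℂ) ^ (-z)) := fun z => by
    exact (differentiableAt_id.neg).const_cpow (.inl hN)
  have h5 : Differentiable ℂ (fun z : ℂ => (π:ℂ) ^ (z / 2)) := fun z => by
    exact (differentiableAt_id.div_const 2).const_cpow (.inl hpi)
  unfold entireL
  fun_prop

lemma expGrowth_entireL : ExpGrowth (entireL χ) := by
  have h0 := ExpGrowth.natCast_cpow_neg (NeZero.pos N)
  have h1 := expGrowth_completedLFunction₀ (χ : ZMod N → ℂ)
  have h2 := expGrowth_inv_gammaFactor χ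
  have h3 : ExpGrowth (fun z : ℂ => (2 * Gamma (z / 2 + 1))⁻¹) := by
    simp only [mul_inv]
    simpa using (ExpGrowth.const (2⁻¹)).mul (expGrowth_inv_Gamma (a := 1) (by norm_num) le_rfl)
  have h4 : ExpGrowth (fun z : ℂ => (π:ℂ) ^ (z / 2)) := by
    convert expGrowth_rpow Real.pi_pos (1/2) 0 using 3
    push_cast; ring
  have h5 := ((((expGrowth_sub_one.mul h1).add (h0.mul (.const (∑ j, χ j)))).mul h2).add
    ((expGrowth_sub_one.mul (h0.mul (.const (χ 0)))).mul (h4.mul h3)).neg)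
  exact h5

lemma LFunction_conj_of_one_lt {z : ℂ} (hz : 1 < z.re) :
    LFunction χ⁻¹ ((starRingEnd ℂ) z) = (starRingEnd ℂ) (LFunction χ z) := by
  rw [LFunction_eq_LSeries χ hz, LFunction_eq_LSeries χ⁻¹ (by simpa using hz), LSeries, LSeries, conj_tsum]
  refine tsum_congr fun n => ?_
  rcases eq_or_ne n 0 with rfl | hn
  · simp
  · rw [LSeries.term_of_ne_zero hn, LSeries.term_of_ne_zero hn, map_div₀, inv_apply_conj,
      conj_natCast_cpow]

lemma entireL_conj (z : ℂ) :
    entireL χ⁻¹ ((starRingEnd ℂ) z) = (starRingEnd ℂ) (entireL χ z) := by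
  have hd : Differentiable ℂ (fun z => (starRingEnd ℂ) (entireL χ⁻¹ ((starRingEnd ℂ) z))) := fun z => by
    simpa [Function.comp_def] using (differentiable_entireL χ⁻¹ ((starRingEnd ℂ) z)).conj_conj
  have h : (fun z => (starRingEnd ℂ) (entireL χ⁻¹ ((starRingEnd ℂ) z))) = entireL χ := by
    refine AnalyticOnNhd.eq_of_eventuallyEq (z₀ := 2) (hd.differentiableOn.analyticOnNhd isOpen_univ)
      ((differentiable_entireL χ).differentiableOn.analyticOnNhd isOpen_univ) ?_
    have h : {z : ℂ | 1 < z.re} ∈ 𝓝 (2:ℂ) :=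
      (isOpen_lt continuous_const continuous_re).mem_nhds (by simp)
    filter_upwards [h] with z hz
    have hz1 : 1 < z.re := hz
    have h0 : z ≠ 0 := by rintro rfl; simp at hz1; linarith
    have h1 : z ≠ 1 := by rintro rfl; simp at hz1
    rw [entireL_eq χ h0 h1 (gammaFactor_ne_zero χ (by linarith)), entireL_eq χ⁻¹
      (by simpa using h0) (by intro h; exact h1 (by simpa using congrArg (starRingEnd ℂ) h))
      (gammaFactor_ne_zero _ (by simp; linarith)), LFunction_conj_of_one_lt χ hz1]
    simp
  have := congrFun h z
  rw [← this, conj_conj]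

lemma LFunction_conj {z : ℂ} (h0 : z ≠ 0) (h1 : z ≠ 1) (h : gammaFactor χ z ≠ 0)
    (h' : gammaFactor χ⁻¹ ((starRingEnd ℂ) z) ≠ 0) :
    LFunction χ⁻¹ ((starRingEnd ℂ) z) = (starRingEnd ℂ) (LFunction χ z) := by
  have h1' : (starRingEnd ℂ) z ≠ 1 := by
    intro h; exact h1 (by simpa using congrArg (starRingEnd ℂ) h)
  have h2 := entireL_conj χ z
  rw [entireL_eq χ h0 h1 h, entireL_eq χ⁻¹ (by simpa using h0) h1' h', map_mul, map_sub, map_one] at h2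
  exact mul_left_cancel₀ (sub_ne_zero.2 h1') h2

end Entire

section FunctionalEquation

open DirichletCharacter

variable {N : ℕ} (χ : DirichletCharacter ℂ N)

/-- The entire version of `(z - 1) γ(1 - z) / γ(z)`, with `γ` the gamma factor of `χ`. -/
noncomputable def gammaQuot (z : ℂ) : ℂ :=
  if χ.Even then -(2 * π) * Gammaℝ (3 - z) * (Gammaℝ z)⁻¹
  else (z - 1) * Gammaℝ (2 - z) * (Gammaℝ (z + 1))⁻¹

/-- The factor relating `(z - 1) L(z, χ)` to `L(1 - z, χ⁻¹)`. -/
noncomputable def feFactor [NeZero N] (z : ℂ) : ℂ :=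
  rootNumber χ * (N:ℂ) ^ (1 / 2 - z) * gammaQuot χ z

lemma gammaQuot_eq {z : ℂ} (hz : z ≠ 1) :
    gammaQuot χ z = (z - 1) * gammaFactor χ (1 - z) * (gammaFactor χ z)⁻¹ := by
  have hpi : (π:ℂ) ≠ 0 := by exact_mod_cast Real.pi_ne_zero
  rcases χ.even_or_odd with hχ | hχ
  · rw [gammaQuot, if_pos hχ, hχ.gammaFactor_def, hχ.gammaFactor_def, show 3 - z = 1 - z + 2 by ring,
      Gammaℝ_add_two (sub_ne_zero.2 hz.symm)]
    congr 1
    field_simp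
    ring
  · rw [gammaQuot, if_neg hχ.not_even, hχ.gammaFactor_def, hχ.gammaFactor_def,
      show 1 - z + 1 = 2 - z by ring]

lemma inv_even (h : χ.Even) : χ⁻¹.Even := by
  have h' : χ (-1) = 1 := h
  show χ⁻¹ (-1) = 1
  rw [inv_apply_conj, h', map_one]

lemma inv_odd (h : χ.Odd) : χ⁻¹.Odd := by
  have h' : χ (-1) = -1 := h
  show χ⁻¹ (-1) = -1
  rw [inv_apply_conj, h', map_neg, map_one]

lemma gammaFactor_inv (z : ℂ) : gammaFactor χ⁻¹ z = gammaFactor χ z := by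
  rcases χ.even_or_odd with hχ | hχ
  · rw [hχ.gammaFactor_def, (inv_even χ hχ).gammaFactor_def]
  · rw [hχ.gammaFactor_def, (inv_odd χ hχ).gammaFactor_def]

lemma gammaFactor_conj (z : ℂ) :
    gammaFactor χ ((starRingEnd ℂ) z) = (starRingEnd ℂ) (gammaFactor χ z) := by
  rcases χ.even_or_odd with hχ | hχ
  · rw [hχ.gammaFactor_def, hχ.gammaFactor_def, conj_Gammaℝ]
  · rw [hχ.gammaFactor_def, hχ.gammaFactor_def, conj_Gammaℝ, map_add, map_one]

lemma norm_Gammaℝ_sub_eq (x t : ℝ) : ‖Gammaℝ (x - t * I)‖ = ‖Gammaℝ (x + t * I)‖ := by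
  rw [← Complex.norm_conj (Gammaℝ (x + t * I)), conj_Gammaℝ]
  simp [sub_eq_add_neg]

lemma Gammaℝ_line_ne_zero {x : ℝ} (hx : 0 < x) (t : ℝ) : Gammaℝ (x + t * I) ≠ 0 :=
  Gammaℝ_ne_zero_of_re_pos (by simpa using hx)

lemma line_ne_zero {x : ℝ} (hx : x ≠ 0) (t : ℝ) : (x + t * I : ℂ) ≠ 0 := fun h =>
  hx (by simpa using congrArg re h)

lemma norm_line_neg (x t : ℝ) : ‖(-x + t * I : ℂ)‖ = ‖(x + t * I : ℂ)‖ := by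
  rw [← Complex.norm_conj, ← norm_neg]
  congr 1
  simp
  ring

lemma norm_line_sub (x t : ℝ) : ‖(x - t * I : ℂ)‖ = ‖(x + t * I : ℂ)‖ := by
  rw [← Complex.norm_conj]
  congr 1
  simp

lemma norm_gammaQuot_critical (t : ℝ) : ‖gammaQuot χ (1/2 + t * I)‖ = ‖(-1/2 + t * I : ℂ)‖ := by
  rw [gammaQuot_eq χ (by simp [Complex.ext_iff]),
    norm_mul, norm_mul, norm_inv, show (1:ℂ) - (1/2 + t * I) = (starRingEnd ℂ) (1/2 + t * I) by
      rw [show (1/2 + t * I : ℂ) = (((1/2:ℝ) : ℂ) + t * I) by push_cast; ring, map_add, map_mul, conj_ofReal,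
        conj_ofReal, conj_I]; push_cast; ring,
    gammaFactor_conj, Complex.norm_conj, mul_assoc, mul_inv_cancel₀, mul_one]
  · congr 1; ring
  · rw [norm_ne_zero_iff]
    exact gammaFactor_ne_zero χ (by simp)

lemma norm_gammaQuot_right (t : ℝ) : ‖gammaQuot χ (3/2 + t * I)‖ = 2 * π := by
  have hpi : ‖(π:ℂ)‖ = π := by rw [norm_real, Real.norm_of_nonneg Real.pi_pos.le]
  rw [gammaQuot]
  split_ifs
  · have h1 := norm_Gammaℝ_sub_eq (3/2) t
    have h2 := Gammaℝ_line_ne_zero (x := 3/2) (by norm_num) t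
    push_cast at h1 h2
    rw [show (3:ℂ) - (3/2 + t * I) = 3/2 - t * I by ring, norm_mul, norm_mul, norm_inv, h1, mul_assoc,
      mul_inv_cancel₀ (norm_ne_zero_iff.2 h2), mul_one, norm_neg, norm_mul, hpi, RCLike.norm_ofNat]
  · have h1 := norm_Gammaℝ_sub_eq (1/2) t
    have h2 := Gammaℝ_line_ne_zero (x := 1/2) (by norm_num) t
    have h3 := line_ne_zero (x := 1/2) (by norm_num) t
    push_cast at h1 h2 h3
    rw [show (2:ℂ) - (3/2 + t * I) = 1/2 - t * I by ring, show (3/2 + t * I + 1 : ℂ) = 1/2 + t * I + 2 by ring,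
      show (3/2 + t * I - 1 : ℂ) = 1/2 + t * I by ring, Gammaℝ_add_two h3, norm_mul, norm_mul, norm_inv, h1,
      norm_div, norm_div, norm_mul, hpi, RCLike.norm_ofNat]
    have h4 := norm_ne_zero_iff.2 h2
    have h5 := norm_ne_zero_iff.2 h3
    have h6 := Real.pi_ne_zero
    generalize ‖Gammaℝ (1/2 + t * I)‖ = g at h4 ⊢
    generalize ‖(1/2 + t * I : ℂ)‖ = l at h5 ⊢
    field_simp

lemma norm_gammaQuot_left (t : ℝ) :
    ‖gammaQuot χ (-1/2 + t * I)‖ = ‖(3/2 + t * I : ℂ)‖ * ‖(1/2 + t * I : ℂ)‖ / (2 * π) := by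
  have hpi : ‖(π:ℂ)‖ = π := by rw [norm_real, Real.norm_of_nonneg Real.pi_pos.le]
  have h6 := Real.pi_ne_zero
  rw [gammaQuot]
  split_ifs
  · have h0 := norm_Gammaℝ_sub_eq (3/2) t
    have h1 := norm_line_sub (3/2) t
    have h2 := norm_line_neg (1/2) t
    have h3 := line_ne_zero (x := -1/2) (by norm_num) t
    have h4 := line_ne_zero (x := 3/2) (by norm_num) (-t)
    have h5 := Gammaℝ_line_ne_zero (x := 3/2) (by norm_num) t
    push_cast at h0 h1 h2 h3 h4 h5
    rw [neg_mul, ← sub_eq_add_neg] at h4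
    have h7 := Gammaℝ_add_two h4
    have h8 := Gammaℝ_add_two h3
    rw [show (-1/2 + t * I + 2 : ℂ) = 3/2 + t * I by ring] at h8
    rw [show (3:ℂ) - (-1/2 + t * I) = 3/2 - t * I + 2 by ring, h7, norm_mul, norm_mul, norm_inv, norm_div,
      norm_div, norm_mul, h0, h1, h8, norm_neg, norm_mul, norm_div, norm_div, norm_mul, hpi, RCLike.norm_ofNat]
    rw [show (-1/2 + t * I : ℂ) = -(1/2) + t * I by ring, h2]
    have a1 : ‖Gammaℝ (-1/2 + t * I)‖ ≠ 0 := by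
      intro h
      rw [h8, norm_eq_zero.1 h] at h5
      simp at h5
    have a2 : ‖(1/2 + t * I : ℂ)‖ ≠ 0 := by
      rw [← h2, norm_ne_zero_iff, show (-(1/2) + t * I : ℂ) = -1/2 + t * I by ring]; exact h3
    rw [show (-1/2 + t * I : ℂ) = -(1/2) + t * I by ring] at a1
    generalize ‖Gammaℝ (-(1/2) + t * I)‖ = g at a1 ⊢
    generalize ‖(1/2 + t * I : ℂ)‖ = l at a2 ⊢
    generalize ‖(3/2 + t * I : ℂ)‖ = m
    field_simp
  · have h0 := norm_Gammaℝ_sub_eq (1/2) t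
    have h1 := norm_line_sub (1/2) t
    have h2 := norm_line_neg (3/2) t
    have h4 := line_ne_zero (x := 1/2) (by norm_num) (-t)
    have h5 := Gammaℝ_line_ne_zero (x := 1/2) (by norm_num) t
    push_cast at h0 h1 h2 h4 h5
    rw [neg_mul, ← sub_eq_add_neg] at h4
    have h7 := Gammaℝ_add_two h4
    rw [show (2:ℂ) - (-1/2 + t * I) = 1/2 - t * I + 2 by ring, h7, norm_mul, norm_mul, norm_inv, norm_div,
      norm_div, norm_mul, h0, h1, show (-1/2 + t * I - 1 : ℂ) = -(3/2) + t * I by ring, h2,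
      show (-1/2 + t * I + 1 : ℂ) = 1/2 + t * I by ring, hpi, RCLike.norm_ofNat]
    have h8 := norm_ne_zero_iff.2 h5
    generalize ‖Gammaℝ (1/2 + t * I)‖ = g at h8 ⊢
    generalize ‖(1/2 + t * I : ℂ)‖ = l
    generalize ‖(3/2 + t * I : ℂ)‖ = m
    field_simp

lemma expGrowth_Gammaℝ {a : ℝ} (ha : 2 ≤ a) : ExpGrowth (fun z => Gammaℝ (a - z)) := by
  obtain ⟨B, hB⟩ := norm_Gamma_le (x := 1/4) (y := a) (by norm_num) (by linarith)
  have h1 : ExpGrowth (fun z => Gamma ((a - z) / 2)) := .of_bounded (B := B) fun z h1 h2 => by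
    have : (((a:ℂ) - z) / 2).re = (a - z.re) / 2 := by simp
    exact hB _ (by rw [this]; linarith) (by rw [this]; linarith)
  convert (expGrowth_rpow Real.pi_pos (1/2) (-a/2)).mul h1 using 2 with z
  rw [Gammaℝ_def]
  congr 2
  push_cast; ring

lemma expGrowth_gammaQuot : ExpGrowth (gammaQuot χ) := by
  unfold gammaQuot
  split_ifs
  · have h := ((ExpGrowth.const (-(2 * π))).mul (expGrowth_Gammaℝ (a := 3) (by norm_num))).mul
      (expGrowth_inv_Gammaℝ (a := 0) le_rfl (by norm_num))
    simpa using h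
  · have h := (expGrowth_sub_one.mul (expGrowth_Gammaℝ (a := 2) le_rfl)).mul
      (expGrowth_inv_Gammaℝ (a := 1) (by norm_num) le_rfl)
    simpa using h

lemma differentiableAt_Gammaℝ {z : ℂ} (hz : 0 < z.re) : DifferentiableAt ℂ Gammaℝ z := by
  have := (differentiable_Gammaℝ_inv z).inv (inv_ne_zero (Gammaℝ_ne_zero_of_re_pos hz))
  refine this.congr_of_eventuallyEq (.of_eq ?_)
  ext s
  simp

lemma differentiableOn_gammaQuot : DifferentiableOn ℂ (gammaQuot χ) (re ⁻¹' Set.Ioo (-1) 2) := by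
  intro z hz
  have hz2 : z.re < 2 := hz.2
  refine DifferentiableAt.differentiableWithinAt ?_
  unfold gammaQuot
  split_ifs
  · have h1 : DifferentiableAt ℂ (fun z => Gammaℝ (3 - z)) z :=
      (differentiableAt_Gammaℝ (z := 3 - z) (by simp; linarith)).comp z (by fun_prop)
    have h2 := differentiable_Gammaℝ_inv z
    fun_prop
  · have h1 : DifferentiableAt ℂ (fun z => Gammaℝ (2 - z)) z :=
      (differentiableAt_Gammaℝ (z := 2 - z) (by simp; linarith)).comp z (by fun_prop)
    have h2 : DifferentiableAt ℂ (fun z => (Gammaℝ (z + 1))⁻¹) z :=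
      (differentiable_Gammaℝ_inv (z + 1)).comp z (f := fun z => z + 1) (by fun_prop)
    fun_prop

variable [NeZero N] {χ}

lemma entireL_eq_feFactor (hχ : χ.IsPrimitive) {z : ℂ} (h0 : z ≠ 0) (h1 : z.re < 1)
    (h : gammaFactor χ z ≠ 0) : entireL χ z = feFactor χ z * LFunction χ⁻¹ (1 - z) := by
  have hz1 : z ≠ 1 := by rintro rfl; simp at h1
  have hz2 : 1 - z ≠ 0 := sub_ne_zero.2 hz1.symm
  have h2 := hχ.completedLFunction_one_sub (1 - z)
  rw [sub_sub_cancel] at h2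
  have h3 : gammaFactor χ (1 - z) ≠ 0 := gammaFactor_ne_zero χ (by simpa using h1)
  rw [entireL_eq χ h0 hz1 h, feFactor, gammaQuot_eq χ hz1,
    LFunction_eq_completed_div_gammaFactor χ z (.inl h0),
    LFunction_eq_completed_div_gammaFactor χ⁻¹ (1 - z) (.inl hz2), h2, gammaFactor_inv,
    show (1:ℂ) - z - 1/2 = 1/2 - z by ring]
  field_simp

lemma completedLFunction_eq_mul (χ : DirichletCharacter ℂ N) {z : ℂ} (h0 : z ≠ 0) (h : gammaFactor χ z ≠ 0) :
    completedLFunction χ z = LFunction χ z * gammaFactor χ z := by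
  rw [LFunction_eq_completed_div_gammaFactor χ z (.inl h0), div_mul_cancel₀ _ h]

lemma norm_completedLFunction_inv (χ : DirichletCharacter ℂ N) {x : ℝ} (h0 : x ≠ 0) (h1 : x ≠ 1)
    (h : gammaFactor χ x ≠ 0) : ‖completedLFunction χ⁻¹ x‖ = ‖completedLFunction χ x‖ := by
  have h0' : (x:ℂ) ≠ 0 := by exact_mod_cast h0
  have h1' : (x:ℂ) ≠ 1 := by exact_mod_cast h1
  have h2 := LFunction_conj χ h0' h1' h (by rwa [conj_ofReal, gammaFactor_inv])
  rw [conj_ofReal] at h2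
  rw [completedLFunction_eq_mul χ h0' h, completedLFunction_eq_mul χ⁻¹ h0' (by rwa [gammaFactor_inv]), h2,
    gammaFactor_inv, norm_mul, norm_mul, Complex.norm_conj]

lemma norm_rootNumber (hχ : χ.IsPrimitive) : ‖rootNumber χ‖ = 1 := by
  have g1 : gammaFactor χ ((3/2:ℝ):ℂ) ≠ 0 := gammaFactor_ne_zero χ (by rw [ofReal_re]; norm_num)
  have g2 : gammaFactor χ ((-1/2:ℝ):ℂ) ≠ 0 := gammaFactor_ne_zero_left χ (by rw [ofReal_re]; norm_num)
    (by rw [ofReal_re]; norm_num) (by rw [ofReal_re]; norm_num)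
  have h1 := hχ.completedLFunction_one_sub ((3/2:ℝ):ℂ)
  have h2 := hχ.completedLFunction_one_sub ((-1/2:ℝ):ℂ)
  have n1 := norm_completedLFunction_inv χ (x := 3/2) (by norm_num) (by norm_num) g1
  have n2 := norm_completedLFunction_inv χ (x := -1/2) (by norm_num) (by norm_num) g2
  rw [show (1:ℂ) - ((3/2:ℝ):ℂ) = ((-1/2:ℝ):ℂ) by push_cast; ring,
    show ((3/2:ℝ):ℂ) - 1/2 = 1 by push_cast; ring, cpow_one] at h1
  rw [show (1:ℂ) - ((-1/2:ℝ):ℂ) = ((3/2:ℝ):ℂ) by push_cast; ring,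
    show ((-1/2:ℝ):ℂ) - 1/2 = -1 by push_cast; ring, cpow_neg_one] at h2
  have m1 := congrArg norm h1
  have m2 := congrArg norm h2
  rw [norm_mul, norm_mul, n1] at m1
  rw [norm_mul, norm_mul, n2, m1, norm_inv] at m2
  have hN : ‖(N:ℂ)‖ ≠ 0 := norm_ne_zero_iff.2 (NeZero.ne _)
  have hL : ‖completedLFunction χ ((3/2:ℝ):ℂ)‖ ≠ 0 := by
    rw [norm_ne_zero_iff, completedLFunction_eq_mul χ (by norm_num) g1]
    refine mul_ne_zero ?_ g1
    refine LFunction_ne_zero_of_one_le_re χ (.inr ?_) ?_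
    · intro h
      have : (3/2:ℝ) = 1 := by exact_mod_cast h
      norm_num at this
    · rw [ofReal_re]; norm_num
  have m3 : ‖rootNumber χ‖ ^ 2 = 1 := by
    have : ‖completedLFunction χ ((3/2:ℝ):ℂ)‖ * ‖rootNumber χ‖ ^ 2 = ‖completedLFunction χ ((3/2:ℝ):ℂ)‖ * 1 := by
      rw [mul_one]
      conv_rhs => rw [m2]
      field_simp
    exact mul_left_cancel₀ hL this
  exact (pow_eq_one_iff_of_nonneg (norm_nonneg _) two_ne_zero).1 m3

lemma norm_feFactor (hχ : χ.IsPrimitive) (z : ℂ) :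
    ‖feFactor χ z‖ = (N:ℝ) ^ (1/2 - z.re) * ‖gammaQuot χ z‖ := by
  rw [feFactor, norm_mul, norm_mul, norm_rootNumber hχ, one_mul, norm_natCast_cpow (NeZero.pos N)]
  simp

lemma norm_feFactor_critical (hχ : χ.IsPrimitive) (t : ℝ) :
    ‖feFactor χ (1/2 + t * I)‖ = ‖(-1/2 + t * I : ℂ)‖ := by
  rw [norm_feFactor hχ, norm_gammaQuot_critical]
  simp

lemma norm_feFactor_right (hχ : χ.IsPrimitive) (t : ℝ) : ‖feFactor χ (3/2 + t * I)‖ ≤ 2 * π := by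
  have hre : (3/2 + t * I : ℂ).re = 3/2 := by
    rw [show (3/2 + t * I : ℂ) = (((3/2:ℝ) : ℂ) + t * I) by push_cast; ring]; simp
  rw [norm_feFactor hχ, norm_gammaQuot_right, hre]
  refine mul_le_of_le_one_left (by positivity) ?_
  exact Real.rpow_le_one_of_one_le_of_nonpos (by exact_mod_cast NeZero.pos N) (by norm_num)

lemma norm_feFactor_left (hχ : χ.IsPrimitive) (t : ℝ) :
    ‖feFactor χ (-1/2 + t * I)‖ ≤ N * (1 + |t|) ^ 2 := by
  have hre : (-1/2 + t * I : ℂ).re = -1/2 := by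
    rw [show (-1/2 + t * I : ℂ) = (((-1/2:ℝ) : ℂ) + t * I) by push_cast; ring]; simp
  rw [norm_feFactor hχ, norm_gammaQuot_left, hre, show (1/2 - -1/2 : ℝ) = 1 by norm_num, Real.rpow_one]
  gcongr
  have h1 := norm_re_add_I_le (3/2) t
  have h2 := norm_re_add_I_le (1/2) t
  rw [abs_of_pos (by norm_num)] at h1 h2
  push_cast at h1 h2
  have h3 := Real.pi_gt_three
  rw [div_le_iff₀ (by positivity)]
  have := abs_nonneg t
  calc _ ≤ (3/2 + |t|) * (1/2 + |t|) := by gcongr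
    _ ≤ (1 + |t|) ^ 2 * 1 := by nlinarith
    _ ≤ _ := by gcongr; linarith

lemma expGrowth_feFactor (χ : DirichletCharacter ℂ N) : ExpGrowth (feFactor χ) := by
  have h := ((ExpGrowth.const (rootNumber χ)).mul
    (expGrowth_rpow (x := N) (by exact_mod_cast NeZero.pos N) (-1) (1/2))).mul (expGrowth_gammaQuot χ)
  convert h using 2 with z
  rw [feFactor]
  congr 3
  push_cast; ring

lemma differentiableOn_feFactor (χ : DirichletCharacter ℂ N) :
    DifferentiableOn ℂ (feFactor χ) (re ⁻¹' Set.Ioo (-1) 2) := by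
  have hN : (N:ℂ) ≠ 0 := NeZero.ne _
  have h1 := differentiableOn_gammaQuot χ
  have h2 : Differentiable ℂ (fun z : ℂ => (N:ℂ) ^ (1/2 - z)) := fun z => by
    exact DifferentiableAt.const_cpow (by fun_prop) (.inl hN)
  exact ((h2.const_mul _).differentiableOn).mul h1

lemma entireL_right (χ : DirichletCharacter ℂ N) (t : ℝ) :
    entireL χ (3/2 + t * I) = (1/2 + t * I) * LFunction χ (3/2 + t * I) := by
  have hre : (3/2 + t * I : ℂ).re = 3/2 := by
    rw [show (3/2 + t * I : ℂ) = (((3/2:ℝ) : ℂ) + t * I) by push_cast; ring]; simp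
  rw [entireL_eq χ (fun h => ?_) (fun h => ?_) (gammaFactor_ne_zero χ (by rw [hre]; norm_num))]
  · congr 1; ring
  · rw [h] at hre; norm_num at hre
  · rw [h] at hre; norm_num at hre

lemma entireL_left (hχ : χ.IsPrimitive) (t : ℝ) :
    entireL χ (-1/2 + t * I) = feFactor χ (-1/2 + t * I) * (starRingEnd ℂ) (LFunction χ (3/2 + t * I)) := by
  have hre : (-1/2 + t * I : ℂ).re = -1/2 := by
    rw [show (-1/2 + t * I : ℂ) = (((-1/2:ℝ) : ℂ) + t * I) by push_cast; ring]; simp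
  have hre' : (3/2 + t * I : ℂ).re = 3/2 := by
    rw [show (3/2 + t * I : ℂ) = (((3/2:ℝ) : ℂ) + t * I) by push_cast; ring]; simp
  have hc : (1:ℂ) - (-1/2 + t * I) = (starRingEnd ℂ) (3/2 + t * I) := by
    rw [show (3/2 + t * I : ℂ) = (((3/2:ℝ) : ℂ) + t * I) by push_cast; ring, map_add, map_mul, conj_ofReal,
        conj_ofReal, conj_I]; push_cast; ring
  rw [entireL_eq_feFactor hχ (fun h => ?_) (by rw [hre]; norm_num)
    (gammaFactor_ne_zero_left χ (by rw [hre]; norm_num) (by rw [hre]; norm_num) (by rw [hre]; norm_num)), hc,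
    LFunction_conj_of_one_lt χ (by rw [hre']; norm_num)]
  rw [h] at hre; norm_num at hre

lemma half_line_ne_one (t : ℝ) : (1/2 + t * I : ℂ) ≠ 1 := fun h => by
  have := congrArg re h
  norm_num at this

lemma half_line_ne_zero (t : ℝ) : (1/2 + t * I : ℂ) ≠ 0 := fun h => by
  have := congrArg re h
  norm_num at this

lemma entireL_half (χ : DirichletCharacter ℂ N) (t : ℝ) :
    entireL χ (1/2 + t * I) = (-1/2 + t * I) * LFunction χ (1/2 + t * I) := by
  rw [entireL_eq χ (half_line_ne_zero t) (half_line_ne_one t) (gammaFactor_ne_zero χ (by simp))]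
  congr 1; ring

lemma entireL_critical (hχ : χ.IsPrimitive) (t : ℝ) :
    entireL χ (1/2 + t * I) * (starRingEnd ℂ) (-1/2 + t * I) =
      feFactor χ (1/2 + t * I) * (starRingEnd ℂ) (entireL χ (1/2 + t * I)) := by
  have hc : (1:ℂ) - (1/2 + t * I) = (starRingEnd ℂ) (1/2 + t * I) := by
    rw [show (1/2 + t * I : ℂ) = (((1/2:ℝ) : ℂ) + t * I) by push_cast; ring, map_add, map_mul, conj_ofReal,
        conj_ofReal, conj_I]; push_cast; ring
  have hγ : gammaFactor χ (1/2 + t * I) ≠ 0 := gammaFactor_ne_zero χ (by simp)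
  conv_rhs => rw [entireL_half, map_mul]
  rw [entireL_eq_feFactor hχ (half_line_ne_zero t) (by norm_num) hγ, hc,
    LFunction_conj χ (half_line_ne_zero t) (half_line_ne_one t) hγ
      (by rw [gammaFactor_inv, gammaFactor_conj]; simpa using hγ)]
  ring

end FunctionalEquation

/-- A Dirichlet character as an arithmetic function. -/
noncomputable def charFn {N : ℕ} (χ : DirichletCharacter ℂ N) : ArithmeticFunction ℂ :=
  toArithmeticFunction (fun n => χ n)

lemma charFn_apply {N : ℕ} (χ : DirichletCharacter ℂ N) {n : ℕ} (hn : n ≠ 0) :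
    charFn χ n = χ n := by
  simp [charFn, toArithmeticFunction, hn]

lemma LogBound.mono {f : ℕ → ℝ} {C D : ℝ} (h : LogBound f C) (hCD : C ≤ D) : LogBound f D := by
  intro x hx
  refine (h x hx).trans ?_
  have := Real.log_natCast_nonneg x
  gcongr

lemma tendsto_dsum {a : ℕ → ℂ} {z l : ℂ} (h : LSeriesHasSum a z l) :
    Tendsto (fun M => dsum a M z) atTop (𝓝 l) := by
  have h1 := (HasSum.tendsto_sum_nat h).comp (tendsto_add_atTop_nat 1)
  refine h1.congr fun M => ?_
  simp only [Function.comp_apply, dsum]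
  rw [sum_range_succ', LSeries.term_zero, add_zero, range_eq_Ico, sum_Ico_add' (fun n => LSeries.term a z n)]
  refine sum_congr ?_ fun n hn => ?_
  · ext n; simp
  · have : n ≠ 0 := by have := (mem_Icc.1 hn).1; omega
    rw [LSeries.term_of_ne_zero this, cpow_neg, div_eq_mul_inv]

lemma lseriesHasSum_mul {N₁ N₂ : ℕ} [NeZero N₁] [NeZero N₂] (χ₁ : DirichletCharacter ℂ N₁)
    (χ₂ : DirichletCharacter ℂ N₂) {s : ℂ} (hs : 1 < s.re) :
    LSeriesHasSum ⇑(charFn χ₁ * charFn χ₂) s (χ₁.LFunction s * χ₂.LFunction s) := by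
  have h1 := (χ₁.LSeriesSummable_of_one_lt_re hs).LSeriesHasSum
  have h2 := (χ₂.LSeriesSummable_of_one_lt_re hs).LSeriesHasSum
  rw [χ₁.LFunction_eq_LSeries hs, χ₂.LFunction_eq_LSeries hs]
  exact h1.convolution h2

theorem fe_mul {N₁ N₂ : ℕ} [NeZero N₁] [NeZero N₂] {χ₁ : DirichletCharacter ℂ N₁}
    {χ₂ : DirichletCharacter ℂ N₂} (h₁ : χ₁.IsPrimitive) (h₂ : χ₂.IsPrimitive) {A : ℝ}
    (hA : LogBound (fun n => ‖(charFn χ₁ * charFn χ₂) n‖ ^ 2) A) :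
    ∃ B, FE ⇑(charFn χ₁ * charFn χ₂)
      (fun t => χ₁.LFunction (3/2 + t * I) * χ₂.LFunction (3/2 + t * I))
      (fun z => entireL χ₁ z * entireL χ₂ z) (fun z => feFactor χ₁ z * feFactor χ₂ z) B := by
  have hA0 := hA.nonneg fun _ => by positivity
  have hN : (0:ℝ) ≤ N₁ * N₂ := by positivity
  refine ⟨A + 1 + (2 * π) ^ 2 + N₁ * N₂, ?_, ?_, ?_, ?_, ?_, ?_, ?_, ?_, ?_, ?_, ?_, ?_, ?_⟩
  · nlinarith [sq_nonneg (2 * π)]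
  · exact hA.mono (by nlinarith [sq_nonneg (2 * π)])
  · exact ((differentiable_entireL χ₁).mul (differentiable_entireL χ₂)).differentiableOn
  · exact (differentiableOn_feFactor χ₁).mul (differentiableOn_feFactor χ₂)
  · exact (expGrowth_entireL χ₁).mul (expGrowth_entireL χ₂)
  · exact (expGrowth_feFactor χ₁).mul (expGrowth_feFactor χ₂)
  · intro t
    exact tendsto_dsum (lseriesHasSum_mul χ₁ χ₂ (by simp; norm_num))
  · intro t
    simp only [entireL_right]
    ring
  · intro t
    simp only [entireL_left h₁, entireL_left h₂, map_mul]
    ring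
  · intro t
    have e1 := entireL_critical h₁ t
    have e2 := entireL_critical h₂ t
    simp only [map_mul, map_pow]
    calc _ = (entireL χ₁ (1/2+t*I) * (starRingEnd ℂ) (-1/2+t*I)) *
          (entireL χ₂ (1/2+t*I) * (starRingEnd ℂ) (-1/2+t*I)) := by ring
      _ = _ := by rw [e1, e2]; ring
  · intro t
    rw [norm_mul, norm_feFactor_critical h₁, norm_feFactor_critical h₂]
    ring
  · intro t
    rw [norm_mul]
    have e1 := norm_feFactor_right h₁ t
    have e2 := norm_feFactor_right h₂ t
    have := mul_le_mul e1 e2 (norm_nonneg _) (by positivity)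
    nlinarith
  · intro t
    rw [norm_mul]
    have e1 := norm_feFactor_left h₁ t
    have e2 := norm_feFactor_left h₂ t
    have := mul_le_mul e1 e2 (norm_nonneg _) (by positivity)
    refine this.trans ?_
    have h4 : (N₁:ℝ) * N₂ ≤ A + 1 + (2 * π) ^ 2 + N₁ * N₂ := by nlinarith [sq_nonneg (2 * π)]
    calc _ = (N₁:ℝ) * N₂ * (1 + |t|) ^ 4 := by ring
      _ ≤ _ := by gcongr

lemma arith_sub_apply (f g : ArithmeticFunction ℂ) (n : ℕ) : (f - g) n = f n - g n := by
  rw [sub_eq_add_neg, ArithmeticFunction.add_apply, sub_eq_add_neg]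
  rfl

/-- The arithmetic function supported at `p`, with value `u`. -/
noncomputable def singleFn (p : ℕ) (u : ℂ) : ArithmeticFunction ℂ :=
  toArithmeticFunction (fun n => if n = p then u else 0)

lemma singleFn_apply {p : ℕ} (hp : p ≠ 0) (u : ℂ) (n : ℕ) :
    singleFn p u n = if n = p then u else 0 := by
  rcases eq_or_ne n 0 with rfl | hn
  · simp [hp.symm]
  · simp [singleFn, toArithmeticFunction, hn]

lemma singleFn_mul_apply {p : ℕ} (hp : p ≠ 0) (u : ℂ) (f : ArithmeticFunction ℂ) (n : ℕ) :
    (singleFn p u * f) n = if p ∣ n then u * f (n / p) else 0 := by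
  rcases eq_or_ne n 0 with rfl | hn
  · simp
  rw [ArithmeticFunction.mul_apply]
  simp only [singleFn_apply hp]
  split_ifs with h
  · rw [sum_eq_single (p, n / p)]
    · simp
    · intro b hb hne
      rw [Nat.mem_divisorsAntidiagonal] at hb
      rw [if_neg, zero_mul]
      intro hbp
      refine hne (Prod.ext hbp ?_)
      rw [← hb.1, hbp, Nat.mul_div_cancel_left _ (Nat.pos_of_ne_zero hp)]
    · intro hne
      exact absurd (Nat.mem_divisorsAntidiagonal.2 ⟨Nat.mul_div_cancel' h, hn⟩) hne
  · refine sum_eq_zero fun b hb => ?_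
    rw [Nat.mem_divisorsAntidiagonal] at hb
    rw [if_neg, zero_mul]
    intro hbp
    exact h (hbp ▸ Dvd.intro _ hb.1)

/-- The coefficients of `∏ p ∈ P, (1 - χ p p^{-s})`. -/
noncomputable def eulerFn {N : ℕ} (χ : DirichletCharacter ℂ N) (P : Finset ℕ) : ArithmeticFunction ℂ :=
  ∏ p ∈ P, (1 - singleFn p (χ p))

/-- The restriction of a character to the integers prime to all members of `P`. -/
noncomputable def coprimeFn {N : ℕ} (χ : DirichletCharacter ℂ N) (P : Finset ℕ) : ArithmeticFunction ℂ :=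
  toArithmeticFunction (fun n => if ∀ p ∈ P, ¬ p ∣ n then χ n else 0)

lemma coprimeFn_apply {N : ℕ} (χ : DirichletCharacter ℂ N) (P : Finset ℕ) {n : ℕ} (hn : n ≠ 0) :
    coprimeFn χ P n = if ∀ p ∈ P, ¬ p ∣ n then χ n else 0 := by
  simp [coprimeFn, toArithmeticFunction, hn]

lemma coprimeFn_insert {N : ℕ} (χ : DirichletCharacter ℂ N) {P : Finset ℕ} {p : ℕ} (hp : p.Prime)
    (hP : ∀ r ∈ P, r.Prime) (hpP : p ∉ P) :
    coprimeFn χ (insert p P) = (1 - singleFn p (χ p)) * coprimeFn χ P := by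
  ext n
  rcases eq_or_ne n 0 with rfl | hn
  · simp
  rw [sub_mul, one_mul, arith_sub_apply, singleFn_mul_apply hp.ne_zero,
    coprimeFn_apply _ _ hn, coprimeFn_apply _ _ hn]
  by_cases h : p ∣ n
  · obtain ⟨m, rfl⟩ := h
    have hm : m ≠ 0 := by rintro rfl; simp at hn
    rw [if_neg (by simp), if_pos (Dvd.intro _ rfl), Nat.mul_div_cancel_left _ hp.pos, coprimeFn_apply _ _ hm]
    have : (∀ r ∈ P, ¬ r ∣ p * m) ↔ ∀ r ∈ P, ¬ r ∣ m := by
      refine forall₂_congr fun r hr => not_congr ?_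
      rw [(hP r hr).dvd_mul, or_iff_right]
      intro hrp
      exact hpP (((Nat.prime_dvd_prime_iff_eq (hP r hr) hp).1 hrp) ▸ hr)
    simp only [this]
    split_ifs <;> simp
  · rw [if_neg h, sub_zero]
    simp [h]

lemma coprimeFn_eq {N : ℕ} (χ : DirichletCharacter ℂ N) {P : Finset ℕ} (hP : ∀ r ∈ P, r.Prime) :
    coprimeFn χ P = eulerFn χ P * charFn χ := by
  induction P using Finset.induction_on with
  | empty => simp [coprimeFn, eulerFn, charFn]
  | insert p P hpP ih =>
    rw [coprimeFn_insert χ (hP p (by simp)) (fun r hr => hP r (by simp [hr])) hpP,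
      ih (fun r hr => hP r (by simp [hr])), eulerFn, eulerFn, prod_insert hpP, mul_assoc]

lemma forall_not_dvd_iff {q : ℕ} [NeZero q] (n : ℕ) :
    (∀ p ∈ q.primeFactors, ¬ p ∣ n) ↔ n.Coprime q := by
  constructor
  · intro h
    refine Nat.Coprime.symm (Nat.coprime_of_dvd fun r hr h1 h2 => ?_)
    exact h r (Nat.mem_primeFactors.2 ⟨hr, h1, NeZero.ne q⟩) h2
  · intro h p hp hpn
    have := Nat.dvd_gcd hpn (Nat.dvd_of_mem_primeFactors hp)
    rw [h.gcd_eq_one] at this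
    exact (Nat.prime_of_mem_primeFactors hp).one_lt.not_ge (Nat.le_of_dvd one_pos this)

lemma charFn_eq_eulerFn_mul {q : ℕ} [NeZero q] (χ : DirichletCharacter ℂ q) :
    charFn χ = eulerFn χ.primitiveCharacter q.primeFactors * charFn χ.primitiveCharacter := by
  rw [← coprimeFn_eq _ fun r hr => Nat.prime_of_mem_primeFactors hr]
  ext n
  rcases eq_or_ne n 0 with rfl | hn
  · simp
  rw [charFn_apply _ hn, coprimeFn_apply _ _ hn]
  have := forall_not_dvd_iff (q := q) n
  split_ifs with h
  · have := χ.primitiveCharacter_apply_of_isCoprime (a := n) (by exact_mod_cast (this.1 h).isCoprime)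
    exact_mod_cast this.symm
  · rw [this] at h
    exact χ.map_nonunit (by rwa [ZMod.isUnit_iff_coprime])

/-- `c` is finitely supported, with Dirichlet series `P`. -/
def HasPoly (c : ArithmeticFunction ℂ) (P : ℂ → ℂ) : Prop :=
  ∃ Q : ℕ, 1 ≤ Q ∧ (∀ d, Q < d → c d = 0) ∧ ∀ z, dsum c Q z = P z

lemma HasPoly.mul {c d : ArithmeticFunction ℂ} {P R : ℂ → ℂ} (hc : HasPoly c P) (hd : HasPoly d R) :
    HasPoly (c * d) (fun z => P z * R z) := by
  obtain ⟨Q, hQ, h1, h2⟩ := hc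
  obtain ⟨M, hM, h3, h4⟩ := hd
  refine ⟨Q * M, Nat.mul_pos hQ hM, fun k hk => ?_, fun z => ?_⟩
  · rw [ArithmeticFunction.mul_apply]
    refine sum_eq_zero fun p hp => ?_
    rw [Nat.mem_divisorsAntidiagonal] at hp
    rcases lt_or_ge Q p.1 with h | h
    · rw [h1 _ h, zero_mul]
    · rw [h3 _, mul_zero]
      by_contra! hlt
      have := Nat.mul_le_mul h hlt
      omega
  · simp only [← h2, ← h4]
    rw [dsum_mul_dsum]
    unfold dsum
    refine sum_congr rfl fun k hk => ?_
    congr 1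
    rw [ArithmeticFunction.mul_apply, prodCoeff]
    refine (sum_subset (fun p hp => ?_) fun p hp hn => ?_).symm
    · rw [mem_filter] at hp
      exact Nat.mem_divisorsAntidiagonal.2 ⟨hp.2, by have := (mem_Icc.1 hk).1; omega⟩
    · rw [Nat.mem_divisorsAntidiagonal] at hp
      rcases lt_or_ge Q p.1 with h | h
      · rw [h1 _ h, zero_mul]
      rcases lt_or_ge M p.2 with h' | h'
      · rw [h3 _ h', mul_zero]
      refine absurd ?_ hn
      have hp1 : 0 < p.1 := Nat.pos_of_ne_zero fun h => by rw [h, zero_mul] at hp; omega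
      have hp2 : 0 < p.2 := Nat.pos_of_ne_zero fun h => by rw [h, mul_zero] at hp; omega
      rw [mem_filter, mem_product, mem_Icc, mem_Icc]
      exact ⟨⟨⟨hp1, h⟩, hp2, h'⟩, hp.1⟩

lemma HasPoly.one_sub {p : ℕ} (hp : 1 ≤ p) (u : ℂ) :
    HasPoly (1 - singleFn p u) (fun z => 1 - u * (p:ℂ) ^ (-z)) := by
  refine ⟨p, hp, fun d hd => ?_, fun z => ?_⟩
  · rw [arith_sub_apply, singleFn_apply (by omega), if_neg (by omega),
      ArithmeticFunction.one_apply_ne (by omega), sub_zero]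
  · unfold dsum
    simp only [arith_sub_apply, singleFn_apply (show p ≠ 0 by omega), sub_mul, sum_sub_distrib]
    congr 1
    · rw [sum_eq_single 1]
      · simp
      · intro b _ hb; rw [ArithmeticFunction.one_apply_ne hb, zero_mul]
      · intro h; exact absurd (mem_Icc.2 ⟨le_rfl, hp⟩) h
    · rw [sum_eq_single p]
      · simp
      · intro b _ hb; simp [hb]
      · intro h; exact absurd (mem_Icc.2 ⟨hp, le_rfl⟩) h

lemma HasPoly.eulerFn {N : ℕ} (χ : DirichletCharacter ℂ N) {P : Finset ℕ} (hP : ∀ p ∈ P, 1 ≤ p) :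
    HasPoly (eulerFn χ P) (fun z => ∏ p ∈ P, (1 - χ p * (p:ℂ) ^ (-z))) := by
  induction P using Finset.induction_on with
  | empty =>
    refine ⟨1, le_rfl, fun d hd => ?_, fun z => ?_⟩
    · rw [MeanSquareL.eulerFn, prod_empty, ArithmeticFunction.one_apply_ne (by omega)]
    · simp [MeanSquareL.eulerFn, dsum]
  | insert p P hpP ih =>
    simp only [MeanSquareL.eulerFn, prod_insert hpP]
    exact (HasPoly.one_sub (hP p (by simp)) _).mul (ih fun r hr => hP r (by simp [hr]))

lemma sum_ite_dvd {M : Type*} [AddCommMonoid M] {p : ℕ} (hp : 1 ≤ p) (f : ℕ → M) (x : ℕ) :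
    ∑ n ∈ Icc 1 x, (if p ∣ n then f (n / p) else 0) = ∑ m ∈ Icc 1 (x / p), f m := by
  rw [← sum_filter]
  symm
  refine sum_nbij (fun m => p * m) ?_ ?_ ?_ ?_
  · intro m hm
    rw [mem_Icc] at hm
    rw [mem_filter, mem_Icc]
    refine ⟨⟨Nat.mul_pos hp hm.1, ?_⟩, Dvd.intro _ rfl⟩
    exact (Nat.mul_le_mul_left p hm.2).trans (Nat.mul_div_le x p)
  · intro a _ b _ h
    exact Nat.eq_of_mul_eq_mul_left hp h
  · intro n hn
    rw [mem_coe, mem_filter, mem_Icc] at hn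
    obtain ⟨⟨h1, h2⟩, m, rfl⟩ := hn
    refine ⟨m, ?_, rfl⟩
    rw [mem_coe, mem_Icc]
    refine ⟨Nat.pos_of_ne_zero fun h => by rw [h, mul_zero] at h1; omega, ?_⟩
    rw [Nat.le_div_iff_mul_le hp, mul_comm]
    exact h2
  · intro m _
    rw [Nat.mul_div_cancel_left m hp]

lemma LogBound.of_one_sub {b : ArithmeticFunction ℂ} {p : ℕ} {u : ℂ} {C : ℝ} (hp : 2 ≤ p)
    (hu : ‖u‖ ≤ 1) (h : LogBound (fun n => ‖((1 - singleFn p u) * b) n‖ ^ 2) C) :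
    LogBound (fun n => ‖b n‖ ^ 2) (12 * C) := by
  have hC := h.nonneg fun _ => by positivity
  set a := (1 - singleFn p u) * b with ha
  have hab : ∀ n, b n = a n + if p ∣ n then u * b (n / p) else 0 := fun n => by
    rw [← singleFn_mul_apply (by omega), ha, sub_mul, one_mul, arith_sub_apply, sub_add_cancel]
  have hle : ∀ n, ‖b n‖ ^ 2 ≤ 3 * ‖a n‖ ^ 2 + 3 / 2 * if p ∣ n then ‖b (n / p)‖ ^ 2 else 0 := by
    intro n
    rw [hab n]
    split_ifs with hd
    · have h1 : ‖a n + u * b (n / p)‖ ≤ ‖a n‖ + ‖b (n / p)‖ := by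
        refine (norm_add_le _ _).trans ?_
        rw [norm_mul]
        nlinarith [norm_nonneg (b (n / p))]
      nlinarith [norm_nonneg (a n + u * b (n / p)), sq_nonneg (2 * ‖a n‖ - ‖b (n / p)‖)]
    · rw [add_zero]
      nlinarith [sq_nonneg ‖a n‖]
  have hsum : ∀ x, ∑ n ∈ Icc 1 x, ‖b n‖ ^ 2 ≤
      3 * ∑ n ∈ Icc 1 x, ‖a n‖ ^ 2 + 3 / 2 * ∑ m ∈ Icc 1 (x / p), ‖b m‖ ^ 2 := fun x => by
    rw [← sum_ite_dvd (by omega) (fun m => ‖b m‖ ^ 2), mul_sum, mul_sum, ← sum_add_distrib]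
    exact sum_le_sum fun n _ => hle n
  intro x
  induction x using Nat.strong_induction_on with
  | _ x ih =>
    intro hx
    have hs := hsum x
    have h1 := h x hx
    have hx' : (2:ℝ) ≤ x := by exact_mod_cast hx
    have hl : 0 ≤ Real.log x := Real.log_natCast_nonneg x
    have hpos : 0 ≤ C * x * Real.log x := by positivity
    have hxp : x / p ≤ x / 2 := Nat.div_le_div_left hp (by norm_num)
    dsimp only at h1 ⊢
    rcases lt_or_ge (x / p) 2 with h2 | h2
    · rcases Nat.lt_or_ge (x / p) 1 with h3 | h3
      · have : x / p = 0 := Nat.lt_one_iff.1 h3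
        rw [this] at hs
        simp at hs
        linarith
      · have : x / p = 1 := le_antisymm (Nat.lt_succ_iff.1 h2) h3
        rw [this, Icc_self, sum_singleton] at hs
        have hb1 : b 1 = a 1 := by rw [hab 1, if_neg (by rw [Nat.dvd_one]; omega), add_zero]
        have : ‖a 1‖ ^ 2 ≤ ∑ n ∈ Icc 1 x, ‖a n‖ ^ 2 :=
          single_le_sum (f := fun n => ‖a n‖ ^ 2) (fun _ _ => by positivity) (mem_Icc.2 ⟨le_rfl, by omega⟩)
        rw [hb1] at hs
        linarith
    · have h3 := ih (x / p) (by omega) h2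
      have h4 : ((x / p : ℕ) : ℝ) ≤ x / 2 :=
        (Nat.cast_le.2 hxp).trans (Nat.cast_div_le (m := x) (n := 2))
      have h5 : Real.log ((x / p : ℕ) : ℝ) ≤ Real.log x :=
        Real.log_le_log (by exact_mod_cast (by omega)) (by linarith)
      have h6 : 12 * C * ((x / p : ℕ) : ℝ) * Real.log ((x / p : ℕ) : ℝ) ≤ 12 * C * (x / 2) * Real.log x := by
        gcongr
      linarith

lemma LogBound.of_eulerFn {N : ℕ} (χ : DirichletCharacter ℂ N) {P : Finset ℕ} (hP : ∀ r ∈ P, r.Prime)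
    {b : ArithmeticFunction ℂ} {C : ℝ} (h : LogBound (fun n => ‖(eulerFn χ P * b) n‖ ^ 2) C) :
    ∃ D, LogBound (fun n => ‖b n‖ ^ 2) D := by
  induction P using Finset.induction_on generalizing C with
  | empty => exact ⟨C, by simpa [eulerFn] using h⟩
  | insert p P hpP ih =>
    refine ih (C := 12 * C) (fun r hr => hP r (by simp [hr])) ?_
    refine LogBound.of_one_sub (hP p (by simp)).two_le (χ.norm_le_one p) ?_
    rwa [eulerFn, prod_insert hpP, mul_assoc] at h

theorem mean_square_of_logBound {q : ℕ} [NeZero q] (χ ν : DirichletCharacter ℂ q) {A : ℝ}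
    (hA : LogBound (fun n => ‖(charFn χ * charFn ν) n‖ ^ 2) A) :
    ∃ K : ℝ, ∀ (T : ℝ) (N : ℕ), 2 ≤ N → (N:ℝ) ≤ T → T ≤ N + 1 →
      |(∫ t in T..(2*T), ‖χ.LFunction (1/2 + t * I) * ν.LFunction (1/2 + t * I)‖ ^ 2)
        - 2 * T * ∑ k ∈ Icc 1 N, ‖(charFn χ * charFn ν) k‖ ^ 2 / k| ≤ K * T * Real.log T := by
  have : NeZero χ.conductor := ⟨χ.conductor_ne_zero⟩
  have : NeZero ν.conductor := ⟨ν.conductor_ne_zero⟩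
  have hP : ∀ r ∈ q.primeFactors, r.Prime := fun r hr => Nat.prime_of_mem_primeFactors hr
  have hP' : ∀ r ∈ q.primeFactors, 1 ≤ r := fun r hr => (hP r hr).one_le
  have he : charFn χ * charFn ν =
      (eulerFn χ.primitiveCharacter q.primeFactors * eulerFn ν.primitiveCharacter q.primeFactors) *
      (charFn χ.primitiveCharacter * charFn ν.primitiveCharacter) := by
    rw [charFn_eq_eulerFn_mul χ, charFn_eq_eulerFn_mul ν]
    ring
  obtain ⟨B, hB⟩ : ∃ B, LogBound
      (fun n => ‖(charFn χ.primitiveCharacter * charFn ν.primitiveCharacter) n‖ ^ 2) B := by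
    rw [he, mul_assoc] at hA
    obtain ⟨D, hD⟩ := LogBound.of_eulerFn _ hP hA
    exact LogBound.of_eulerFn _ hP hD
  obtain ⟨D, fe⟩ := fe_mul χ.primitiveCharacter_isPrimitive ν.primitiveCharacter_isPrimitive hB
  obtain ⟨Q, hQ, h1, h2⟩ := (HasPoly.eulerFn χ.primitiveCharacter hP').mul
    (HasPoly.eulerFn ν.primitiveCharacter hP')
  obtain ⟨K, hK⟩ := fe.mean_square hQ h1 (b := ⇑(charFn χ * charFn ν)) fun k => by
    rw [he, ArithmeticFunction.mul_apply]
  refine ⟨K, fun T N hN hNT hTN => ?_⟩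
  have h := hK T N hN hNT hTN
  have key : ∀ t : ℝ, χ.LFunction (1/2 + t * I) * ν.LFunction (1/2 + t * I) =
      dsum (⇑(eulerFn χ.primitiveCharacter q.primeFactors * eulerFn ν.primitiveCharacter q.primeFactors)) Q
        (1/2 + t * I) * (entireL χ.primitiveCharacter (1/2 + t * I) *
        entireL ν.primitiveCharacter (1/2 + t * I) / (1/2 + t * I - 1) ^ 2) := by
    intro t
    have hz : (1/2 + t * I - 1 : ℂ) ≠ 0 := sub_ne_zero.2 (half_line_ne_one t)
    have e1 := DirichletCharacter.LFunction_changeLevel χ.conductor_dvd_level χ.primitiveCharacter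
      (s := 1/2 + t * I) (.inr (half_line_ne_one t))
    have e2 := DirichletCharacter.LFunction_changeLevel ν.conductor_dvd_level ν.primitiveCharacter
      (s := 1/2 + t * I) (.inr (half_line_ne_one t))
    rw [DirichletCharacter.changeLevel_primitiveCharacter] at e1 e2
    rw [h2, e1, e2, entireL_half, entireL_half,
      show (-1/2 + t * I : ℂ) = 1/2 + t * I - 1 by ring]
    generalize (1/2 + t * I : ℂ) = s at *
    field_simp
  simpa only [key] using h

open Asymptotics

/-- The logarithmically weighted partial sums `∑ n ≤ N, f n / n`. -/
noncomputable def wsum (f : ArithmeticFunction ℂ) (N : ℕ) : ℂ := ∑ n ∈ Icc 1 N, f n / n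

lemma wsum_mul (f g : ArithmeticFunction ℂ) (N : ℕ) :
    wsum (f * g) N = ∑ n ∈ Icc 1 N, f n / n * wsum g (N / n) := by
  set F : ArithmeticFunction ℂ := toArithmeticFunction (fun n => f n / n) with hF
  set G : ArithmeticFunction ℂ := toArithmeticFunction (fun n => g n / n) with hG
  have hF' : ∀ n, F n = f n / n := fun n => by
    rcases eq_or_ne n 0 with rfl | hn
    · simp
    · simp [hF, toArithmeticFunction, hn]
  have hG' : ∀ n, G n = g n / n := fun n => by
    rcases eq_or_ne n 0 with rfl | hn
    · simp
    · simp [hG, toArithmeticFunction, hn]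
  have h := ArithmeticFunction.sum_Ioc_mul_eq_sum_sum F G N
  simp only [hF', hG'] at h
  unfold wsum
  have e : ∀ n, Icc 1 n = Ioc 0 n := fun n => by ext; simp [Nat.succ_le_iff]
  simp only [e]
  rw [← h]
  refine sum_congr rfl fun n _ => ?_
  rw [ArithmeticFunction.mul_apply, ArithmeticFunction.mul_apply, sum_div]
  refine sum_congr rfl fun p hp => ?_
  rw [hF', hG', ← (Nat.mem_divisorsAntidiagonal.1 hp).1, Nat.cast_mul, mul_div_mul_comm]

lemma sum_one_div_le (N : ℕ) : ∑ n ∈ Icc 1 N, 1 / (n:ℝ) ≤ 1 + Real.log N := by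
  have h := harmonic_le_one_add_log N
  rw [harmonic_eq_sum_Icc] at h
  push_cast at h
  simpa using h

lemma abs_log_div_sub_le {y p : ℕ} (hp : 1 ≤ p) :
    |Real.log ((y / p : ℕ) : ℝ) - Real.log y| ≤ Real.log (2 * p) := by
  have hp' : (1:ℝ) ≤ p := by exact_mod_cast hp
  rcases Nat.lt_or_ge y p with h | h
  · rw [Nat.div_eq_of_lt h, Nat.cast_zero, Real.log_zero, zero_sub, abs_neg,
      abs_of_nonneg (Real.log_natCast_nonneg y)]
    rcases Nat.eq_zero_or_pos y with rfl | hy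
    · simp only [Nat.cast_zero, Real.log_zero]
      exact Real.log_nonneg (by linarith)
    · have : (y:ℝ) ≤ p := by exact_mod_cast h.le
      exact Real.log_le_log (by exact_mod_cast hy) (by linarith)
  · have h1 : 1 ≤ y / p := (Nat.one_le_div_iff hp).2 h
    have hy : (1:ℝ) ≤ y := by exact_mod_cast hp.trans h
    have h2 : ((y / p : ℕ) : ℝ) ≤ y := by exact_mod_cast Nat.div_le_self y p
    have h3 : (y:ℝ) ≤ 2 * p * ((y / p : ℕ) : ℝ) := by
      have : y ≤ 2 * p * (y / p) := by
        have e := Nat.div_add_mod y p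
        have e2 := Nat.mod_lt y hp
        have : p ≤ p * (y / p) := Nat.le_mul_of_pos_right p h1
        nlinarith
      exact_mod_cast this
    have h1' : (0:ℝ) < ((y / p : ℕ) : ℝ) := by exact_mod_cast h1
    have h4 := Real.log_le_log h1' h2
    have h5 := Real.log_le_log (by linarith) h3
    rw [Real.log_mul (by positivity) h1'.ne'] at h5
    rw [abs_le]
    constructor
    · linarith
    · have : 0 ≤ Real.log (2 * p) := Real.log_nonneg (by linarith)
      linarith

lemma coprimeFn_one_apply (P : Finset ℕ) {n : ℕ} (hn : n ≠ 0) :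
    coprimeFn (1 : DirichletCharacter ℂ 1) P n = if ∀ p ∈ P, ¬ p ∣ n then 1 else 0 := by
  rw [coprimeFn_apply _ _ hn, MulChar.one_apply (isUnit_of_subsingleton _)]

lemma wsum_coprimeFn_insert {P : Finset ℕ} {p : ℕ} (hp : p.Prime) (hP : ∀ r ∈ P, r.Prime)
    (hpP : p ∉ P) (y : ℕ) :
    wsum (coprimeFn (1 : DirichletCharacter ℂ 1) (insert p P)) y =
      wsum (coprimeFn (1 : DirichletCharacter ℂ 1) P) y -
        wsum (coprimeFn (1 : DirichletCharacter ℂ 1) P) (y / p) / p := by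
  have hp0 : (p:ℂ) ≠ 0 := by exact_mod_cast hp.ne_zero
  unfold wsum
  rw [← sum_ite_dvd hp.one_le (fun n => coprimeFn (1 : DirichletCharacter ℂ 1) P n / (n:ℂ)), sum_div,
    ← sum_sub_distrib]
  refine sum_congr rfl fun n _ => ?_
  rw [coprimeFn_insert _ hp hP hpP, sub_mul, one_mul, arith_sub_apply, singleFn_mul_apply hp.ne_zero,
    MulChar.one_apply (isUnit_of_subsingleton _), sub_div]
  congr 1
  split_ifs with h
  · rw [Nat.cast_div h hp0, one_mul]
    field_simp
  · simp

lemma wsum_coprimeFn {P : Finset ℕ} (hP : ∀ r ∈ P, r.Prime) :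
    ∃ C : ℝ, ∀ y : ℕ, ‖wsum (coprimeFn (1 : DirichletCharacter ℂ 1) P) y -
      (∏ p ∈ P, (1 - (p:ℂ)⁻¹)) * Real.log y‖ ≤ C := by
  induction P using Finset.induction_on with
  | empty =>
    refine ⟨1, fun y => ?_⟩
    have e : wsum (coprimeFn (1 : DirichletCharacter ℂ 1) ∅) y = ((∑ n ∈ Icc 1 y, 1 / (n:ℝ) : ℝ) : ℂ) := by
      unfold wsum
      push_cast
      refine sum_congr rfl fun n hn => ?_
      rw [coprimeFn_one_apply _ (by have := (mem_Icc.1 hn).1; omega)]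
      simp
    rw [e, prod_empty, one_mul, ← ofReal_sub, norm_real, Real.norm_eq_abs, abs_le]
    have h1 := sum_one_div_le y
    have h2 := log_add_one_le_harmonic y
    rw [harmonic_eq_sum_Icc] at h2
    push_cast at h2
    have h3 : Real.log y ≤ Real.log (y + 1) := by
      rcases Nat.eq_zero_or_pos y with rfl | hy
      · simp
      · exact Real.log_le_log (by exact_mod_cast hy) (by linarith)
    simp only [one_div] at h1 ⊢
    constructor <;> linarith
  | insert p P hpP ih =>
    obtain ⟨C, hC⟩ := ih fun r hr => hP r (by simp [hr])
    have hp : p.Prime := hP p (by simp)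
    set κ := ∏ p ∈ P, (1 - (p:ℂ)⁻¹)
    refine ⟨C + C + ‖κ‖ * Real.log (2 * p), fun y => ?_⟩
    rw [wsum_coprimeFn_insert hp (fun r hr => hP r (by simp [hr])) hpP, prod_insert hpP]
    set W := wsum (coprimeFn (1 : DirichletCharacter ℂ 1) P)
    have hpi : ‖(p:ℂ)⁻¹‖ ≤ 1 := by
      rw [norm_inv, Complex.norm_natCast]
      exact inv_le_one_of_one_le₀ (by exact_mod_cast hp.one_le)
    have e : W y - W (y / p) / p - (1 - (p:ℂ)⁻¹) * κ * Real.log y =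
        (W y - κ * Real.log y) - (p:ℂ)⁻¹ * (W (y / p) - κ * Real.log ((y / p : ℕ) : ℝ))
        - (p:ℂ)⁻¹ * (κ * ((Real.log ((y / p : ℕ) : ℝ) - Real.log y : ℝ) : ℂ)) := by
      push_cast; ring
    rw [e]
    refine (norm_sub_le _ _).trans (add_le_add ((norm_sub_le _ _).trans (add_le_add (hC y) ?_)) ?_)
    · rw [norm_mul]
      calc _ ≤ 1 * C := mul_le_mul hpi (hC _) (norm_nonneg _) zero_le_one
        _ = C := one_mul C
    · rw [norm_mul, norm_mul, norm_real, Real.norm_eq_abs]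
      calc _ ≤ 1 * (‖κ‖ * Real.log (2 * p)) := by
            gcongr
            exact abs_log_div_sub_le hp.one_le
        _ = _ := one_mul _

lemma charFn_one_apply {q : ℕ} {n : ℕ} (hn : n ≠ 0) :
    charFn (1 : DirichletCharacter ℂ q) n = if n.Coprime q then 1 else 0 := by
  rw [charFn_apply _ hn]
  split_ifs with h
  · exact MulChar.one_apply ((ZMod.isUnit_iff_coprime _ _).2 h)
  · exact MulChar.map_nonunit _ (by rwa [ZMod.isUnit_iff_coprime])

/-- The density of the integers prime to `q`. -/
noncomputable def density (q : ℕ) : ℝ := (q.totient : ℝ) / q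

lemma density_eq (q : ℕ) [NeZero q] : density q = ∏ p ∈ q.primeFactors, (1 - (p:ℝ)⁻¹) := by
  have h := congrArg (fun x : ℚ => (x : ℝ)) (Nat.totient_eq_mul_prod_factors q)
  push_cast at h
  have hq : (q:ℝ) ≠ 0 := by exact_mod_cast NeZero.ne q
  rw [density, h]
  field_simp

lemma wsum_charFn_one (q : ℕ) [NeZero q] :
    ∃ C : ℝ, ∀ y : ℕ, ‖wsum (charFn (1 : DirichletCharacter ℂ q)) y - density q * Real.log y‖ ≤ C := by
  obtain ⟨C, hC⟩ := wsum_coprimeFn (P := q.primeFactors) fun r hr => Nat.prime_of_mem_primeFactors hr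
  refine ⟨C, fun y => ?_⟩
  have e : coprimeFn (1 : DirichletCharacter ℂ 1) q.primeFactors = charFn (1 : DirichletCharacter ℂ q) := by
    ext n
    rcases eq_or_ne n 0 with rfl | hn
    · simp
    rw [coprimeFn_one_apply _ hn, charFn_one_apply hn]
    simp only [forall_not_dvd_iff]
  have := hC y
  rw [e] at this
  rw [density_eq]
  push_cast at this ⊢
  exact this

lemma isBigO_log_of_le {f : ℕ → ℂ} {A B : ℝ} (h : ∀ N : ℕ, 2 ≤ N → ‖f N‖ ≤ A + B * Real.log N) :
    f =O[atTop] (fun N : ℕ => Real.log N) := by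
  have h2 : 0 < Real.log 2 := Real.log_pos (by norm_num)
  refine IsBigO.of_bound (|A| / Real.log 2 + B) ?_
  filter_upwards [eventually_ge_atTop 2] with N hN
  have hl : Real.log 2 ≤ Real.log N := Real.log_le_log (by norm_num) (by exact_mod_cast hN)
  rw [Real.norm_eq_abs, abs_of_nonneg (h2.le.trans hl)]
  refine (h N hN).trans ?_
  have : A ≤ |A| / Real.log 2 * Real.log N := by
    rw [div_mul_eq_mul_div, le_div_iff₀ h2]
    nlinarith [abs_nonneg A, le_abs_self A]
  linarith

lemma norm_charFn_div_le {N : ℕ} (χ : DirichletCharacter ℂ N) (n : ℕ) :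
    ‖charFn χ n / n‖ ≤ 1 / n := by
  rw [norm_div, Complex.norm_natCast]
  gcongr
  rcases eq_or_ne n 0 with rfl | hn
  · simp
  · rw [charFn_apply _ hn]
    exact χ.norm_le_one _

lemma two_mul_sum_mul_wsum (f : ArithmeticFunction ℂ) (N : ℕ) :
    2 * ∑ n ∈ Icc 1 N, f n / n * wsum f n = wsum f N ^ 2 + ∑ n ∈ Icc 1 N, (f n / n) ^ 2 := by
  induction N with
  | zero => simp [wsum]
  | succ N ih =>
    have e : wsum f (N + 1) = wsum f N + f (N + 1) / ((N + 1 : ℕ) : ℂ) :=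
      Finset.sum_Icc_succ_top (by omega) _
    rw [Finset.sum_Icc_succ_top (by omega), Finset.sum_Icc_succ_top (by omega), mul_add, ih, e]
    ring

lemma norm_sum_charFn_mul_le {q : ℕ} (χ : DirichletCharacter ℂ q) {g : ℕ → ℂ} {N : ℕ} {C : ℝ}
    (hC : 0 ≤ C) (h : ∀ n ∈ Icc 1 N, ‖g n‖ ≤ C) :
    ‖∑ n ∈ Icc 1 N, charFn χ n / n * g n‖ ≤ C * (1 + Real.log N) := by
  calc _ ≤ ∑ n ∈ Icc 1 N, 1 / (n:ℝ) * C := (norm_sum_le _ _).trans (sum_le_sum fun n hn => by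
        rw [norm_mul]
        exact mul_le_mul (norm_charFn_div_le χ n) (h n hn) (norm_nonneg _) (by positivity))
    _ = C * ∑ n ∈ Icc 1 N, 1 / (n:ℝ) := by rw [← sum_mul, mul_comm]
    _ ≤ _ := by gcongr; exact sum_one_div_le N

lemma wsum_charFn_one_sq (q : ℕ) [NeZero q] :
    (fun N => wsum (charFn (1 : DirichletCharacter ℂ q) * charFn (1 : DirichletCharacter ℂ q)) N -
      (density q : ℂ) ^ 2 / 2 * (Real.log N : ℂ) ^ 2) =O[atTop] (fun N : ℕ => Real.log N) := by
  obtain ⟨C, hC⟩ := wsum_charFn_one q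
  set f := charFn (1 : DirichletCharacter ℂ q) with hf
  set κ : ℂ := (density q : ℂ) with hκ
  have hC0 : 0 ≤ C := (norm_nonneg _).trans (hC 0)
  set E : ℕ → ℂ := fun y => wsum f y - κ * Real.log y with hE
  set R1 : ℕ → ℂ := fun N => ∑ n ∈ Icc 1 N, f n / n *
    (E (N / n) + κ * ((Real.log ((N / n : ℕ) : ℝ) - (Real.log N - Real.log n) : ℝ) : ℂ)) with hR1
  set R2 : ℕ → ℂ := fun N => ∑ n ∈ Icc 1 N, f n / n * E n with hR2
  set R3 : ℕ → ℂ := fun N => ∑ n ∈ Icc 1 N, (f n / n) ^ 2 with hR3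
  have e1 : ∀ N, wsum (f * f) N - κ ^ 2 / 2 * (Real.log N : ℂ) ^ 2 =
      R1 N - E N ^ 2 / 2 - R3 N / 2 + R2 N := by
    intro N
    have h1 : wsum (f * f) N = R1 N + κ * Real.log N * wsum f N -
        κ * ∑ n ∈ Icc 1 N, f n / n * (Real.log n : ℂ) := by
      rw [wsum_mul, wsum, mul_sum, mul_sum, ← sum_add_distrib, ← sum_sub_distrib]
      refine sum_congr rfl fun n _ => ?_
      simp only [hE]
      push_cast
      ring
    have h2 : κ * ∑ n ∈ Icc 1 N, f n / n * (Real.log n : ℂ) =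
        ∑ n ∈ Icc 1 N, f n / n * wsum f n - R2 N := by
      rw [mul_sum, ← sum_sub_distrib]
      refine sum_congr rfl fun n _ => ?_
      simp only [hE]
      ring
    have h3 := two_mul_sum_mul_wsum f N
    have h4 : wsum f N = E N + κ * Real.log N := by simp only [hE]; ring
    rw [h1, h2]
    rw [h4] at h3 ⊢
    linear_combination (-1/2) * h3
  have hlog : ∀ N n : ℕ, n ∈ Icc 1 N →
      |Real.log ((N / n : ℕ) : ℝ) - (Real.log N - Real.log n)| ≤ Real.log 2 := by
    intro N n hn
    obtain ⟨h1, h2⟩ := mem_Icc.1 hn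
    have h3 : 1 ≤ N / n := (Nat.one_le_div_iff h1).2 h2
    have h4 : N / n * n ≤ N := Nat.div_mul_le_self N n
    have h5 : N ≤ 2 * (N / n * n) := by
      have := Nat.div_add_mod' N n
      have := Nat.mod_lt N h1
      nlinarith
    have hn0 : (n : ℝ) ≠ 0 := by positivity
    have hd0 : ((N / n : ℕ) : ℝ) ≠ 0 := by positivity
    have e : Real.log ((N / n : ℕ) : ℝ) - (Real.log N - Real.log n) =
        Real.log (((N / n * n : ℕ) : ℝ)) - Real.log N := by
      rw [Nat.cast_mul, Real.log_mul hd0 hn0]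
      ring
    have h6 : Real.log ((N / n * n : ℕ) : ℝ) ≤ Real.log N :=
      Real.log_le_log (by positivity) (by exact_mod_cast h4)
    have h7 : Real.log N ≤ Real.log 2 + Real.log ((N / n * n : ℕ) : ℝ) := by
      rw [← Real.log_mul (by norm_num) (by positivity)]
      exact Real.log_le_log (by exact_mod_cast h1.trans h2) (by exact_mod_cast h5)
    rw [e, abs_le]
    constructor <;> linarith
  have h2 : 0 ≤ Real.log 2 := Real.log_nonneg (by norm_num)
  have hR1' : R1 =O[atTop] (fun N : ℕ => Real.log N) := by
    refine isBigO_log_of_le (A := C + ‖κ‖ * Real.log 2) (B := C + ‖κ‖ * Real.log 2) fun N _ => ?_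
    refine (norm_sum_charFn_mul_le _ (C := C + ‖κ‖ * Real.log 2) (by positivity) fun n hn => ?_).trans
      (by linarith)
    refine (norm_add_le _ _).trans (add_le_add (hC _) ?_)
    rw [norm_mul]
    refine mul_le_mul_of_nonneg_left ?_ (norm_nonneg _)
    rw [norm_real, Real.norm_eq_abs]
    exact hlog N n hn
  have hR2' : R2 =O[atTop] (fun N : ℕ => Real.log N) :=
    isBigO_log_of_le (A := C) (B := C) fun N _ =>
      (norm_sum_charFn_mul_le _ hC0 fun n _ => hC n).trans (by linarith)
  have hR3' : R3 =O[atTop] (fun N : ℕ => Real.log N) := by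
    refine isBigO_log_of_le (A := 1) (B := 1) fun N _ => ?_
    simp only [hR3, sq]
    refine (norm_sum_charFn_mul_le _ zero_le_one fun n hn => ?_).trans (by linarith)
    refine (norm_charFn_div_le _ n).trans ?_
    rw [div_le_one (by exact_mod_cast (mem_Icc.1 hn).1)]
    exact_mod_cast (mem_Icc.1 hn).1
  have hE' : (fun N => E N ^ 2) =O[atTop] (fun N : ℕ => Real.log N) := by
    refine isBigO_log_of_le (A := C ^ 2) (B := 0) fun N _ => ?_
    rw [norm_pow, zero_mul, add_zero]
    gcongr
    exact hC N
  simp only [e1]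
  have := ((hR1'.sub (hE'.const_mul_left (1/2))).sub (hR3'.const_mul_left (1/2))).add hR2'
  refine this.congr_left fun N => ?_
  ring

lemma norm_sum_Ico_mul_le {f : ℕ → ℂ} {c : ℕ → ℝ} {B : ℝ} (hB : ∀ n, ‖∑ k ∈ range n, f k‖ ≤ B)
    {z : ℕ} (hc : ∀ n, z ≤ n → c (n + 1) ≤ c n) (hc0 : ∀ n, z ≤ n → 0 ≤ c n) {M : ℕ} (hM : z ≤ M) :
    ‖∑ n ∈ Ico z M, (c n : ℂ) * f n‖ ≤ 2 * B * c z := by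
  have key : ‖∑ n ∈ Ico z M, (c n : ℂ) * f n - c M * ∑ k ∈ range M, f k‖ ≤
      B * (2 * c z - c M) := by
    induction M, hM using Nat.le_induction with
    | base =>
      rw [Ico_self, sum_empty, zero_sub, norm_neg, norm_mul, norm_real, Real.norm_eq_abs,
        abs_of_nonneg (hc0 z le_rfl)]
      nlinarith [hB z, hc0 z le_rfl]
    | succ M hM ih =>
      have e : ∑ n ∈ Ico z (M + 1), (c n : ℂ) * f n - c (M + 1) * ∑ k ∈ range (M + 1), f k =
          (∑ n ∈ Ico z M, (c n : ℂ) * f n - c M * ∑ k ∈ range M, f k) +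
          ((c M - c (M + 1) : ℝ) : ℂ) * ∑ k ∈ range (M + 1), f k := by
        rw [sum_Ico_succ_top hM, sum_range_succ]
        push_cast
        ring
      rw [e]
      refine (norm_add_le _ _).trans ?_
      rw [norm_mul, norm_real, Real.norm_eq_abs, abs_of_nonneg (sub_nonneg.2 (hc M hM))]
      nlinarith [hB (M + 1), hc M hM]
  have h2 : ‖(c M : ℂ) * ∑ k ∈ range M, f k‖ ≤ c M * B := by
    rw [norm_mul, norm_real, Real.norm_eq_abs, abs_of_nonneg (hc0 M hM)]
    exact mul_le_mul_of_nonneg_left (hB M) (hc0 M hM)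
  have := norm_le_insert' (∑ n ∈ Ico z M, (c n : ℂ) * f n) (c M * ∑ k ∈ range M, f k)
  linarith

lemma norm_sum_range_le {q : ℕ} [NeZero q] {ψ : DirichletCharacter ℂ q} (hψ : ψ ≠ 1) (n : ℕ) :
    ‖∑ k ∈ range n, ψ k‖ ≤ q := by
  have hq : 0 < q := NeZero.pos q
  have hper : ∑ k ∈ range q, ψ k = 0 := by
    rw [← MulChar.sum_eq_zero_of_ne_one hψ]
    refine sum_bij (fun k _ => (k : ZMod q)) (fun _ _ => mem_univ _) ?_ ?_ (fun _ _ => rfl)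
    · intro a ha b hb h
      rw [ZMod.natCast_eq_natCast_iff'] at h
      rwa [Nat.mod_eq_of_lt (mem_range.1 ha), Nat.mod_eq_of_lt (mem_range.1 hb)] at h
    · intro b _
      exact ⟨b.val, mem_range.2 (ZMod.val_lt b), by simp⟩
  induction n using Nat.strong_induction_on with
  | _ n ih =>
    rcases le_or_gt n q with h | h
    · calc _ ≤ ∑ k ∈ range n, (1:ℝ) := (norm_sum_le _ _).trans (sum_le_sum fun k _ => ψ.norm_le_one _)
        _ ≤ q := by simpa using h
    · obtain ⟨m, rfl⟩ := Nat.exists_eq_add_of_le h.le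
      rw [sum_range_add, hper, zero_add]
      simpa using ih m (by omega)

lemma norm_wsum_charFn_sub_le {q : ℕ} [NeZero q] {ψ : DirichletCharacter ℂ q} (hψ : ψ ≠ 1) {z : ℕ}
    (hz : 1 ≤ z) : ‖wsum (charFn ψ) z - ψ.LFunction 1‖ ≤ 2 * q / z := by
  have h1 : ∀ s : ℝ, 1 < s →
      ‖∑ n ∈ Icc 1 z, ψ n * ((n : ℂ) ^ (-(s : ℂ))) - ψ.LFunction s‖ ≤ 2 * q / z := by
    intro s hs
    have hs' : 1 < (s : ℂ).re := by simpa using hs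
    have hsum := (ψ.LSeriesSummable_of_one_lt_re hs').hasSum
    have hL : LSeries (fun n => ψ n) s = ψ.LFunction s := (ψ.LFunction_eq_LSeries hs').symm
    have ht := hsum.tendsto_sum_nat
    have ht' : Tendsto (fun M => ∑ n ∈ range M, LSeries.term (fun n => ψ n) s n) atTop
        (𝓝 (ψ.LFunction s)) := by
      rw [← hL]
      exact ht
    have h0 : ∑ n ∈ Icc 1 z, ψ n * ((n : ℂ) ^ (-(s : ℂ))) =
        ∑ n ∈ range (z + 1), LSeries.term (fun n => ψ n) s n := by
      rw [range_eq_Ico, sum_eq_sum_Ico_succ_bot (by omega), LSeries.term_zero, zero_add]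
      refine sum_congr (by ext; simp) fun n hn => ?_
      rw [LSeries.term_of_ne_zero (by have := (mem_Ico.1 hn).1; omega), cpow_neg, div_eq_mul_inv]
    refine le_of_tendsto (((ht'.const_sub _).norm)) ?_
    filter_upwards [eventually_ge_atTop (z + 1)] with M hM
    rw [h0, norm_sub_rev, ← sum_Ico_eq_sub _ hM]
    have e : ∑ n ∈ Ico (z + 1) M, LSeries.term (fun n => ψ n) s n =
        ∑ n ∈ Ico (z + 1) M, (((n : ℝ) ^ (-s) : ℝ) : ℂ) * ψ n := by
      refine sum_congr rfl fun n hn => ?_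
      rw [LSeries.term_of_ne_zero (by have := (mem_Ico.1 hn).1; omega), ofReal_cpow (by positivity),
        ofReal_neg, ofReal_natCast, cpow_neg, div_eq_inv_mul]
    rw [e]
    refine (norm_sum_Ico_mul_le (c := fun n : ℕ => (n:ℝ) ^ (-s)) (norm_sum_range_le hψ) ?_ ?_ hM).trans ?_
    · intro n hn
      have : (0:ℝ) < n := by exact_mod_cast (by omega : 0 < n)
      exact Real.rpow_le_rpow_of_nonpos this (by push_cast; linarith) (by linarith)
    · intro n _
      positivity
    · rw [div_eq_mul_inv]
      refine mul_le_mul_of_nonneg_left ?_ (by positivity)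
      have hz' : (1:ℝ) ≤ z := by exact_mod_cast hz
      calc ((z + 1 : ℕ) : ℝ) ^ (-s) ≤ (z : ℝ) ^ (-s) :=
            Real.rpow_le_rpow_of_nonpos (by linarith) (by push_cast; linarith) (by linarith)
        _ ≤ (z : ℝ) ^ (-1 : ℝ) := Real.rpow_le_rpow_of_exponent_le hz' (by linarith)
        _ = (z : ℝ)⁻¹ := Real.rpow_neg_one _
  have hcont : Tendsto (fun s : ℝ => ‖∑ n ∈ Icc 1 z, ψ n * ((n : ℂ) ^ (-(s : ℂ))) - ψ.LFunction s‖)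
      (𝓝[>] 1) (𝓝 ‖∑ n ∈ Icc 1 z, ψ n * ((n : ℂ) ^ (-((1:ℝ) : ℂ))) - ψ.LFunction ((1:ℝ):ℂ)‖) := by
    have : Continuous (fun s : ℝ => ‖∑ n ∈ Icc 1 z, ψ n * ((n : ℂ) ^ (-(s : ℂ))) - ψ.LFunction s‖) := by
      refine Continuous.norm (Continuous.sub (continuous_finsetSum _ fun n hn => ?_) ?_)
      · refine continuous_const.mul ?_
        have : (n : ℂ) ≠ 0 := by
          have := (mem_Icc.1 hn).1
          exact_mod_cast (by omega : n ≠ 0)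
        exact Continuous.const_cpow (by fun_prop) (Or.inl this)
      · exact (DirichletCharacter.differentiable_LFunction hψ).continuous.comp continuous_ofReal
    exact this.continuousAt.tendsto.mono_left nhdsWithin_le_nhds
  have := le_of_tendsto hcont (by filter_upwards [self_mem_nhdsWithin] with s hs using h1 s hs)
  rw [ofReal_one] at this
  refine le_of_eq_of_le (congrArg (fun w => ‖w - ψ.LFunction 1‖) (sum_congr rfl fun n hn => ?_)) this
  rw [charFn_apply _ (by have := (mem_Icc.1 hn).1; omega), cpow_neg_one, div_eq_mul_inv]

lemma sum_Icc_div_eq_ite (F G : ℕ → ℂ) (y z : ℕ) (hz : z ≤ y) :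
    ∑ d ∈ Icc 1 z, F d * ∑ e ∈ Icc 1 (y / d), G e =
      ∑ d ∈ Icc 1 y, ∑ e ∈ Icc 1 y, if d ≤ z ∧ d * e ≤ y then F d * G e else 0 := by
  have h1 : Icc 1 z = (Icc 1 y).filter (fun d => d ≤ z) := by ext; simp; omega
  rw [h1, sum_filter]
  refine sum_congr rfl fun d hd => ?_
  have hd1 : 0 < d := (mem_Icc.1 hd).1
  split_ifs with h
  · have h2 : Icc 1 (y / d) = (Icc 1 y).filter (fun e => d * e ≤ y) := by
      ext e
      simp only [mem_Icc, mem_filter, Nat.le_div_iff_mul_le hd1]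
      constructor
      · rintro ⟨h1, h2⟩
        refine ⟨⟨h1, ?_⟩, by linarith⟩
        nlinarith
      · rintro ⟨⟨h1, _⟩, h2⟩
        exact ⟨h1, by linarith⟩
    rw [h2, sum_filter, mul_sum]
    exact sum_congr rfl fun e _ => by split_ifs <;> simp_all
  · exact (sum_eq_zero fun e _ => if_neg fun h' => h h'.1).symm

/-- The Dirichlet hyperbola method. -/
lemma wsum_mul_hyperbola (f g : ArithmeticFunction ℂ) {y z : ℕ} (h1 : z * z ≤ y)
    (h2 : y < (z + 1) * (z + 1)) :
    wsum (f * g) y = ∑ d ∈ Icc 1 z, f d / d * wsum g (y / d) +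
      ∑ d ∈ Icc 1 z, g d / d * wsum f (y / d) - wsum f z * wsum g z := by
  have hz : z ≤ y := by nlinarith
  have e1 : wsum (f * g) y = ∑ d ∈ Icc 1 y, ∑ e ∈ Icc 1 y,
      if d ≤ y ∧ d * e ≤ y then f d / d * (g e / e) else 0 := by
    rw [wsum_mul]
    exact sum_Icc_div_eq_ite (fun d => f d / d) (fun d => g d / d) y y le_rfl
  have e2 : ∑ d ∈ Icc 1 z, f d / d * wsum g (y / d) = ∑ d ∈ Icc 1 y, ∑ e ∈ Icc 1 y,
      if d ≤ z ∧ d * e ≤ y then f d / d * (g e / e) else 0 :=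
    sum_Icc_div_eq_ite (fun d => f d / d) (fun d => g d / d) y z hz
  have e3 : ∑ d ∈ Icc 1 z, g d / d * wsum f (y / d) = ∑ d ∈ Icc 1 y, ∑ e ∈ Icc 1 y,
      if e ≤ z ∧ d * e ≤ y then f d / d * (g e / e) else 0 := by
    refine (sum_Icc_div_eq_ite (fun d => g d / d) (fun d => f d / d) y z hz).trans ?_
    rw [sum_comm]
    refine sum_congr rfl fun d _ => sum_congr rfl fun e _ => ?_
    rw [mul_comm e d, mul_comm (g e / e)]
  have e4 : wsum f z * wsum g z = ∑ d ∈ Icc 1 y, ∑ e ∈ Icc 1 y,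
      if d ≤ z ∧ e ≤ z then f d / d * (g e / e) else 0 := by
    have h1 : Icc 1 z = (Icc 1 y).filter (fun d => d ≤ z) := by ext; simp; omega
    rw [wsum, wsum, sum_mul_sum, h1, sum_filter]
    refine sum_congr rfl fun d _ => ?_
    split_ifs with h
    · rw [sum_filter]
      exact sum_congr rfl fun e _ => by simp [h]
    · exact (sum_eq_zero fun e _ => if_neg fun h' => h h'.1).symm
  rw [e1, e2, e3, e4, ← sum_add_distrib, ← sum_sub_distrib]
  refine sum_congr rfl fun d hd => ?_
  rw [← sum_add_distrib, ← sum_sub_distrib]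
  refine sum_congr rfl fun e he => ?_
  have hdy := (mem_Icc.1 hd).2
  by_cases hd' : d ≤ z <;> by_cases he' : e ≤ z
  · have : d * e ≤ y := (Nat.mul_le_mul hd' he').trans h1
    simp [hd', he', hdy, this]
  · simp [hd', he', hdy]
  · simp [hd', he', hdy]
  · have : ¬ d * e ≤ y := by
      have := Nat.mul_le_mul (not_le.1 hd') (not_le.1 he')
      simp only [Nat.succ_eq_add_one] at this
      omega
    simp [hd', he', this]

lemma norm_wsum_mul_sub_le {f g : ArithmeticFunction ℂ} {a b : ℂ} {B : ℝ}
    (hf1 : ∀ n : ℕ, ‖f n / n‖ ≤ 1 / n) (hg1 : ∀ n : ℕ, ‖g n / n‖ ≤ 1 / n)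
    (hf : ∀ z : ℕ, 1 ≤ z → ‖wsum f z - a‖ ≤ B / z) (hg : ∀ z : ℕ, 1 ≤ z → ‖wsum g z - b‖ ≤ B / z)
    {y : ℕ} (hy : 1 ≤ y) :
    ‖wsum (f * g) y - a * b‖ ≤ 2 * B * (4 + B) / √y := by
  have hB : 0 ≤ B := by simpa using (norm_nonneg _).trans (hf 1 le_rfl)
  set z := Nat.sqrt y with hz
  have h1 : z * z ≤ y := Nat.sqrt_le y
  have h2 : y < (z + 1) * (z + 1) := Nat.lt_succ_sqrt y
  have hz1 : 1 ≤ z := Nat.sqrt_pos.2 hy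
  have hzr : (1:ℝ) ≤ z := by exact_mod_cast hz1
  have hy0 : (0:ℝ) < y := by exact_mod_cast hy
  have key : ∀ f g : ArithmeticFunction ℂ, ∀ b : ℂ, (∀ n : ℕ, ‖f n / n‖ ≤ 1 / n) →
      (∀ z : ℕ, 1 ≤ z → ‖wsum g z - b‖ ≤ B / z) →
      ‖∑ d ∈ Icc 1 z, f d / d * wsum g (y / d) - wsum f z * b‖ ≤ 2 * B / z := by
    intro f g b hf1 hg
    rw [wsum, sum_mul, ← sum_sub_distrib]
    calc _ ≤ ∑ d ∈ Icc 1 z, 2 * B / y := by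
          refine (norm_sum_le _ _).trans (sum_le_sum fun d hd => ?_)
          obtain ⟨hd1, hd2⟩ := mem_Icc.1 hd
          have hd0 : (0:ℝ) < d := by exact_mod_cast hd1
          have hdy : 1 ≤ y / d := (Nat.one_le_div_iff hd1).2 (by nlinarith)
          have hq : (0:ℝ) < (y / d : ℕ) := by exact_mod_cast hdy
          have h5 : (y:ℝ) ≤ 2 * ((y / d : ℕ) * d) := by
            have := Nat.div_add_mod' y d
            have := Nat.mod_lt y hd1
            have : y ≤ 2 * (y / d * d) := by nlinarith
            exact_mod_cast this
          rw [← mul_sub, norm_mul]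
          refine (mul_le_mul (hf1 d) (hg _ hdy) (norm_nonneg _) (by positivity)).trans ?_
          rw [div_mul_div_comm, one_mul, div_le_div_iff₀ (by positivity) hy0]
          nlinarith
      _ = z * (2 * B / y) := by simp
      _ ≤ 2 * B / z := by
          rw [mul_div_assoc', div_le_div_iff₀ hy0 (by linarith)]
          have : (z:ℝ) * z ≤ y := by exact_mod_cast h1
          nlinarith
  have k1 := key f g b hf1 hg
  have k2 := key g f a hg1 hf
  have e : wsum (f * g) y - a * b = (∑ d ∈ Icc 1 z, f d / d * wsum g (y / d) - wsum f z * b) +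
      (∑ d ∈ Icc 1 z, g d / d * wsum f (y / d) - wsum g z * a) -
      (wsum f z - a) * (wsum g z - b) := by
    rw [wsum_mul_hyperbola f g h1 h2]
    ring
  have k3 : ‖(wsum f z - a) * (wsum g z - b)‖ ≤ B * B / z := by
    rw [norm_mul]
    refine (mul_le_mul (hf z hz1) (hg z hz1) (norm_nonneg _) (by positivity)).trans ?_
    rw [div_mul_div_comm]
    exact div_le_div_of_nonneg_left (by positivity) (by linarith) (by nlinarith)
  have k4 : √y ≤ 2 * z := by
    rw [Real.sqrt_le_left (by linarith)]
    have : (y:ℝ) ≤ (z + 1) * (z + 1) := by exact_mod_cast h2.le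
    nlinarith
  have hs : 0 < √(y:ℝ) := Real.sqrt_pos.2 hy0
  calc _ ≤ 2 * B / z + 2 * B / z + B * B / z := by
        rw [e]
        exact (norm_sub_le _ _).trans (add_le_add ((norm_add_le _ _).trans (add_le_add k1 k2)) k3)
    _ = B * (4 + B) / z := by ring
    _ ≤ 2 * B * (4 + B) / √y := by
        rw [div_le_div_iff₀ (by linarith) hs]
        have : 0 ≤ B * (4 + B) := by positivity
        nlinarith

open scoped ArithmeticFunction.Moebius

lemma tendsto_wsum_charFn {q : ℕ} [NeZero q] {ψ : DirichletCharacter ℂ q} (hψ : ψ ≠ 1) :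
    Tendsto (wsum (charFn ψ)) atTop (𝓝 (ψ.LFunction 1)) := by
  rw [tendsto_iff_norm_sub_tendsto_zero]
  refine squeeze_zero' (Eventually.of_forall fun _ => norm_nonneg _) ?_
    (tendsto_const_div_atTop_nhds_zero_nat (2 * (q:ℝ)))
  filter_upwards [eventually_ge_atTop 1] with z hz using norm_wsum_charFn_sub_le hψ hz

lemma LFunction_inv_one {q : ℕ} [NeZero q] {ψ : DirichletCharacter ℂ q} (hψ : ψ ≠ 1) :
    ψ⁻¹.LFunction 1 = (starRingEnd ℂ) (ψ.LFunction 1) := by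
  refine tendsto_nhds_unique (tendsto_wsum_charFn (inv_ne_one.2 hψ)) ?_
  refine ((continuous_conj.tendsto _).comp (tendsto_wsum_charFn hψ)).congr fun z => ?_
  rw [Function.comp_apply, wsum, wsum, map_sum]
  refine sum_congr rfl fun n hn => ?_
  have : n ≠ 0 := by have := (mem_Icc.1 hn).1; omega
  rw [charFn_apply _ this, charFn_apply _ this, inv_apply_conj, map_div₀, Complex.conj_natCast]

lemma norm_wsum_charFn_mul_inv_sub_le {q : ℕ} [NeZero q] {ψ : DirichletCharacter ℂ q} (hψ : ψ ≠ 1) :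
    ∃ C, 0 ≤ C ∧ ∀ y : ℕ, 1 ≤ y →
      ‖wsum (charFn ψ * charFn ψ⁻¹) y - (‖ψ.LFunction 1‖ ^ 2 : ℝ)‖ ≤ C / √y := by
  refine ⟨2 * (2 * q) * (4 + 2 * q), by positivity, fun y hy => ?_⟩
  have := norm_wsum_mul_sub_le (norm_charFn_div_le ψ) (norm_charFn_div_le ψ⁻¹)
    (fun z hz => norm_wsum_charFn_sub_le hψ hz)
    (fun z hz => norm_wsum_charFn_sub_le (inv_ne_one.2 hψ) hz) hy
  rwa [LFunction_inv_one hψ, mul_conj, normSq_eq_norm_sq] at this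

lemma sum_antidiagonal_eq_ite (H : ℕ → ℕ → ℂ) {y Y : ℕ} (hY : y ≤ Y) :
    ∑ n ∈ Icc 1 y, ∑ p ∈ n.divisorsAntidiagonal, H p.1 p.2 =
      ∑ s ∈ Icc 1 Y, ∑ t ∈ Icc 1 Y, if s * t ≤ y then H s t else 0 := by
  rw [← sum_product' (f := fun s t => if s * t ≤ y then H s t else 0), ← sum_filter, sum_sigma']
  refine sum_bij' (fun x _ => x.2) (fun p _ => ⟨p.1 * p.2, p⟩) ?_ ?_ ?_ ?_ ?_
  · rintro ⟨n, s, t⟩ h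
    simp only [mem_sigma, mem_Icc, Nat.mem_divisorsAntidiagonal] at h
    obtain ⟨⟨h1, h2⟩, h3, h4⟩ := h
    subst h3
    have hs : 0 < s := Nat.pos_of_ne_zero (left_ne_zero_of_mul h4)
    have ht : 0 < t := Nat.pos_of_ne_zero (right_ne_zero_of_mul h4)
    simp only [mem_filter, mem_product, mem_Icc]
    refine ⟨⟨⟨hs, ?_⟩, ⟨ht, ?_⟩⟩, h2⟩ <;> nlinarith
  · rintro ⟨s, t⟩ h
    simp only [mem_filter, mem_product, mem_Icc] at h
    obtain ⟨⟨⟨hs, _⟩, ⟨ht, _⟩⟩, h2⟩ := h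
    simp only [mem_sigma, mem_Icc, Nat.mem_divisorsAntidiagonal]
    have : 0 < s * t := Nat.mul_pos hs ht
    exact ⟨⟨this, h2⟩, trivial, this.ne'⟩
  · rintro ⟨n, s, t⟩ h
    simp only [mem_sigma, mem_Icc, Nat.mem_divisorsAntidiagonal] at h
    obtain ⟨_, h3, _⟩ := h
    subst h3
    rfl
  · intro p _
    rfl
  · intro p _
    rfl

/-- The arithmetic function `m ↦ ∑ ψ(s) ψ⁻¹(t)` over coprime factorizations `m = st`. -/
noncomputable def coprimeConv {q : ℕ} (ψ : DirichletCharacter ℂ q) : ArithmeticFunction ℂ :=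
  ⟨fun m => ∑ p ∈ m.divisorsAntidiagonal, if p.1.Coprime p.2 then ψ p.1 * ψ⁻¹ p.2 else 0, by simp⟩

lemma coprimeConv_apply {q : ℕ} (ψ : DirichletCharacter ℂ q) (m : ℕ) : coprimeConv ψ m =
    ∑ p ∈ m.divisorsAntidiagonal, if p.1.Coprime p.2 then ψ p.1 * ψ⁻¹ p.2 else 0 := rfl

lemma ite_coprime_eq_sum {s t y : ℕ} (hs : 1 ≤ s) (hsy : s ≤ y) :
    (if s.Coprime t then (1:ℂ) else 0) =
      ∑ k ∈ Icc 1 y, if k ∣ s then (if k ∣ t then (μ k : ℂ) else 0) else 0 := by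
  have h := congrArg (fun f : ArithmeticFunction ℂ => f (s.gcd t))
    (ArithmeticFunction.coe_moebius_mul_coe_zeta (R := ℂ))
  have hg : s.gcd t ≠ 0 := (Nat.gcd_pos_of_pos_left t hs).ne'
  simp only [ArithmeticFunction.coe_mul_zeta_apply, ArithmeticFunction.one_apply] at h
  rw [show (if s.Coprime t then (1:ℂ) else 0) = if s.gcd t = 1 then 1 else 0 from rfl, ← h]
  have e : (s.gcd t).divisors = (Icc 1 y).filter (fun k => k ∣ s ∧ k ∣ t) := by
    ext k
    simp only [Nat.mem_divisors, mem_filter, mem_Icc, Nat.dvd_gcd_iff]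
    constructor
    · rintro ⟨h1, _⟩
      exact ⟨⟨Nat.pos_of_dvd_of_pos h1.1 hs, (Nat.le_of_dvd hs h1.1).trans hsy⟩, h1⟩
    · rintro ⟨_, h1⟩
      exact ⟨h1, hg⟩
  rw [e, sum_filter]
  refine sum_congr rfl fun k _ => ?_
  split_ifs <;> simp_all

lemma wsum_mul_apply_eq (f g : ArithmeticFunction ℂ) {y Y : ℕ} (hY : y ≤ Y) :
    wsum (f * g) y = ∑ s ∈ Icc 1 Y, ∑ t ∈ Icc 1 Y,
      if s * t ≤ y then f s / s * (g t / t) else 0 := by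
  rw [← sum_antidiagonal_eq_ite (fun s t => f s / s * (g t / t)) hY, wsum]
  refine sum_congr rfl fun n _ => ?_
  rw [ArithmeticFunction.mul_apply, sum_div]
  refine sum_congr rfl fun p hp => ?_
  rw [← (Nat.mem_divisorsAntidiagonal.1 hp).1, Nat.cast_mul, mul_div_mul_comm]

set_option maxHeartbeats 800000 in
lemma wsum_coprimeConv {q : ℕ} (ψ : DirichletCharacter ℂ q) (y : ℕ) :
    wsum (coprimeConv ψ) y = ∑ k ∈ Icc 1 y,
      (μ k : ℂ) * charFn (1 : DirichletCharacter ℂ q) k / (k:ℂ) ^ 2 *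
        wsum (charFn ψ * charFn ψ⁻¹) (y / (k * k)) := by
  set F : ℕ → ℂ := fun n => ψ n / n with hF
  set G : ℕ → ℂ := fun n => ψ⁻¹ n / n with hG
  have h1 : wsum (coprimeConv ψ) y = ∑ s ∈ Icc 1 y, ∑ t ∈ Icc 1 y,
      if s * t ≤ y then (if s.Coprime t then 1 else 0) * (F s * G t) else 0 := by
    rw [← sum_antidiagonal_eq_ite (fun s t => (if s.Coprime t then 1 else 0) * (F s * G t)) le_rfl, wsum]
    refine sum_congr rfl fun n _ => ?_
    rw [coprimeConv_apply, sum_div]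
    refine sum_congr rfl fun p hp => ?_
    rw [← (Nat.mem_divisorsAntidiagonal.1 hp).1, Nat.cast_mul]
    split_ifs
    · rw [one_mul, hF, hG, mul_div_mul_comm]
    · simp
  have h2 : wsum (coprimeConv ψ) y = ∑ k ∈ Icc 1 y, (μ k : ℂ) *
      ∑ s ∈ Icc 1 y, if k ∣ s then (∑ t ∈ Icc 1 y, if k ∣ t then
        (if (k * (s / k)) * (k * (t / k)) ≤ y then F (k * (s / k)) * G (k * (t / k)) else 0) else 0)
        else 0 := by
    rw [h1]
    have : ∀ H : ℕ → ℕ → ℂ, ∑ k ∈ Icc 1 y, (μ k : ℂ) * ∑ s ∈ Icc 1 y, H k s =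
        ∑ s ∈ Icc 1 y, ∑ k ∈ Icc 1 y, (μ k : ℂ) * H k s := fun H => by
      simp only [mul_sum]
      exact sum_comm
    rw [this]
    refine sum_congr rfl fun s hs => ?_
    have e : ∀ t ∈ Icc 1 y, (if s * t ≤ y then (if s.Coprime t then (1:ℂ) else 0) * (F s * G t) else 0) =
        ∑ k ∈ Icc 1 y, (μ k : ℂ) * (if k ∣ s then (if k ∣ t then
          (if s * t ≤ y then F s * G t else 0) else 0) else 0) := by
      intro t _
      rw [ite_coprime_eq_sum (mem_Icc.1 hs).1 (mem_Icc.1 hs).2, sum_mul]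
      by_cases h : s * t ≤ y
      · simp only [h, if_true]
        refine sum_congr rfl fun k _ => ?_
        split_ifs <;> simp
      · simp [h]
    rw [sum_congr rfl e, sum_comm]
    refine sum_congr rfl fun k _ => ?_
    rw [← mul_sum]
    congr 1
    split_ifs with hks
    · refine sum_congr rfl fun t _ => ?_
      by_cases hkt : k ∣ t
      · rw [if_pos hkt, if_pos hkt, Nat.mul_div_cancel' hks, Nat.mul_div_cancel' hkt]
      · rw [if_neg hkt, if_neg hkt]
    · exact sum_const_zero
  rw [h2]
  refine sum_congr rfl fun k hk => ?_
  have hk1 : 1 ≤ k := (mem_Icc.1 hk).1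
  have hk0 : k ≠ 0 := by omega
  rw [sum_ite_dvd hk1 (fun s' => ∑ t ∈ Icc 1 y, if k ∣ t then
        (if (k * s') * (k * (t / k)) ≤ y then F (k * s') * G (k * (t / k)) else 0) else 0) y]
  have e : ∀ s' ∈ Icc 1 (y / k), (∑ t ∈ Icc 1 y, if k ∣ t then
        (if (k * s') * (k * (t / k)) ≤ y then F (k * s') * G (k * (t / k)) else 0) else 0) =
      ∑ t ∈ Icc 1 (y / k), if (k * s') * (k * t) ≤ y then F (k * s') * G (k * t) else 0 := fun s' _ =>
    sum_ite_dvd hk1 (fun t' => if (k * s') * (k * t') ≤ y then F (k * s') * G (k * t') else 0) y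
  rw [sum_congr rfl e, wsum_mul_apply_eq (Y := y / k) _ _
    (Nat.div_le_div_left (Nat.le_mul_of_pos_left k hk1) hk1), mul_div_assoc, mul_assoc]
  congr 1
  rw [mul_sum]
  refine sum_congr rfl fun s hs => ?_
  rw [mul_sum]
  refine sum_congr rfl fun t ht => ?_
  have hs0 : s ≠ 0 := by have := (mem_Icc.1 hs).1; omega
  have ht0 : t ≠ 0 := by have := (mem_Icc.1 ht).1; omega
  have hiff : (k * s) * (k * t) ≤ y ↔ s * t ≤ y / (k * k) := by
    rw [Nat.le_div_iff_mul_le (Nat.mul_pos hk1 hk1)]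
    constructor <;> intro h <;> nlinarith
  simp only [hiff]
  split_ifs
  · rw [charFn_apply _ hs0, charFn_apply _ ht0, charFn_apply _ hk0]
    simp only [hF, hG]
    have : (1 : DirichletCharacter ℂ q) (k : ZMod q) = ψ k * ψ⁻¹ k := by
      rw [← MulChar.mul_apply, mul_inv_cancel]
    rw [this]
    push_cast
    rw [map_mul, map_mul]
    ring
  · simp

/-- The density of the squarefree integers after removing the Euler factors at the primes
dividing `q`, i.e. `∑ μ(k) / k²` over `k` coprime to `q`. -/
noncomputable def sqfreeDensity (q : ℕ) : ℝ :=
  6 / π ^ 2 * (∏ p ∈ q.primeFactors, (1 - ((p : ℝ) ^ 2)⁻¹))⁻¹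

lemma hasSum_moebius_div_sq (q : ℕ) [NeZero q] :
    HasSum (fun k : ℕ => (μ k : ℂ) * charFn (1 : DirichletCharacter ℂ q) k / (k:ℂ) ^ 2)
      (sqfreeDensity q : ℂ) := by
  have h2 : 1 < (2:ℂ).re := by norm_num
  set χ := (1 : DirichletCharacter ℂ q) with hχ
  have hs : LSeriesSummable ((fun n : ℕ => χ n) * fun n : ℕ => (μ n : ℂ)) 2 :=
    DirichletCharacter.LSeriesSummable_mul χ (ArithmeticFunction.LSeriesSummable_moebius_iff.mpr h2)
  have h1 := DirichletCharacter.LSeries.mul_mu_eq_one χ h2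
  have h3 : LSeries (fun n : ℕ => χ n) 2 =
      (∏ p ∈ q.primeFactors, (1 - ((p : ℂ) ^ 2)⁻¹)) * (π ^ 2 / 6) := by
    rw [← DirichletCharacter.LFunction_eq_LSeries χ h2, ← riemannZeta_two]
    refine (DirichletCharacter.LFunctionTrivChar_eq_mul_riemannZeta (N := q) (by norm_num)).trans ?_
    congr 1
    refine prod_congr rfl fun p _ => ?_
    rw [cpow_neg]
    norm_num
  have h4 : LSeries ((fun n : ℕ => χ n) * fun n : ℕ => (μ n : ℂ)) 2 = (sqfreeDensity q : ℂ) := by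
    have hne : LSeries (fun n : ℕ => χ n) 2 ≠ 0 := left_ne_zero_of_mul (h1.trans_ne one_ne_zero)
    have : LSeries ((fun n : ℕ => χ n) * fun n : ℕ => (μ n : ℂ)) 2 =
        (LSeries (fun n : ℕ => χ n) 2)⁻¹ := eq_inv_of_mul_eq_one_right h1
    rw [this, h3, sqfreeDensity]
    push_cast
    rw [mul_inv, inv_div, mul_comm]
  rw [← h4]
  convert! hs.hasSum using 1
  funext k
  rcases eq_or_ne k 0 with rfl | hk
  · simp
  · rw [LSeries.term_of_ne_zero hk, charFn_apply _ hk, Pi.mul_apply, mul_comm (μ k : ℂ), cpow_ofNat]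

lemma norm_charFn_le {q : ℕ} (χ : DirichletCharacter ℂ q) (n : ℕ) : ‖charFn χ n‖ ≤ 1 := by
  rcases eq_or_ne n 0 with rfl | hn
  · simp
  · rw [charFn_apply _ hn]
    exact χ.norm_le_one _

lemma norm_wsum_div_sq_sub_le {f : ArithmeticFunction ℂ} {L C : ℝ} (hL : 0 ≤ L) (hC : 0 ≤ C)
    (h : ∀ y : ℕ, 1 ≤ y → ‖wsum f y - L‖ ≤ C / √y) {y k : ℕ} (hy : 1 ≤ y) (hk : 1 ≤ k) :
    ‖wsum f (y / (k * k)) - L‖ ≤ (2 * C + L) * ((k:ℝ) ^ (1 / 2 : ℝ) * (y:ℝ) ^ (-1 / 4 : ℝ)) := by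
  have hy0 : (0:ℝ) < y := by exact_mod_cast hy
  have hk0 : (0:ℝ) < k := by exact_mod_cast hk
  set r : ℝ := (k:ℝ) ^ (1 / 2 : ℝ) * (y:ℝ) ^ (-1 / 4 : ℝ) with hr
  have hr0 : 0 < r := by positivity
  have hr4 : r ^ 4 * y = k ^ 2 := by
    rw [hr, mul_pow, ← Real.rpow_natCast, ← Real.rpow_natCast, ← Real.rpow_mul hk0.le,
      ← Real.rpow_mul hy0.le]
    norm_num
    rw [Real.rpow_neg_one]
    field_simp
  rcases Nat.lt_or_ge y (k * k) with hlt | hge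
  · rw [Nat.div_eq_of_lt hlt, wsum, show Icc 1 0 = (∅ : Finset ℕ) from rfl, sum_empty, zero_sub,
      norm_neg, norm_real, Real.norm_eq_abs, abs_of_nonneg hL]
    have : 1 ≤ r := by
      by_contra! hlt1
      have h1 : (y:ℝ) < k * k := by exact_mod_cast hlt
      have h2 : r ^ 4 ≤ 1 := pow_le_one₀ hr0.le hlt1.le
      nlinarith
    nlinarith
  · have h1 : 1 ≤ y / (k * k) := (Nat.one_le_div_iff (Nat.mul_pos hk hk)).2 hge
    refine (h _ h1).trans ?_
    have hm : (y:ℝ) ≤ 2 * ((y / (k * k) : ℕ) * (k * k)) := by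
      have := Nat.div_add_mod' y (k * k)
      have := Nat.mod_lt y (Nat.mul_pos hk hk)
      have : y ≤ 2 * (y / (k * k) * (k * k)) := by nlinarith
      exact_mod_cast this
    set m : ℝ := ((y / (k * k) : ℕ) : ℝ) with hm'
    have hm0 : 0 < m := by
      rw [hm']
      exact_mod_cast h1
    have hle1 : r ≤ 1 := by
      by_contra! hlt1
      have h1 : (k:ℝ) * k ≤ y := by exact_mod_cast hge
      have h2 : 1 < r ^ 4 := one_lt_pow₀ hlt1 (by norm_num)
      nlinarith
    have h5 : 1 ≤ 2 * (m * r ^ 4) := by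
      have : (y:ℝ) ≤ 2 * (m * (r ^ 4 * y)) := by rw [hr4]; linarith
      by_contra! hlt
      nlinarith
    have h6 : 1 ≤ 2 * r * √m := by
      refine le_of_sq_le_sq ?_ (by positivity)
      rw [mul_pow, Real.sq_sqrt hm0.le]
      have : m * r ^ 4 ≤ m * r ^ 2 := by
        refine mul_le_mul_of_nonneg_left (pow_le_pow_of_le_one hr0.le hle1 (by norm_num)) hm0.le
      nlinarith
    rw [div_le_iff₀ (Real.sqrt_pos.2 hm0)]
    have : C * 1 ≤ C * (2 * r * √m) := mul_le_mul_of_nonneg_left h6 hC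
    have : 0 ≤ L * r * √m := by positivity
    nlinarith

lemma norm_wsum_coprimeConv_sub_le {q : ℕ} [NeZero q] {ψ : DirichletCharacter ℂ q} (hψ : ψ ≠ 1) :
    ∃ C, 0 ≤ C ∧ ∀ y : ℕ, 1 ≤ y →
      ‖wsum (coprimeConv ψ) y - (‖ψ.LFunction 1‖ ^ 2 * sqfreeDensity q : ℝ)‖ ≤
        C * (y:ℝ) ^ (-1 / 4 : ℝ) := by
  obtain ⟨C, hC, h⟩ := norm_wsum_charFn_mul_inv_sub_le hψ
  set L : ℝ := ‖ψ.LFunction 1‖ ^ 2 with hL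
  have hL0 : 0 ≤ L := by positivity
  have hsum : Summable (fun k : ℕ => (k:ℝ) ^ (-3 / 2 : ℝ)) := Real.summable_nat_rpow.2 (by norm_num)
  refine ⟨(2 * C + L) * ∑' k : ℕ, (k:ℝ) ^ (-3 / 2 : ℝ),
    mul_nonneg (by positivity) (tsum_nonneg fun k => by positivity), fun y hy => ?_⟩
  set c : ℕ → ℂ := fun k => (μ k : ℂ) * charFn (1 : DirichletCharacter ℂ q) k / (k:ℂ) ^ 2 with hc
  have h1 : HasSum (fun k => c k * wsum (charFn ψ * charFn ψ⁻¹) (y / (k * k)))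
      (wsum (coprimeConv ψ) y) := by
    rw [wsum_coprimeConv]
    refine hasSum_sum_of_ne_finset_zero fun k hk => ?_
    rcases Nat.eq_zero_or_pos k with rfl | hk0
    · simp [hc]
    · have : y < k := by
        by_contra! h'
        exact hk (mem_Icc.2 ⟨hk0, h'⟩)
      rw [Nat.div_eq_of_lt (by nlinarith)]
      simp [wsum]
  have h2 : HasSum (fun k => c k * (L : ℂ)) (sqfreeDensity q * L) :=
    (hasSum_moebius_div_sq q).mul_right _
  have h3 := h1.sub h2
  have h4 := (hsum.hasSum.mul_left ((2 * C + L) * (y:ℝ) ^ (-1 / 4 : ℝ)))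
  have h5 := h3.norm_le_of_bounded h4 fun k => ?_
  · refine (le_of_eq ?_).trans (h5.trans (le_of_eq ?_))
    · push_cast
      rw [mul_comm (L : ℂ)]
    · ring
  · rcases Nat.eq_zero_or_pos k with rfl | hk0
    · simp [hc]
    · have hk0' : (0:ℝ) < k := by exact_mod_cast hk0
      rw [← mul_sub, norm_mul]
      have hck : ‖c k‖ ≤ (k:ℝ) ^ (-2 : ℝ) := by
        rw [hc, norm_div, norm_mul, norm_pow, Complex.norm_natCast, Real.rpow_neg hk0'.le, ← one_div]
        rw [show ((k:ℝ) ^ (2:ℝ)) = (k:ℝ) ^ 2 by norm_cast]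
        gcongr
        refine mul_le_one₀ ?_ (norm_nonneg _) (norm_charFn_le _ k)
        rw [norm_intCast]
        exact_mod_cast ArithmeticFunction.abs_moebius_le_one
      refine (mul_le_mul hck (norm_wsum_div_sq_sub_le hL0 hC h hy hk0) (norm_nonneg _)
        (by positivity)).trans (le_of_eq ?_)
      rw [show (-3 / 2 : ℝ) = -2 + 1 / 2 by norm_num, Real.rpow_add hk0']
      ring

lemma exists_eq_mul_of_mul_eq_mul {d d' e e' : ℕ} (h : d * d' = e * e') (h0 : d * d' ≠ 0) :
    ∃ g s t u : ℕ, 0 < g ∧ 0 < t ∧ s.Coprime t ∧ d = g * s ∧ d' = t * u ∧ e = g * t ∧ e' = s * u := by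
  have hd : 0 < d := Nat.pos_of_ne_zero (left_ne_zero_of_mul h0)
  obtain ⟨g, s, t, hg, hst, hds, het⟩ :=
    Nat.exists_coprime' (m := d) (n := e) (Nat.gcd_pos_of_pos_left e hd)
  have he : 0 < e := Nat.pos_of_ne_zero (left_ne_zero_of_mul (h.symm.trans_ne h0))
  have ht : 0 < t := Nat.pos_of_ne_zero fun h => by simp [h] at het; omega
  have h1 : s * d' = t * e' := by
    refine Nat.eq_of_mul_eq_mul_left hg ?_
    rw [hds, het] at h
    linarith
  obtain ⟨u, rfl⟩ : t ∣ d' := hst.symm.dvd_of_dvd_mul_left (Dvd.intro _ h1.symm)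
  refine ⟨g, s, t, u, hg, ht, hst, by rw [hds, mul_comm], rfl, by rw [het, mul_comm], ?_⟩
  refine Nat.eq_of_mul_eq_mul_left ht ?_
  rw [← h1]
  ring

/-- Pairs of factorizations `n = d d' = e e'` correspond to factorizations `n = (g u) (s t)` with
`s`, `t` coprime, via `d = g s`, `d' = t u`, `e = g t`, `e' = s u`. -/
lemma sum_antidiagonal_sq_eq {n : ℕ} (H : ℕ × ℕ → ℕ × ℕ → ℂ) :
    ∑ p ∈ n.divisorsAntidiagonal, ∑ p' ∈ n.divisorsAntidiagonal, H p p' =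
      ∑ m ∈ n.divisorsAntidiagonal, ∑ x ∈ m.1.divisorsAntidiagonal,
        ∑ z ∈ m.2.divisorsAntidiagonal, if z.1.Coprime z.2 then
          H (x.1 * z.1, z.2 * x.2) (x.1 * z.2, z.1 * x.2) else 0 := by
  have e : ∀ m ∈ n.divisorsAntidiagonal, (∑ x ∈ m.1.divisorsAntidiagonal,
        ∑ z ∈ m.2.divisorsAntidiagonal, if z.1.Coprime z.2 then
          H (x.1 * z.1, z.2 * x.2) (x.1 * z.2, z.1 * x.2) else 0) =
      ∑ w ∈ m.1.divisorsAntidiagonal ×ˢ (m.2.divisorsAntidiagonal.filter fun z => z.1.Coprime z.2),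
        H (w.1.1 * w.2.1, w.2.2 * w.1.2) (w.1.1 * w.2.2, w.2.1 * w.1.2) := by
    intro m _
    rw [sum_product]
    exact sum_congr rfl fun x _ => (sum_filter _ _).symm
  rw [sum_congr rfl e, ← sum_product', sum_sigma']
  symm
  refine sum_bij' (fun w _ => ((w.2.1.1 * w.2.2.1, w.2.2.2 * w.2.1.2),
      (w.2.1.1 * w.2.2.2, w.2.2.1 * w.2.1.2)))
    (fun p _ => ⟨(p.1.1.gcd p.2.1 * (p.1.2 / (p.2.1 / p.1.1.gcd p.2.1)),
        p.1.1 / p.1.1.gcd p.2.1 * (p.2.1 / p.1.1.gcd p.2.1)),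
      ((p.1.1.gcd p.2.1, p.1.2 / (p.2.1 / p.1.1.gcd p.2.1)),
        (p.1.1 / p.1.1.gcd p.2.1, p.2.1 / p.1.1.gcd p.2.1))⟩) ?_ ?_ ?_ ?_ ?_
  · rintro ⟨⟨m1, m2⟩, ⟨g, u⟩, s, t⟩ h
    simp only [mem_sigma, mem_product, mem_filter, Nat.mem_divisorsAntidiagonal] at h
    obtain ⟨⟨h1, h2⟩, ⟨h3, _⟩, ⟨h4, _⟩, _⟩ := h
    subst h3 h4
    simp only [mem_product, Nat.mem_divisorsAntidiagonal]
    refine ⟨⟨?_, h2⟩, ?_, h2⟩ <;> rw [← h1] <;> ring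
  · rintro ⟨⟨d, d'⟩, e, e'⟩ h
    simp only [mem_product, Nat.mem_divisorsAntidiagonal] at h
    obtain ⟨⟨h1, h2⟩, h3, _⟩ := h
    obtain ⟨g, s, t, u, hg, ht, hst, rfl, rfl, rfl, rfl⟩ :=
      exists_eq_mul_of_mul_eq_mul (h1.trans h3.symm) (h1.trans_ne h2)
    have hg0 : g ≠ 0 := hg.ne'
    simp only [Nat.gcd_mul_left, hst.gcd_eq_one, mul_one, Nat.mul_div_cancel_left _ hg,
      Nat.mul_div_cancel_left _ ht, mem_sigma, mem_product, mem_filter, Nat.mem_divisorsAntidiagonal]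
    have h5 : g * u * (s * t) = n := by rw [← h1]; ring
    have h6 := left_ne_zero_of_mul (h5.trans_ne h2)
    have h7 := right_ne_zero_of_mul (h5.trans_ne h2)
    exact ⟨⟨h5, h2⟩, ⟨trivial, h6⟩, ⟨trivial, h7⟩, hst⟩
  · rintro ⟨⟨m1, m2⟩, ⟨g, u⟩, s, t⟩ h
    simp only [mem_sigma, mem_product, mem_filter, Nat.mem_divisorsAntidiagonal] at h
    obtain ⟨⟨h1, h2⟩, ⟨h3, h3'⟩, ⟨h4, h4'⟩, hst⟩ := h
    subst h3 h4
    have hg : 0 < g := Nat.pos_of_ne_zero (left_ne_zero_of_mul h3')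
    have ht : 0 < t := Nat.pos_of_ne_zero (right_ne_zero_of_mul h4')
    simp only [Nat.gcd_mul_left, Nat.Coprime.gcd_eq_one hst, mul_one, Nat.mul_div_cancel_left _ hg,
      Nat.mul_div_cancel_left _ ht]
  · rintro ⟨⟨d, d'⟩, e, e'⟩ h
    simp only [mem_product, Nat.mem_divisorsAntidiagonal] at h
    obtain ⟨⟨h1, h2⟩, h3, _⟩ := h
    obtain ⟨g, s, t, u, hg, ht, hst, rfl, rfl, rfl, rfl⟩ :=
      exists_eq_mul_of_mul_eq_mul (h1.trans h3.symm) (h1.trans_ne h2)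
    simp only [Nat.gcd_mul_left, hst.gcd_eq_one, mul_one, Nat.mul_div_cancel_left _ hg,
      Nat.mul_div_cancel_left _ ht]
  · intro w _
    rfl

lemma norm_sq_charFn_mul_eq {q : ℕ} (χ ν : DirichletCharacter ℂ q) (n : ℕ) :
    ((‖(charFn χ * charFn ν) n‖ ^ 2 : ℝ) : ℂ) =
      (charFn (1 : DirichletCharacter ℂ q) * charFn (1 : DirichletCharacter ℂ q) *
        coprimeConv (χ * ν⁻¹)) n := by
  have hχ : ∀ k : ℕ, (1 : DirichletCharacter ℂ q) (k : ZMod q) = χ k * χ⁻¹ k := fun k => by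
    rw [← MulChar.mul_apply, mul_inv_cancel]
  have hν : ∀ k : ℕ, (1 : DirichletCharacter ℂ q) (k : ZMod q) = ν k * ν⁻¹ k := fun k => by
    rw [← MulChar.mul_apply, mul_inv_cancel]
  have ha : (charFn χ * charFn ν) n = ∑ p ∈ n.divisorsAntidiagonal, χ p.1 * ν p.2 := by
    rw [ArithmeticFunction.mul_apply]
    refine sum_congr rfl fun p hp => ?_
    obtain ⟨h1, h2⟩ := Nat.ne_zero_of_mem_divisorsAntidiagonal hp
    rw [charFn_apply _ h1, charFn_apply _ h2]
  rw [← normSq_eq_norm_sq, ← mul_conj, ha, map_sum, sum_mul_sum, sum_antidiagonal_sq_eq,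
    ArithmeticFunction.mul_apply]
  refine sum_congr rfl fun m _ => ?_
  rw [ArithmeticFunction.mul_apply, coprimeConv_apply, sum_mul_sum]
  refine sum_congr rfl fun x hx => sum_congr rfl fun z _ => ?_
  obtain ⟨h1, h2⟩ := Nat.ne_zero_of_mem_divisorsAntidiagonal hx
  rw [charFn_apply _ h1, charFn_apply _ h2]
  split_ifs
  · rw [hχ x.1, hν x.2, map_mul, ← inv_apply_conj, ← inv_apply_conj, mul_inv, inv_inv]
    simp only [MulChar.mul_apply]
    push_cast
    simp only [map_mul]
    ring
  · simp

lemma sum_rpow_neg_three_quarters_le (y : ℕ) :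
    ∑ g ∈ Icc 1 y, (g:ℝ) ^ (-3 / 4 : ℝ) ≤ 4 * (y:ℝ) ^ (1 / 4 : ℝ) := by
  induction y with
  | zero => simp
  | succ y ih =>
    rw [sum_Icc_succ_top (by omega)]
    have hb0 : (0:ℝ) < (y + 1 : ℕ) := by positivity
    set a : ℝ := (y:ℝ) ^ (1 / 4 : ℝ) with ha
    set b : ℝ := ((y + 1 : ℕ) : ℝ) ^ (1 / 4 : ℝ) with hb
    have ha' : 0 ≤ a := by positivity
    have hb' : 0 < b := by positivity
    have hab : a ≤ b := Real.rpow_le_rpow (by positivity) (by push_cast; linarith) (by norm_num)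
    have ha4 : a ^ 4 = y := by
      rw [ha, ← Real.rpow_natCast, ← Real.rpow_mul (by positivity)]
      norm_num
    have hb4 : b ^ 4 = y + 1 := by
      rw [hb, ← Real.rpow_natCast, ← Real.rpow_mul (by positivity)]
      norm_num
    have hb3 : ((y + 1 : ℕ) : ℝ) ^ (-3 / 4 : ℝ) = (b ^ 3)⁻¹ := by
      rw [hb, ← Real.rpow_natCast, ← Real.rpow_mul hb0.le, ← Real.rpow_neg hb0.le]
      norm_num
    have h1 : (b ^ 3)⁻¹ ≤ 4 * (b - a) := by
      rw [inv_le_iff_one_le_mul₀ (by positivity)]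
      have h2 : (b - a) * (b ^ 3 + b ^ 2 * a + b * a ^ 2 + a ^ 3) = 1 := by
        have : b ^ 4 - a ^ 4 = 1 := by rw [ha4, hb4]; ring
        linarith
      have h3 : b ^ 3 + b ^ 2 * a + b * a ^ 2 + a ^ 3 ≤ 4 * b ^ 3 := by
        have e1 : b ^ 2 * a ≤ b ^ 2 * b := by gcongr
        have e2 : b * a ^ 2 ≤ b * b ^ 2 := by gcongr
        have e3 : a ^ 3 ≤ b ^ 3 := by gcongr
        nlinarith
      nlinarith
    rw [hb3]
    linarith

lemma sum_inv_mul_rpow_le (y : ℕ) :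
    ∑ g ∈ Icc 1 y, 1 / (g:ℝ) * ((y / g : ℕ) : ℝ) ^ (-1 / 4 : ℝ) ≤ 8 := by
  rcases Nat.eq_zero_or_pos y with rfl | hy
  · simp
  have hy0 : (0:ℝ) < y := by exact_mod_cast hy
  calc _ ≤ ∑ g ∈ Icc 1 y, 2 * (y:ℝ) ^ (-1 / 4 : ℝ) * (g:ℝ) ^ (-3 / 4 : ℝ) := by
        refine sum_le_sum fun g hg => ?_
        obtain ⟨h1, h2⟩ := mem_Icc.1 hg
        have hg0 : (0:ℝ) < g := by exact_mod_cast h1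
        have h3 : 1 ≤ y / g := (Nat.one_le_div_iff h1).2 h2
        have h5 : (y:ℝ) / (2 * g) ≤ (y / g : ℕ) := by
          have := Nat.div_add_mod' y g
          have := Nat.mod_lt y h1
          have : y ≤ (y / g) * (2 * g) := by nlinarith
          rw [div_le_iff₀ (by positivity)]
          exact_mod_cast this
        have h6 : ((y / g : ℕ) : ℝ) ^ (-1 / 4 : ℝ) ≤ ((y:ℝ) / (2 * g)) ^ (-1 / 4 : ℝ) :=
          Real.rpow_le_rpow_of_nonpos (by positivity) h5 (by norm_num)
        have h7 : ((y:ℝ) / (2 * g)) ^ (-1 / 4 : ℝ) ≤ 2 * (y:ℝ) ^ (-1 / 4 : ℝ) * (g:ℝ) ^ (1 / 4 : ℝ) := by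
          rw [Real.div_rpow hy0.le (by positivity), Real.mul_rpow (by norm_num) hg0.le,
            div_eq_mul_inv, mul_inv, ← Real.rpow_neg (by norm_num), ← Real.rpow_neg hg0.le]
          have : (2:ℝ) ^ (-(-1 / 4) : ℝ) ≤ 2 ^ (1:ℝ) :=
            Real.rpow_le_rpow_of_exponent_le (by norm_num) (by norm_num)
          rw [Real.rpow_one] at this
          rw [show (1 / 4 : ℝ) = -(-1 / 4) by norm_num, mul_comm (2:ℝ), mul_assoc]
          gcongr
        calc _ ≤ 1 / (g:ℝ) * (2 * (y:ℝ) ^ (-1 / 4 : ℝ) * (g:ℝ) ^ (1 / 4 : ℝ)) :=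
              mul_le_mul_of_nonneg_left (h6.trans h7) (by positivity)
          _ = _ := by
              rw [show (-3 / 4 : ℝ) = -1 + 1 / 4 by norm_num, Real.rpow_add hg0, Real.rpow_neg_one]
              ring
    _ ≤ 2 * (y:ℝ) ^ (-1 / 4 : ℝ) * (4 * (y:ℝ) ^ (1 / 4 : ℝ)) := by
        rw [← mul_sum]
        exact mul_le_mul_of_nonneg_left (sum_rpow_neg_three_quarters_le y) (by positivity)
    _ = 8 * ((y:ℝ) ^ (-1 / 4 : ℝ) * (y:ℝ) ^ (1 / 4 : ℝ)) := by ring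
    _ = 8 := by
        rw [← Real.rpow_add hy0]
        norm_num

lemma sum_norm_sq_div_isBigO {q : ℕ} [NeZero q] {χ ν : DirichletCharacter ℂ q} (hne : χ ≠ ν) :
    ∃ C, 0 ≤ C ∧ ∀ N : ℕ, |∑ k ∈ Icc 1 N, ‖(charFn χ * charFn ν) k‖ ^ 2 / k -
      ‖(χ * ν⁻¹).LFunction 1‖ ^ 2 * sqfreeDensity q * density q ^ 2 / 2 * Real.log N ^ 2| ≤
        C * (1 + Real.log N) := by
  have hψ : χ * ν⁻¹ ≠ 1 := fun h => hne (mul_inv_eq_one.1 h)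
  obtain ⟨C, hC, hb⟩ := norm_wsum_coprimeConv_sub_le hψ
  set b := coprimeConv (χ * ν⁻¹) with hbdef
  set L : ℝ := ‖(χ * ν⁻¹).LFunction 1‖ ^ 2 * sqfreeDensity q with hL
  set f := charFn (1 : DirichletCharacter ℂ q) with hf
  have hE : ∀ y, ‖wsum (f * b) y - L * wsum f y‖ ≤ C * 8 := by
    intro y
    rw [wsum_mul, wsum, mul_sum, ← sum_sub_distrib]
    calc _ ≤ ∑ g ∈ Icc 1 y, C * (1 / (g:ℝ) * ((y / g : ℕ) : ℝ) ^ (-1 / 4 : ℝ)) := by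
          refine (norm_sum_le _ _).trans (sum_le_sum fun g hg => ?_)
          obtain ⟨h1, h2⟩ := mem_Icc.1 hg
          rw [mul_comm (L : ℂ), ← mul_sub, norm_mul]
          refine (mul_le_mul (norm_charFn_div_le _ g) (hb _ ((Nat.one_le_div_iff h1).2 h2))
            (norm_nonneg _) (by positivity)).trans (le_of_eq (by ring))
      _ ≤ C * 8 := by
          rw [← mul_sum]
          exact mul_le_mul_of_nonneg_left (sum_inv_mul_rpow_le y) hC
  have hA : ∀ N : ℕ, ((∑ k ∈ Icc 1 N, ‖(charFn χ * charFn ν) k‖ ^ 2 / k : ℝ) : ℂ) =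
      L * wsum (f * f) N + ∑ m ∈ Icc 1 N, f m / m * (wsum (f * b) (N / m) - L * wsum f (N / m)) := by
    intro N
    have e : ((∑ k ∈ Icc 1 N, ‖(charFn χ * charFn ν) k‖ ^ 2 / k : ℝ) : ℂ) = wsum (f * (f * b)) N := by
      rw [ofReal_sum, wsum]
      refine sum_congr rfl fun k _ => ?_
      rw [ofReal_div, norm_sq_charFn_mul_eq, ofReal_natCast, mul_assoc]
    rw [e, wsum_mul f (f * b), wsum_mul f f, mul_sum, ← sum_add_distrib]
    refine sum_congr rfl fun k _ => ?_
    ring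
  have h1 : (fun N : ℕ => ∑ m ∈ Icc 1 N, f m / m * (wsum (f * b) (N / m) - L * wsum f (N / m)))
      =O[atTop] (fun N : ℕ => Real.log N) :=
    isBigO_log_of_le (A := C * 8) (B := C * 8) fun N _ =>
      (norm_sum_charFn_mul_le _ (by positivity) fun n _ => hE (N / n)).trans (by linarith)
  have h2 := ((wsum_charFn_one_sq q).const_mul_left (L : ℂ)).add h1
  have h3 : (fun N : ℕ => ((∑ k ∈ Icc 1 N, ‖(charFn χ * charFn ν) k‖ ^ 2 / k -
      L * density q ^ 2 / 2 * Real.log N ^ 2 : ℝ) : ℂ)) =O[atTop] (fun N : ℕ => 1 + Real.log N) := by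
    refine (h2.congr_left fun N => ?_).trans (IsBigO.of_bound 1 (Eventually.of_forall fun N => ?_))
    · rw [ofReal_sub, hA]
      push_cast
      ring
    · have := Real.log_natCast_nonneg N
      rw [Real.norm_eq_abs, Real.norm_eq_abs, abs_of_nonneg this, abs_of_nonneg (by linarith)]
      linarith
  obtain ⟨K, hK, h⟩ := bound_of_isBigO_nat_atTop h3
  refine ⟨K, hK.le, fun N => ?_⟩
  have hN := Real.log_natCast_nonneg N
  have := h (x := N) (by positivity)
  rwa [norm_real, Real.norm_eq_abs, Real.norm_eq_abs, abs_of_nonneg (by linarith : 0 ≤ 1 + Real.log N)]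
    at this

lemma logBound_of_sum_div {f : ℕ → ℝ} (hf : ∀ n, 0 ≤ f n) {c C : ℝ} (hc : 0 ≤ c) (hC : 0 ≤ C)
    (h : ∀ N : ℕ, |∑ k ∈ Icc 1 N, f k / k - c * Real.log N ^ 2| ≤ C * (1 + Real.log N)) :
    ∃ A, LogBound f A := by
  set D : ℝ := 2 * C + 2 * c * Real.log 4 with hD
  have hl4 : 0 ≤ Real.log 4 := Real.log_nonneg (by norm_num)
  have hD0 : 0 ≤ D := by positivity
  have hdiff : ∀ x : ℕ, ∑ k ∈ Icc 1 x, f k / k - ∑ k ∈ Icc 1 (x / 2), f k / k ≤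
      D * (1 + Real.log x) := by
    intro x
    have h1 := (abs_le.1 (h x)).2
    have h2 := (abs_le.1 (h (x / 2))).1
    have h3 := (abs_le.1 (abs_log_div_sub_le (y := x) (p := 2) (by norm_num))).1
    have hx := Real.log_natCast_nonneg x
    have hx2 := Real.log_natCast_nonneg (x / 2)
    have h4 : Real.log ((x / 2 : ℕ) : ℝ) ≤ Real.log x := by
      rcases Nat.eq_zero_or_pos (x / 2) with h0 | h0
      · rw [h0, Nat.cast_zero, Real.log_zero]
        exact hx
      · exact Real.log_le_log (by exact_mod_cast h0) (by exact_mod_cast Nat.div_le_self x 2)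
    rw [show (2 * ((2:ℕ):ℝ)) = 4 by norm_num] at h3
    generalize Real.log ((x / 2 : ℕ) : ℝ) = v at *
    generalize Real.log (x : ℝ) = u at *
    have h5 : u ^ 2 - v ^ 2 ≤ Real.log 4 * (2 * u) := by
      calc u ^ 2 - v ^ 2 = (u - v) * (u + v) := by ring
        _ ≤ Real.log 4 * (2 * u) := mul_le_mul (by linarith) (by linarith) (by linarith) hl4
    have h6 := mul_le_mul_of_nonneg_left h5 hc
    have h7 : C * (1 + v) ≤ C * (1 + u) := by gcongr
    have h8 : 0 ≤ c * Real.log 4 := by positivity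
    rw [hD]
    nlinarith
  have hS : ∀ x : ℕ, ∑ n ∈ Icc 1 x, f n ≤ 2 * D * x * (1 + Real.log x) := by
    intro x
    induction x using Nat.strong_induction_on with
    | _ x ih =>
      rcases Nat.eq_zero_or_pos x with rfl | hx
      · simp
      have hx0 : (0:ℝ) < x := by exact_mod_cast hx
      have hlt : x / 2 < x := Nat.div_lt_self hx (by norm_num)
      have hsub : Icc 1 (x / 2) ⊆ Icc 1 x := Icc_subset_Icc le_rfl hlt.le
      have h1 : ∑ n ∈ Icc 1 x, f n ≤ ∑ n ∈ Icc 1 (x / 2), f n +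
          x * (∑ k ∈ Icc 1 x, f k / k - ∑ k ∈ Icc 1 (x / 2), f k / k) := by
        rw [← sum_sdiff hsub, ← sum_sdiff (f := fun k => f k / (k:ℝ)) hsub, add_sub_cancel_right,
          add_comm, mul_sum]
        gcongr with n hn
        have hn' := mem_Icc.1 (mem_sdiff.1 hn).1
        have : (0:ℝ) < n := by exact_mod_cast hn'.1
        rw [mul_div_assoc', le_div_iff₀ this, mul_comm]
        exact mul_le_mul_of_nonneg_right (by exact_mod_cast hn'.2) (hf n)
      have h2 := ih _ hlt
      have h3 := mul_le_mul_of_nonneg_left (hdiff x) hx0.le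
      have h4 : ((x / 2 : ℕ) : ℝ) * (1 + Real.log ((x / 2 : ℕ) : ℝ)) ≤ x / 2 * (1 + Real.log x) := by
        have hx2 := Real.log_natCast_nonneg (x / 2)
        have h5 : Real.log ((x / 2 : ℕ) : ℝ) ≤ Real.log x := by
          rcases Nat.eq_zero_or_pos (x / 2) with h0 | h0
          · rw [h0, Nat.cast_zero, Real.log_zero]
            exact Real.log_natCast_nonneg x
          · exact Real.log_le_log (by exact_mod_cast h0) (by exact_mod_cast Nat.div_le_self x 2)
        exact mul_le_mul Nat.cast_div_le (by linarith) (by linarith) (by positivity)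
      have h5 := mul_le_mul_of_nonneg_left h4 (by positivity : 0 ≤ 2 * D)
      linarith
  have hl2 : 0 < Real.log 2 := Real.log_pos (by norm_num)
  refine ⟨2 * D * (1 / Real.log 2 + 1), fun x hx => (hS x).trans ?_⟩
  have hl : Real.log 2 ≤ Real.log x := Real.log_le_log (by norm_num) (by exact_mod_cast hx)
  have : 1 + Real.log x ≤ (1 / Real.log 2 + 1) * Real.log x := by
    have : 1 ≤ 1 / Real.log 2 * Real.log x := by
      rw [one_div_mul_eq_div, le_div_iff₀ hl2]
      linarith
    linarith
  calc 2 * D * x * (1 + Real.log x) ≤ 2 * D * x * ((1 / Real.log 2 + 1) * Real.log x) := by gcongr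
    _ = _ := by ring

lemma sqfreeDensity_mul_density_sq (q : ℕ) [NeZero q] :
    sqfreeDensity q * density q ^ 2 =
      6 / π ^ 2 * ((q.totient : ℝ) / q) * ∏ p ∈ q.primeFactors, (1 - 1 / ((p : ℝ) + 1)) := by
  have hd : density q ^ 2 = ((q.totient : ℝ) / q) * ∏ p ∈ q.primeFactors, (1 - (p:ℝ)⁻¹) := by
    rw [← density_eq q, density, sq]
  have hp : (∏ p ∈ q.primeFactors, (1 - ((p : ℝ) ^ 2)⁻¹))⁻¹ * ∏ p ∈ q.primeFactors, (1 - (p:ℝ)⁻¹) =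
      ∏ p ∈ q.primeFactors, (1 - 1 / ((p : ℝ) + 1)) := by
    rw [← prod_inv_distrib, ← prod_mul_distrib]
    refine prod_congr rfl fun p hp => ?_
    have h2 : (2:ℝ) ≤ p := by exact_mod_cast (Nat.prime_of_mem_primeFactors hp).two_le
    have h3 : (p:ℝ) ^ 2 - 1 ≠ 0 := by nlinarith
    have h4 : (p:ℝ) + 1 ≠ 0 := by linarith
    have h5 : (p:ℝ) ≠ 0 := by linarith
    have e : 1 - ((p:ℝ) ^ 2)⁻¹ = ((p:ℝ) ^ 2 - 1) / (p:ℝ) ^ 2 := by field_simp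
    rw [e, inv_div]
    field_simp
    ring
  rw [hd, sqfreeDensity, ← hp]
  ring

lemma ringHomComp_conj_eq_inv {q : ℕ} [NeZero q] (ν : DirichletCharacter ℂ q) :
    ν.ringHomComp (starRingEnd ℂ) = ν⁻¹ := by
  ext a
  rw [MulChar.ringHomComp_apply, inv_apply_conj]

lemma mean_square_bound {q : ℕ} [NeZero q] {χ ν : DirichletCharacter ℂ q} (hne : χ ≠ ν) :
    ∃ C, ∀ T : ℝ, 3 ≤ T →
      |(∫ t in T..(2*T), ‖χ.LFunction (1/2 + t * I) * ν.LFunction (1/2 + t * I)‖ ^ 2) -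
        ‖(χ * ν⁻¹).LFunction 1‖ ^ 2 * sqfreeDensity q * density q ^ 2 * T * Real.log T ^ 2| ≤
      C * T * Real.log T := by
  obtain ⟨C, hC, hA⟩ := sum_norm_sq_div_isBigO hne
  set c : ℝ := ‖(χ * ν⁻¹).LFunction 1‖ ^ 2 * sqfreeDensity q * density q ^ 2 with hc
  have hc0 : 0 ≤ c := by
    rw [hc, mul_assoc, sqfreeDensity_mul_density_sq]
    refine mul_nonneg (by positivity) (mul_nonneg (by positivity) (prod_nonneg fun p _ => ?_))
    rw [sub_nonneg, div_le_one (by positivity)]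
    linarith [(Nat.cast_nonneg p : (0:ℝ) ≤ p)]
  obtain ⟨A, hLog⟩ := logBound_of_sum_div (f := fun n => ‖(charFn χ * charFn ν) n‖ ^ 2)
    (fun n => by positivity) (c := c / 2) (by positivity) hC hA
  obtain ⟨K, hK⟩ := mean_square_of_logBound χ ν hLog
  refine ⟨K + (4 * C + 2 * c * Real.log 2), fun T hT => ?_⟩
  set N := ⌊T⌋₊ with hN
  have hT0 : 0 < T := by linarith
  have hNT : (N:ℝ) ≤ T := Nat.floor_le hT0.le
  have hTN : T ≤ N + 1 := (Nat.lt_floor_add_one T).le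
  have hN3 : 3 ≤ N := Nat.le_floor (by exact_mod_cast hT)
  have hN3' : (3:ℝ) ≤ N := by exact_mod_cast hN3
  have h1 := hK T N (by omega) hNT hTN
  have h2 := hA N
  have hl2 : 0 ≤ Real.log 2 := Real.log_nonneg (by norm_num)
  have hlN : 0 ≤ Real.log N := Real.log_natCast_nonneg N
  have hle : Real.log N ≤ Real.log T := Real.log_le_log (by linarith) hNT
  have hge : Real.log T ≤ Real.log 2 + Real.log N := by
    rw [← Real.log_mul (by norm_num) (by linarith)]
    exact Real.log_le_log hT0 (by linarith)
  have hl1 : 1 ≤ Real.log T := by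
    rw [Real.le_log_iff_exp_le hT0]
    linarith [Real.exp_one_lt_d9]
  set S : ℝ := ∑ k ∈ Icc 1 N, ‖(charFn χ * charFn ν) k‖ ^ 2 / k with hS
  set J : ℝ := ∫ t in T..(2*T), ‖χ.LFunction (1/2 + t * I) * ν.LFunction (1/2 + t * I)‖ ^ 2 with hJ
  have h3 : |2 * T * S - c * T * Real.log N ^ 2| ≤ 4 * C * T * Real.log T := by
    have e : 2 * T * S - c * T * Real.log N ^ 2 = 2 * T * (S - c / 2 * Real.log N ^ 2) := by ring
    rw [e, abs_mul, abs_of_pos (by linarith : 0 < 2 * T)]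
    calc _ ≤ 2 * T * (C * (2 * Real.log T)) := by
          refine mul_le_mul_of_nonneg_left (h2.trans ?_) (by linarith)
          exact mul_le_mul_of_nonneg_left (by linarith) hC
      _ = _ := by ring
  have h4 : |c * T * Real.log N ^ 2 - c * T * Real.log T ^ 2| ≤ 2 * c * Real.log 2 * T * Real.log T := by
    have e : c * T * Real.log N ^ 2 - c * T * Real.log T ^ 2 =
        -(c * T * ((Real.log T - Real.log N) * (Real.log T + Real.log N))) := by ring
    have h5 : (Real.log T - Real.log N) * (Real.log T + Real.log N) ≤
        Real.log 2 * (2 * Real.log T) :=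
      mul_le_mul (by linarith) (by linarith) (by linarith) hl2
    have h6 : 0 ≤ (Real.log T - Real.log N) * (Real.log T + Real.log N) :=
      mul_nonneg (by linarith) (by linarith)
    rw [e, abs_neg, abs_of_nonneg (by positivity)]
    calc _ ≤ c * T * (Real.log 2 * (2 * Real.log T)) :=
          mul_le_mul_of_nonneg_left h5 (by positivity)
      _ = _ := by ring
  calc |J - c * T * Real.log T ^ 2|
      = |(J - 2 * T * S) + (2 * T * S - c * T * Real.log N ^ 2) +
          (c * T * Real.log N ^ 2 - c * T * Real.log T ^ 2)| := by congr 1; ring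
    _ ≤ K * T * Real.log T + 4 * C * T * Real.log T + 2 * c * Real.log 2 * T * Real.log T :=
        (abs_add_three _ _ _).trans (add_le_add (add_le_add h1 h3) h4)
    _ = _ := by ring

end MeanSquareL

/-- Mean square of a product of two distinct Dirichlet `L`-functions:
`∫_T^{2T} |L(1/2+it,χ)L(1/2+it,ν)|² dt = D(χ,ν) T (log T)² + O_q(T log T)` with
`D(χ,ν) = (6/π²)|L(1,χν̄)|²(φ(q)/q) ∏_{p ∣ q} (1 − 1/(p+1))`. -/
theorem mean_square_product_L (q : ℕ) [NeZero q] (χ ν : DirichletCharacter ℂ q) (hne : χ ≠ ν) :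
    ∃ C T₀ : ℝ, ∀ T : ℝ, T₀ ≤ T →
      |(∫ t in T..(2*T),
          ‖DirichletCharacter.LFunction χ (1/2 + t * Complex.I) *
            DirichletCharacter.LFunction ν (1/2 + t * Complex.I)‖ ^ 2)
        - (6 / π ^ 2) *
            ‖DirichletCharacter.LFunction (χ * ν.ringHomComp (starRingEnd ℂ)) 1‖ ^ 2 *
            ((q.totient : ℝ) / (q : ℝ)) *
            (∏ p ∈ q.primeFactors, (1 - 1 / ((p : ℝ) + 1))) * T * Real.log T ^ 2|
      ≤ C * T * Real.log T := by
  obtain ⟨C, hC⟩ := MeanSquareL.mean_square_bound hne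
  refine ⟨C, 3, fun T hT => ?_⟩
  have h := hC T hT
  rw [mul_assoc (‖_‖ ^ 2), MeanSquareL.sqfreeDensity_mul_density_sq] at h
  rw [MeanSquareL.ringHomComp_conj_eq_inv]
  convert h using 4
  ring
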